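/- Let n ≥ 1 and d be integers with 1 ≤ d < n, and let E ⊆ ℝⁿ be a closed set which is Ahlfors regular of dimension d, with associated measure μ and regularity constant C. Suppose in addition that (i) E is a d-dimensional topological manifold, i.e. every point of E has an open neighborhood in E which is homeomorphic to an open subset of ℝᵈ, and (ii) E is locally linearly contractible: there is a constant L₁ ≥ 1 such that for every x ∈ E and every radius r with 0 < r ≤ L₁⁻¹ · diam E, the inclusion of E ∩ B(x,r) into E ∩ B(x, L₁ r) is homotopic to a constant map. Then E is uniformly rectifiable: there exists a constant k ≥ 1 such that for every x ∈ E and every r with 0 < r ≤ diam E there is a closed set A ⊆ E ∩ closedBall(x,r) with μ(A) ≥ (9/10)·μ(E ∩ closedBall(x,r)) and a map f : A → ℝᵈ satisfying k⁻¹·|y−z| ≤ |f(y) − f(z)| ≤ k·|y−z| for all y, z ∈ A. -/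

import Mathlib

section
open MeasureTheory Metric Set Filter Topology


abbrev XX (d : ℕ) := Fin d → ℝ
abbrev Sm {E F : Type*} [NormedAddCommGroup E] [NormedSpace ℝ E] [NormedAddCommGroup F]
    [NormedSpace ℝ F] (f : E → F) : Prop := ContDiff ℝ ((⊤:ℕ∞):WithTop ℕ∞) f

lemma two_le_sm : (2 : WithTop ℕ∞) ≤ ((⊤:ℕ∞):WithTop ℕ∞) := WithTop.coe_le_coe.2 le_top

noncomputable def volForm (d : ℕ) : XX d [⋀^Fin d]→L[ℝ] ℝ :=
  { (Pi.basisFun ℝ (Fin d)).det with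
    cont := by
      change Continuous fun v => (Pi.basisFun ℝ (Fin d)).det v
      simp only [Module.Basis.det_apply]
      apply Continuous.matrix_det
      refine continuous_matrix fun i j => ?_
      simp only [Module.Basis.toMatrix_apply, Pi.basisFun_repr]
      fun_prop }

lemma volForm_apply {d : ℕ} (v : Fin d → XX d) : volForm d v = (Pi.basisFun ℝ (Fin d)).det v := rfl

noncomputable def pbF {d : ℕ} (η : XX d → ℝ) (F : XX (d+1) → XX d) (p : XX (d+1)) :
    XX (d+1) [⋀^Fin d]→L[ℝ] ℝ :=
  (η (F p) • volForm d).compContinuousLinearMap (fderiv ℝ F p)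

lemma pbF_contDiff {d : ℕ} {η : XX d → ℝ} {F : XX (d+1) → XX d} (hη : Sm η)
    (hF : Sm F) (v : Fin d → XX (d+1)) : ContDiff ℝ 1 (fun p => pbF η F p v) := by
  have : (fun p => pbF η F p v) = fun p => η (F p) *
      (Matrix.of fun i j => fderiv ℝ F p (v j) i).det := by
    ext p
    simp only [pbF, ContinuousAlternatingMap.compContinuousLinearMap_apply,
      ContinuousAlternatingMap.smul_apply, volForm_apply, Module.Basis.det_apply, smul_eq_mul]
    rfl
  rw [this]
  refine ContDiff.mul ((hη.comp hF).of_le (by simp)) ?_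
  simp only [Matrix.det_apply]
  refine ContDiff.sum fun σ _ => ContDiff.const_smul _ ?_
  refine contDiff_prod fun i _ => ?_
  simp only [Matrix.of_apply]
  have h1 : ContDiff ℝ 1 (fderiv ℝ F) := hF.fderiv_right (m := 1) two_le_sm
  have h2 := h1.clm_apply (contDiff_const (c := v i))
  exact contDiff_pi.1 h2 _

lemma pbF_diff {d : ℕ} {η : XX d → ℝ} {F : XX (d+1) → XX d} (hη : Sm η)
    (hF : Sm F) : Differentiable ℝ (pbF η F) := by
  have h0 : Differentiable ℝ fun p => η (F p) := (hη.comp hF).differentiable (by simp)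
  have h1 : Differentiable ℝ (fderiv ℝ F) := (hF.fderiv_right (m := 1) two_le_sm).differentiable (by simp)
  intro p
  unfold pbF
  have := (h0 p).smul_const (volForm d)
  exact (DifferentiableAt.continuousAlternatingMapCompContinuousLinearMap (f := fun p => η (F p) • volForm d) this (h1 p))

lemma pbF_div {d : ℕ} {η : XX d → ℝ} {F : XX (d+1) → XX d} (hη : Sm η)
    (hF : Sm F) (p : XX (d+1)) :
    ∑ i : Fin (d+1), (-1 : ℝ) ^ (i:ℕ) * fderiv ℝ (fun q => pbF η F q
      (i.removeNth (α := fun _ => XX (d+1)) fun j => Pi.single j 1)) p (Pi.single i 1) = 0 := by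
  have h := extDeriv_apply (ω := pbF η F) (x := p) (pbF_diff hη hF p) (fun j => Pi.single j 1)
  have h2 := extDeriv_pullback (ω := fun x => η x • volForm d) (f := F) (x := p) (r := ((⊤:ℕ∞):WithTop ℕ∞))
    (((hη.differentiable (by simp)) _).smul_const _) hF.contDiffAt (by simpa using two_le_sm)
  change extDeriv (pbF η F) p = _ at h2
  rw [h2] at h
  have h3 : extDeriv (fun x => η x • volForm d) (F p) = 0 := by
    ext v
    apply AlternatingMap.map_linearDependent (extDeriv (fun x => η x • volForm d) (F p)).toAlternatingMap
    intro hl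
    have := hl.fintype_card_le_finrank
    simp at this
  rw [h3] at h
  simpa using h.symm

theorem deg_integral_invariance {d : ℕ} {η : XX d → ℝ} {F : XX (d+1) → XX d} (hη : Sm η)
    (hF : Sm F) {V : Set (XX d)} (hV : IsOpen V) (hb : Bornology.IsBounded V)
    (hfr : ∀ t ∈ Icc (0:ℝ) 1, ∀ x ∈ frontier V, F (Fin.cons t x) ∉ tsupport η) :
    ∫ x in V, η (F (Fin.cons 0 x)) * (fderiv ℝ (fun x => F (Fin.cons 0 x)) x).det =
    ∫ x in V, η (F (Fin.cons 1 x)) * (fderiv ℝ (fun x => F (Fin.cons 1 x)) x).det := by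
  classical
  obtain ⟨R, hR0, hR⟩ := hb.subset_ball_lt 0 0
  set bs : Fin (d+1) → XX (d+1) := fun j => Pi.single j 1
  set T : Set (XX (d+1)) := {p | Fin.tail p ∈ V}
  have htc : Continuous (fun p : XX (d+1) => (Fin.tail p : XX d)) :=
    continuous_pi fun j => continuous_apply _
  have hTo : IsOpen T := hV.preimage htc
  set h : Fin (d+1) → XX (d+1) → ℝ := fun i p =>
    (-1:ℝ)^(i:ℕ) * pbF η F p (i.removeNth (α := fun _ => XX (d+1)) bs)
  have hh : ∀ i, ContDiff ℝ 1 (h i) := fun i => contDiff_const.mul (pbF_contDiff hη hF _)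
  set H : Fin (d+1) → XX (d+1) → ℝ := fun i => T.indicator (h i)
  set H' : Fin (d+1) → XX (d+1) → (XX (d+1) →L[ℝ] ℝ) := fun i => T.indicator (fun p => fderiv ℝ (h i) p)
  have hder : ∀ p : XX (d+1), p 0 ∈ Icc (0:ℝ) 1 → ∀ i, HasFDerivAt (H i) (H' i p) p := by
    intro p hp i
    by_cases hpT : p ∈ T
    · have : H' i p = fderiv ℝ (h i) p := indicator_of_mem hpT _
      rw [this]
      refine (((hh i).differentiable (by simp)) p).hasFDerivAt.congr_of_eventuallyEq ?_
      filter_upwards [hTo.mem_nhds hpT] with q hq using indicator_of_mem hq _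
    · have : H' i p = 0 := indicator_of_notMem hpT _
      rw [this]
      refine (hasFDerivAt_const (0:ℝ) p).congr_of_eventuallyEq ?_
      by_cases hc : (Fin.tail p : XX d) ∈ closure V
      · have h1 : F p ∉ tsupport η := by
          have := hfr (p 0) hp (Fin.tail p) ⟨hc, by rw [hV.interior_eq]; exact hpT⟩
          rwa [Fin.cons_self_tail] at this
        have h2 : ∀ᶠ q in 𝓝 p, F q ∈ (tsupport η)ᶜ :=
          hF.continuous.continuousAt.eventually_mem ((isClosed_tsupport η).isOpen_compl.mem_nhds h1)
        filter_upwards [h2] with q hq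
        have : η (F q) = 0 := image_eq_zero_of_notMem_tsupport hq
        simp [H, h, indicator_apply, pbF, this]
      · have h2 : ∀ᶠ q : XX (d+1) in 𝓝 p, (Fin.tail q : XX d) ∈ (closure V)ᶜ :=
          htc.continuousAt.eventually_mem (isClosed_closure.isOpen_compl.mem_nhds hc)
        filter_upwards [h2] with q hq
        exact indicator_of_notMem (fun hqT : q ∈ T => hq (subset_closure hqT)) (h i)
  have hdiv : ∀ p, ∑ i, H' i p (Pi.single i 1) = 0 := by
    intro p
    by_cases hpT : p ∈ T
    · have h1 : ∀ i, H' i p = fderiv ℝ (h i) p := fun i => indicator_of_mem hpT _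
      simp only [h1]
      rw [← pbF_div hη hF p]
      refine Finset.sum_congr rfl fun i _ => ?_
      simp only [h]
      rw [fderiv_const_mul ((pbF_contDiff hη hF _).differentiable (by simp) p)]
      rfl
    · have h1 : ∀ i, H' i p = 0 := fun i => indicator_of_notMem hpT _
      simp [h1]
  have hside : ∀ p : XX (d+1), (∃ j : Fin d, p j.succ = R ∨ p j.succ = -R) → ∀ i, H i p = 0 := by
    rintro p ⟨j, hj⟩ i
    refine indicator_of_notMem (fun hp => ?_) _
    have h1 := hR hp
    rw [mem_ball_zero_iff, pi_norm_lt_iff hR0] at h1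
    have h2 := h1 j
    rw [Real.norm_eq_abs, abs_lt] at h2
    change -R < p j.succ ∧ p j.succ < R at h2
    rcases hj with hj | hj <;> linarith [h2.1, h2.2]
  set a : XX (d+1) := Fin.cons 0 (fun _ => -R)
  set b : XX (d+1) := Fin.cons 1 (fun _ => R)
  have hab : a ≤ b := by
    intro i
    refine Fin.cases ?_ (fun j => ?_) i
    · simp [a, b]
    · simp [a, b]; linarith
  have key := integral_divergence_of_hasFDerivAt_off_countable' a b hab H H' ∅ countable_empty
    (fun i p hp => ((hder p ⟨by simpa [a] using hp.1 0, by simpa [b] using hp.2 0⟩ i).continuousAt).continuousWithinAt)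
    (fun p hp i => hder p (by
      have := hp.1 0 (mem_univ _)
      simp only [a, b, Fin.cons_zero] at this
      exact ⟨this.1.le, this.2.le⟩) i)
    (by simp only [hdiv]; exact integrableOn_zero)
  simp only [hdiv, integral_zero] at key
  rw [Fin.sum_univ_succ] at key
  have hz : ∀ (i : Fin d) (c : ℝ), (c = R ∨ c = -R) → ∀ x : XX d, H i.succ (i.succ.insertNth (α := fun _ => ℝ) c x) = 0 := by
    intro i c hc x
    exact hside _ ⟨i, by simpa using hc⟩ _
  have hz2 : ∀ i : Fin d, ∀ x : XX d, H i.succ (i.succ.insertNth (α := fun _ => ℝ) (b i.succ) x) = 0 := fun i x =>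
    hz i _ (Or.inl (by simp [b])) x
  have hz3 : ∀ i : Fin d, ∀ x : XX d, H i.succ (i.succ.insertNth (α := fun _ => ℝ) (a i.succ) x) = 0 := fun i x =>
    hz i _ (Or.inr (by simp [a])) x
  simp only [hz2, hz3, integral_zero, sub_zero, Finset.sum_const_zero, add_zero] at key
  have hsub : V ⊆ Icc (a ∘ (0:Fin (d+1)).succAbove) (b ∘ (0:Fin (d+1)).succAbove) := by
    intro x hx
    have h1 := hR hx
    rw [mem_ball_zero_iff, pi_norm_lt_iff hR0] at h1
    constructor <;> intro j <;> have h2 := h1 j <;> rw [Real.norm_eq_abs, abs_lt] at h2 <;>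
      simp [a, b] <;> linarith [h2.1, h2.2]
  have hface : ∀ t : ℝ, ∫ x in Icc (a ∘ (0:Fin (d+1)).succAbove) (b ∘ (0:Fin (d+1)).succAbove),
      H 0 ((0:Fin (d+1)).insertNth (α := fun _ => ℝ) t x) =
      ∫ x in V, η (F (Fin.cons t x)) * (fderiv ℝ (fun x => F (Fin.cons t x)) x).det := by
    intro t
    have : ∀ x : XX d, H 0 ((0:Fin (d+1)).insertNth (α := fun _ => ℝ) t x) =
        V.indicator (fun x => η (F (Fin.cons t x)) * (fderiv ℝ (fun x => F (Fin.cons t x)) x).det) x := by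
      intro x
      rw [Fin.insertNth_zero']
      by_cases hx : x ∈ V
      · rw [indicator_of_mem hx]
        simp only [H]
        rw [indicator_of_mem (by simpa [T] using hx)]
        simp only [h, Fin.val_zero, pow_zero, one_mul, pbF,
          ContinuousAlternatingMap.compContinuousLinearMap_apply,
          ContinuousAlternatingMap.smul_apply, volForm_apply, smul_eq_mul]
        congr 1
        set J : XX d →L[ℝ] XX (d+1) := ContinuousLinearMap.pi (Fin.cons 0 fun j => ContinuousLinearMap.proj j)
        have hJ : HasFDerivAt (fun x : XX d => (Fin.cons t x : XX (d+1))) J x := by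
          rw [hasFDerivAt_pi']
          refine fun i => Fin.cases ?_ (fun j => ?_) i
          · simp only [Fin.cons_zero]
            refine (hasFDerivAt_const t x).congr_fderiv ?_
            ext; simp [J]
          · simp only [Fin.cons_succ]
            exact (ContinuousLinearMap.proj (R := ℝ) (φ := fun _ : Fin d => ℝ) j).hasFDerivAt
        have hcomp := ((hF.differentiable (by simp)) (Fin.cons t x)).hasFDerivAt.comp x hJ
        rw [show (fun x : XX d => F (Fin.cons t x)) = F ∘ (fun x => (Fin.cons t x)) from rfl, hcomp.fderiv]
        have := (Pi.basisFun ℝ (Fin d)).det_comp ((fderiv ℝ F (Fin.cons t x)).comp J).toLinearMap (Pi.basisFun ℝ (Fin d))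
        rw [Module.Basis.det_self, mul_one] at this
        rw [ContinuousLinearMap.det, ← this]
        congr 1
        ext j : 1
        simp only [Function.comp, Fin.removeNth, bs]
        simp only [ContinuousLinearMap.coe_coe, ContinuousLinearMap.comp_apply]
        congr 1
        ext i
        refine Fin.cases ?_ (fun k => ?_) i
        · simp [J]
        · simp [J, Pi.single_apply]
      · rw [indicator_of_notMem hx]
        exact indicator_of_notMem (by simpa [T] using hx) _
    simp only [this]
    rw [setIntegral_indicator hV.measurableSet, inter_eq_right.2 hsub]
  rw [hface, hface] at key
  simp only [a, b, Fin.cons_zero] at key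
  linarith
end

section
open MeasureTheory Metric Set Filter Topology

def Zs {d : ℕ} (g : XX d → XX d) (V : Set (XX d)) (y : XX d) : Set (XX d) := {x ∈ V | g x = y}

structure RegAt {d : ℕ} (g : XX d → XX d) (V : Set (XX d)) (y : XX d) : Prop where
  sm : Sm g
  det : ∀ x ∈ V, g x = y → (fderiv ℝ g x).det ≠ 0
  fr : ∀ x ∈ frontier V, g x ≠ y

noncomputable def sgd {d : ℕ} (g : XX d → XX d) (x : XX d) : ℤ := if 0 < (fderiv ℝ g x).det then 1 else -1

lemma fderiv_det_cont {d : ℕ} {g : XX d → XX d} (hg : Sm g) : Continuous fun x => (fderiv ℝ g x).det :=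
  ContinuousLinearMap.continuous_det.comp (hg.continuous_fderiv (by simp))

lemma Zs_compact {d : ℕ} {g : XX d → XX d} {V : Set (XX d)} {y : XX d} (hg : ContinuousOn g (closure V))
    (hV : IsOpen V) (hb : Bornology.IsBounded V) (hfr : ∀ x ∈ frontier V, g x ≠ y) : IsCompact (Zs g V y) := by
  have h1 : IsCompact (closure V) := hb.isCompact_closure
  have : Zs g V y = closure V ∩ g ⁻¹' {y} := by
    ext x
    constructor
    · exact fun h => ⟨subset_closure h.1, h.2⟩
    · intro h
      refine ⟨?_, h.2⟩
      by_contra hx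
      exact hfr x ⟨h.1, by rwa [hV.interior_eq]⟩ h.2
  rw [this]
  exact h1.of_isClosed_subset (hg.preimage_isClosed_of_isClosed isClosed_closure isClosed_singleton) inter_subset_left

lemma reg_local {d : ℕ} {g : XX d → XX d} (hg : Sm g) {x : XX d} (hx : (fderiv ℝ g x).det ≠ 0) :
    (∃ s ∈ 𝓝 x, InjOn g s) ∧ map g (𝓝 x) = 𝓝 (g x) := by
  set e := (fderiv ℝ g x).toContinuousLinearEquivOfDetNeZero hx
  have hs : HasStrictFDerivAt g (e : XX d →L[ℝ] XX d) x := by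
    have := hg.contDiffAt (x := x) |>.hasStrictFDerivAt (by simp)
    exact this
  refine ⟨⟨_, (hs.toOpenPartialHomeomorph g).open_source.mem_nhds hs.mem_toOpenPartialHomeomorph_source,
    (hs.toOpenPartialHomeomorph g).injOn⟩, hs.map_nhds_eq_of_equiv⟩

lemma RegAt.finite {d : ℕ} {g : XX d → XX d} {V : Set (XX d)} {y : XX d} (h : RegAt g V y)
    (hV : IsOpen V) (hb : Bornology.IsBounded V) : (Zs g V y).Finite := by
  have hc := Zs_compact h.sm.continuous.continuousOn hV hb h.fr
  refine hc.finite ?_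
  rw [isDiscrete_iff_forall_mem_exists_isOpen] 
  intro x hx
  obtain ⟨⟨s, hs, hi⟩, -⟩ := reg_local h.sm (h.det x hx.1 hx.2)
  obtain ⟨u, hu, huo, hxu⟩ := _root_.mem_nhds_iff.1 hs
  refine ⟨u, huo, ?_⟩
  ext z
  constructor
  · rintro ⟨hz, hz2⟩
    exact hi (hu hz) (hu hxu) (hz2.2.trans hx.2.symm)
  · rintro rfl
    exact ⟨hxu, hx⟩

lemma RegAt.integral {d : ℕ} {g : XX d → XX d} {V : Set (XX d)} {y : XX d} (h : RegAt g V y)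
    (hV : IsOpen V) (hb : Bornology.IsBounded V) : ∃ δ > 0, ∀ η : XX d → ℝ, Sm η →
      (∀ z, δ ≤ dist z y → η z = 0) →
      ∫ x in V, η (g x) * (fderiv ℝ g x).det =
        ((∑ x ∈ (h.finite hV hb).toFinset, sgd g x : ℤ) : ℝ) * ∫ z, η z := by
  classical
  obtain ⟨U, hU, hUd⟩ := (h.finite hV hb).t2_separation
  have hdc := fderiv_det_cont h.sm
  have hO : ∀ x ∈ Zs g V y, ∃ O : Set (XX d), IsOpen O ∧ x ∈ O ∧ O ⊆ U x ∧ O ⊆ V ∧ InjOn g O ∧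
      (∀ z ∈ O, (fderiv ℝ g z).det = (sgd g x : ℝ) * |(fderiv ℝ g z).det|) ∧ g '' O ∈ 𝓝 y := by
    intro x hx
    have hdx := h.det x hx.1 hx.2
    obtain ⟨⟨s, hs, hi⟩, hm⟩ := reg_local h.sm hdx
    have h1 : ∀ᶠ z in 𝓝 x, (fderiv ℝ g z).det = (sgd g x : ℝ) * |(fderiv ℝ g z).det| := by
      rcases lt_or_gt_of_ne hdx with hl | hl
      · filter_upwards [hdc.continuousAt.eventually_lt continuousAt_const hl] with z hz
        simp [sgd, not_lt.2 hl.le, abs_of_neg hz]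
      · filter_upwards [continuousAt_const.eventually_lt hdc.continuousAt hl] with z hz
        simp [sgd, hl, abs_of_pos hz]
    obtain ⟨O, hOs, hOo, hxO⟩ := _root_.mem_nhds_iff.1 (inter_mem (inter_mem hs h1)
      (inter_mem ((hU x).2.mem_nhds (hU x).1) (hV.mem_nhds hx.1)))
    refine ⟨O, hOo, hxO, fun z hz => (hOs hz).2.1, fun z hz => (hOs hz).2.2, hi.mono fun z hz => (hOs hz).1.1,
      fun z hz => (hOs hz).1.2, ?_⟩
    rw [← hx.2, ← hm]
    exact image_mem_map (hOo.mem_nhds hxO)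
  choose! O hOo hxO hOU hOV hOi hOs hOn using hO
  set Z := (h.finite hV hb).toFinset with hZ
  have hmem : ∀ x, x ∈ Z ↔ x ∈ Zs g V y := fun x => by simp [hZ]
  set W := ⋃ x ∈ Z, O x with hW
  have hWo : IsOpen W := isOpen_biUnion fun x hx => hOo x ((hmem x).1 hx)
  have hK : IsCompact (closure V \ W) := hb.isCompact_closure.diff hWo
  have hKy : y ∉ g '' (closure V \ W) := by
    rintro ⟨x, ⟨hx, hxW⟩, hxy⟩
    by_cases hxV : x ∈ V
    · exact hxW (mem_biUnion ((hmem x).2 ⟨hxV, hxy⟩) (hxO x ⟨hxV, hxy⟩))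
    · exact h.fr x ⟨hx, by rwa [hV.interior_eq]⟩ hxy
  have hnh : (g '' (closure V \ W))ᶜ ∩ ⋂ x ∈ Z, g '' O x ∈ 𝓝 y :=
    inter_mem ((hK.image h.sm.continuous).isClosed.isOpen_compl.mem_nhds hKy)
      ((Filter.biInter_finset_mem Z).2 fun x hx => hOn x ((hmem x).1 hx))
  obtain ⟨δ, hδ, hδs⟩ := Metric.mem_nhds_iff.1 hnh
  refine ⟨δ, hδ, fun η hη hsupp => ?_⟩
  have hcont : Continuous fun x => η (g x) * (fderiv ℝ g x).det :=
    (hη.continuous.comp h.sm.continuous).mul hdc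
  have hint : ∀ S : Set (XX d), S ⊆ V → IntegrableOn (fun x => η (g x) * (fderiv ℝ g x).det) S := fun S hS =>
    (hcont.continuousOn.integrableOn_compact hb.isCompact_closure).mono_set (hS.trans subset_closure)
  have hWV : W ⊆ V := iUnion₂_subset fun x hx => hOV x ((hmem x).1 hx)
  have e1 : ∫ x in V, η (g x) * (fderiv ℝ g x).det = ∫ x in W, η (g x) * (fderiv ℝ g x).det := by
    refine setIntegral_eq_of_subset_of_forall_sdiff_eq_zero hV.measurableSet hWV fun x hx => ?_
    rw [hsupp, zero_mul]
    by_contra hlt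
    exact (hδs (mem_ball.2 (not_le.1 hlt))).1 ⟨x, ⟨subset_closure hx.1, hx.2⟩, rfl⟩
  have hdisj : (Z : Set (XX d)).Pairwise (Function.onFun Disjoint O) := by
    intro a ha b hb' hab
    exact (hUd ((hmem a).1 ha) ((hmem b).1 hb') hab).mono (hOU a ((hmem a).1 ha)) (hOU b ((hmem b).1 hb'))
  rw [e1, hW, integral_biUnion_finset Z (fun x hx => (hOo x ((hmem x).1 hx)).measurableSet) hdisj
    (fun x hx => hint _ (hOV x ((hmem x).1 hx)))]
  push_cast
  rw [Finset.sum_mul]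
  refine Finset.sum_congr rfl fun x hx => ?_
  have hxz := (hmem x).1 hx
  have e2 : ∫ z in g '' O x, η z = ∫ z in O x, |(fderiv ℝ g z).det| • η (g z) :=
    integral_image_eq_integral_abs_det_fderiv_smul volume (hOo x hxz).measurableSet
      (fun z _ => ((h.sm.differentiable (by simp)) z).hasFDerivAt.hasFDerivWithinAt) (hOi x hxz) η
  have e3 : ∫ z in g '' O x, η z = ∫ z, η z := by
    refine setIntegral_eq_integral_of_forall_compl_eq_zero fun z hz => ?_
    apply hsupp
    by_contra hlt
    exact hz (mem_iInter₂.1 (hδs (mem_ball.2 (not_le.1 hlt))).2 x hx)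
  rw [← e3, e2, ← integral_const_mul]
  refine setIntegral_congr_fun (hOo x hxz).measurableSet fun z hz => ?_
  simp only [smul_eq_mul]
  conv_lhs => rw [hOs x hxz z hz]
  ring

theorem RegAt.parity {d : ℕ} {f g : XX d → XX d} {V : Set (XX d)} {y : XX d} (hf : RegAt f V y) (hg : RegAt g V y)
    (hV : IsOpen V) (hb : Bornology.IsBounded V)
    (hfg : ∀ t ∈ Icc (0:ℝ) 1, ∀ x ∈ frontier V, f x + t • (g x - f x) ≠ y) :
    ((Zs f V y).ncard : ZMod 2) = (Zs g V y).ncard := by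
  obtain ⟨δ1, hδ1, h1⟩ := hf.integral hV hb
  obtain ⟨δ2, hδ2, h2⟩ := hg.integral hV hb
  set F : XX (d+1) → XX d := fun p => f (Fin.tail p) + p 0 • (g (Fin.tail p) - f (Fin.tail p))
  have ht : Sm (fun p : XX (d+1) => (Fin.tail p : XX d)) := contDiff_pi.2 fun j => contDiff_apply _ _ _
  have hF : Sm F := (hf.sm.comp ht).add ((contDiff_apply _ _ _).smul ((hg.sm.comp ht).sub (hf.sm.comp ht)))
  have hfrc : IsCompact (frontier V) := hb.isCompact_closure.of_isClosed_subset isClosed_frontier frontier_subset_closure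
  have hKc : IsCompact ((fun p : ℝ × XX d => f p.2 + p.1 • (g p.2 - f p.2)) '' (Icc 0 1 ×ˢ frontier V)) := by
    refine (isCompact_Icc.prod hfrc).image ?_
    have := hf.sm.continuous
    have := hg.sm.continuous
    fun_prop
  have hyK : y ∉ ((fun p : ℝ × XX d => f p.2 + p.1 • (g p.2 - f p.2)) '' (Icc 0 1 ×ˢ frontier V)) := by
    rintro ⟨⟨t, x⟩, ⟨ht, hx⟩, he⟩
    exact hfg t ht x hx he
  obtain ⟨δ3, hδ3, h3⟩ := Metric.mem_nhds_iff.1 (hKc.isClosed.isOpen_compl.mem_nhds hyK)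
  set δ := min δ1 (min δ2 δ3)
  have hδ : 0 < δ := lt_min hδ1 (lt_min hδ2 hδ3)
  let η : ContDiffBump y := ⟨δ/4, δ/2, by positivity, by linarith⟩
  have hη0 : ∀ z, δ ≤ dist z y → η z = 0 := fun z hz => η.zero_of_le_dist (by
    change δ / 2 ≤ _; linarith)
  have hηs : Sm (η : XX d → ℝ) := η.contDiff
  have k1 := h1 η hηs fun z hz => hη0 z ((min_le_left _ _).trans hz)
  have k2 := h2 η hηs fun z hz => hη0 z (((min_le_right _ _).trans (min_le_left _ _)).trans hz)
  have k3 := deg_integral_invariance (η := η) (F := F) hηs hF hV hb (by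
    intro t ht x hx hmem
    rw [η.tsupport_eq, mem_closedBall] at hmem
    change _ ≤ δ / 2 at hmem
    have h4 : F (Fin.cons t x) ∈ ball y δ3 := mem_ball.2 (hmem.trans_lt (by
      have : δ ≤ δ3 := (min_le_right _ _).trans (min_le_right _ _)
      linarith))
    exact h3 h4 ⟨(t, x), ⟨ht, hx⟩, by simp [F]⟩)
  have e0 : (fun x : XX d => F (Fin.cons 0 x)) = f := by ext x; simp [F]
  have e1 : (fun x : XX d => F (Fin.cons 1 x)) = g := by ext x; simp [F]
  have e0' : ∀ x : XX d, F (Fin.cons 0 x) = f x := fun x => congrFun e0 x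
  have e1' : ∀ x : XX d, F (Fin.cons 1 x) = g x := fun x => congrFun e1 x
  simp only [e0', e1'] at k3
  change ∫ x in V, η (f x) * (fderiv ℝ f x).det = ∫ x in V, η (g x) * (fderiv ℝ g x).det at k3
  rw [k1, k2] at k3
  have hpos : 0 < ∫ z, η z := η.integral_pos
  have k4 := mul_right_cancel₀ hpos.ne' k3
  have k5 : (∑ x ∈ (hf.finite hV hb).toFinset, sgd f x) = ∑ x ∈ (hg.finite hV hb).toFinset, sgd g x := by
    exact_mod_cast k4
  have k6 : ∀ (g : XX d → XX d) x, ((sgd g x : ℤ) : ZMod 2) = 1 := by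
    intro g x; unfold sgd; split_ifs <;> decide
  have k7 := congrArg (Int.cast : ℤ → ZMod 2) k5
  push_cast at k7
  simp only [k6, Finset.sum_const, nsmul_eq_mul, mul_one] at k7
  rw [ncard_eq_toFinset_card _ (hf.finite hV hb), ncard_eq_toFinset_card _ (hg.finite hV hb)]
  exact k7
end

section
open MeasureTheory Metric Set Filter Topology

lemma cpt_pos {α : Type*} [TopologicalSpace α] {K : Set α} (hK : IsCompact K) {f : α → ℝ}
    (hf : ContinuousOn f K) (h : ∀ x ∈ K, 0 < f x) : ∃ m > 0, ∀ x ∈ K, m ≤ f x := by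
  rcases K.eq_empty_or_nonempty with rfl | hne
  · exact ⟨1, one_pos, by simp⟩
  · obtain ⟨x, hx, hm⟩ := hK.exists_isMinOn hne hf
    exact ⟨f x, h x hx, fun z hz => hm hz⟩

lemma cOn_dist {α β : Type*} [TopologicalSpace α] [PseudoMetricSpace β] {f g : α → β} {s : Set α}
    (hf : ContinuousOn f s) (hg : ContinuousOn g s) : ContinuousOn (fun x => dist (f x) (g x)) s :=
  fun x hx => (hf x hx).dist (hg x hx)

lemma tietze {α : Type*} [TopologicalSpace α] [NormalSpace α] {d : ℕ} {K : Set α} (hK : IsClosed K)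
    {f : α → XX d} (hf : ContinuousOn f K) : ∃ g : α → XX d, Continuous g ∧ ∀ x ∈ K, g x = f x := by
  obtain ⟨g, hg⟩ := ContinuousMap.exists_restrict_eq hK (⟨K.domRestrict f, hf.domRestrict⟩ : C(K, XX d))
  exact ⟨g, g.continuous, fun x hx => congrArg (fun h : C(K, XX d) => h ⟨x, hx⟩) hg⟩

lemma smooth_approx {d : ℕ} {K : Set (XX d)} (hK : IsClosed K) {f : XX d → XX d} (hf : ContinuousOn f K)
    {ε : ℝ} (hε : 0 < ε) {Q : Set (XX d)} (hQ : Q.Countable) :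
    ∃ g : XX d → XX d, Sm g ∧ (∀ x ∈ K, dist (g x) (f x) < ε) ∧
      ∀ x, g x ∈ Q → (fderiv ℝ g x).det ≠ 0 := by
  obtain ⟨f', hf', hff⟩ := tietze hK hf
  obtain ⟨h, hh, ha, -⟩ := hf'.exists_contDiff_approx ⊤ (continuous_const (y := ε/2)) (fun _ => by positivity)
  set Cr := h '' {x | (fderiv ℝ h x).det = 0}
  have hCr : volume Cr = 0 := addHaar_image_eq_zero_of_det_fderivWithin_eq_zero (f' := fun x => fderiv ℝ h x) volume
    (fun x _ => ((hh.differentiable (by simp)) x).hasFDerivAt.hasFDerivWithinAt) (fun x hx => hx)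
  have hN : volume (⋃ y ∈ Q, (fun c => y - c) ⁻¹' Cr) = 0 := by
    rw [measure_biUnion_null_iff hQ]
    intro y _
    have := (volume (α := XX d)).measurePreserving_sub_left y
    rw [(this.quasiMeasurePreserving).preimage_null hCr]
  have hpos : 0 < volume (ball (0 : XX d) (ε/2)) := measure_ball_pos _ _ (by positivity)
  obtain ⟨c, hc, hcN⟩ : ∃ c ∈ ball (0 : XX d) (ε/2), c ∉ ⋃ y ∈ Q, (fun c => y - c) ⁻¹' Cr := by
    by_contra hcon
    push Not at hcon
    have := measure_mono_null hcon hN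
    exact hpos.ne' this
  refine ⟨fun x => h x + c, hh.add contDiff_const, fun x hx => ?_, fun x hx hdet => ?_⟩
  · rw [← hff x hx]
    have h1 := ha x
    rw [mem_ball_zero_iff] at hc
    calc dist (h x + c) (f' x) ≤ dist (h x + c) (h x) + dist (h x) (f' x) := dist_triangle _ _ _
      _ < ε/2 + ε/2 := by gcongr; simpa using hc
      _ = ε := by ring
  · apply hcN
    refine mem_biUnion hx ⟨x, ?_, by simp⟩
    rw [fderiv_add_const] at hdet
    exact hdet

structure DegWit {d : ℕ} (f : XX d → XX d) (V : Set (XX d)) (y : XX d) (g : XX d → XX d) : Prop where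
  reg : RegAt g V y
  near : ∀ x ∈ frontier V, dist (g x) (f x) < dist (f x) y

open Classical in
noncomputable def deg {d : ℕ} (f : XX d → XX d) (V : Set (XX d)) (y : XX d) : ZMod 2 :=
  if h : ∃ g, DegWit f V y g then ((Zs h.choose V y).ncard : ZMod 2) else 0

section
variable {d : ℕ} {f f' g : XX d → XX d} {V : Set (XX d)} {y : XX d}

lemma seg_ne {p a b y : XX d} {r : ℝ} (ha : dist a p < r) (hb : dist b p < r) (hy : r ≤ dist p y)
    {t : ℝ} (ht : t ∈ Icc (0:ℝ) 1) : a + t • (b - a) ≠ y := by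
  intro h
  have := (convex_ball p r).add_smul_sub_mem (mem_ball.2 ha) (mem_ball.2 hb) ht
  rw [h, mem_ball, dist_comm] at this
  linarith

lemma DegWit.deg_eq (hV : IsOpen V) (hb : Bornology.IsBounded V) (h : DegWit f V y g) :
    deg f V y = (Zs g V y).ncard := by
  have hex : ∃ g, DegWit f V y g := ⟨g, h⟩
  rw [deg, dif_pos hex]
  exact hex.choose_spec.reg.parity h.reg hV hb fun t ht x hx =>
    seg_ne (hex.choose_spec.near x hx) (h.near x hx) le_rfl ht

lemma DegWit.self (h : RegAt g V y) : DegWit g V y g := ⟨h, fun x hx => by simpa using h.fr x hx⟩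

/-- approximants are witnesses -/
lemma exists_wit (hf' : ContinuousOn f' (closure V)) {ε : ℝ}
    (hε : 0 < ε) (hff : ∀ x ∈ frontier V, dist (f x) (f' x) + ε ≤ dist (f x) y) :
    ∃ g, DegWit f V y g ∧ ∀ x ∈ closure V, dist (g x) (f' x) < ε := by
  obtain ⟨g, hg, hn, hdet⟩ := smooth_approx isClosed_closure hf' hε (countable_singleton y)
  have hnear : ∀ x ∈ frontier V, dist (g x) (f x) < dist (f x) y := fun x hx => by
    have h1 := hn x (frontier_subset_closure hx)
    have h2 := hff x hx
    have := dist_triangle_right (g x) (f x) (f' x)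
    linarith
  refine ⟨g, ⟨⟨hg, fun x _ hx => hdet x hx, fun x hx he => ?_⟩, hnear⟩, hn⟩
  have := hnear x hx
  rw [he, dist_comm] at this
  exact lt_irrefl _ this

lemma deg_hom (hV : IsOpen V) (hb : Bornology.IsBounded V) (hf : ContinuousOn f (frontier V))
    (hf' : ContinuousOn f' (closure V)) (hff : ∀ x ∈ frontier V, dist (f x) (f' x) < dist (f x) y) :
    deg f V y = deg f' V y := by
  have hfrc : IsCompact (frontier V) := hb.isCompact_closure.of_isClosed_subset isClosed_frontier frontier_subset_closure
  have hf'2 := hf'.mono frontier_subset_closure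
  obtain ⟨m, hm, hm2⟩ := cpt_pos hfrc (f := fun x => dist (f x) y - dist (f x) (f' x))
    ((cOn_dist hf continuousOn_const).sub (cOn_dist hf hf'2)) (fun x hx => by linarith [hff x hx])
  obtain ⟨m', hm', hm2'⟩ := cpt_pos hfrc (f := fun x => dist (f' x) y)
    (cOn_dist hf'2 continuousOn_const) (fun x hx => by
      rw [dist_pos]; rintro rfl; exact lt_irrefl _ (hff x hx))
  obtain ⟨g, hg, hgn⟩ := exists_wit (f := f) (y := y) hf' (lt_min hm hm') (fun x hx => by
    have := hm2 x hx; have := min_le_left m m'; linarith)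
  rw [hg.deg_eq hV hb, DegWit.deg_eq (f := f') hV hb ⟨hg.reg, fun x hx =>
    (hgn x (frontier_subset_closure hx)).trans_le ((min_le_right _ _).trans (hm2' x hx))⟩]

lemma deg_add {ι : Type*} (I : Finset ι) (W : ι → Set (XX d)) (hV : IsOpen V) (hb : Bornology.IsBounded V)
    (hf : ContinuousOn f (closure V)) (hW : ∀ i ∈ I, IsOpen (W i)) (hWV : ∀ i ∈ I, W i ⊆ V)
    (hd : (I : Set ι).Pairwise (Function.onFun Disjoint W))
    (hz : ∀ x ∈ closure V, f x = y → ∃ i ∈ I, x ∈ W i) :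
    deg f V y = ∑ i ∈ I, deg f (W i) y := by
  have hK : IsCompact (closure V \ ⋃ i ∈ I, W i) := hb.isCompact_closure.diff (isOpen_biUnion hW)
  obtain ⟨m, hm, hm2⟩ := cpt_pos hK (f := fun x => dist (f x) y)
    (cOn_dist (hf.mono sdiff_subset) continuousOn_const) (fun x hx => by
      rw [dist_pos]
      intro h
      obtain ⟨i, hi, hxi⟩ := hz x hx.1 h
      exact hx.2 (mem_biUnion hi hxi))
  have hfrV : ∀ x ∈ frontier V, x ∈ closure V \ ⋃ i ∈ I, W i := fun x hx => by
    refine ⟨hx.1, fun h => ?_⟩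
    obtain ⟨i, hi, hxi⟩ := mem_iUnion₂.1 h
    exact hx.2 (by rw [hV.interior_eq]; exact hWV i hi hxi)
  have hfrW : ∀ i ∈ I, ∀ x ∈ frontier (W i), x ∈ closure V \ ⋃ i ∈ I, W i := fun i hi x hx => by
    refine ⟨closure_mono (hWV i hi) hx.1, fun h => ?_⟩
    obtain ⟨j, hj, hxj⟩ := mem_iUnion₂.1 h
    by_cases hij : i = j
    · subst hij
      exact hx.2 (by rwa [(hW i hi).interior_eq])
    · have := (hd hi hj hij).closure_left (hW j hj)
      exact this.le_bot ⟨hx.1, hxj⟩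
  obtain ⟨g, hg, hgn⟩ := exists_wit (f := f) (y := y) hf hm (fun x hx => by simpa using hm2 x (hfrV x hx))
  have hgne : ∀ x ∈ closure V \ ⋃ i ∈ I, W i, g x ≠ y := fun x hx h => by
    have h1 := hgn x hx.1
    rw [h, dist_comm] at h1
    linarith [hm2 x hx]
  have hw : ∀ i ∈ I, DegWit f (W i) y g := fun i hi => ⟨⟨hg.reg.sm, fun x hx => hg.reg.det x (hWV i hi hx),
    fun x hx => hgne x (hfrW i hi x hx)⟩, fun x hx => (hgn x (hfrW i hi x hx).1).trans_le (hm2 x (hfrW i hi x hx))⟩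
  rw [hg.deg_eq hV hb, Finset.sum_congr rfl fun i hi => (hw i hi).deg_eq (hW i hi) (hb.subset (hWV i hi))]
  have hZ : Zs g V y = ⋃ i ∈ (I : Set ι), Zs g (W i) y := by
    ext x
    simp only [mem_iUnion₂]
    constructor
    · intro hx
      by_contra hcon
      push Not at hcon
      refine hgne x ⟨subset_closure hx.1, fun h => ?_⟩ hx.2
      obtain ⟨j, hj, hxj⟩ := mem_iUnion₂.1 h
      exact hcon j hj ⟨hxj, hx.2⟩
    · rintro ⟨i, hi, hx⟩
      exact ⟨hWV i hi hx.1, hx.2⟩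
  have hfin := fun i (hi : i ∈ I) => (hw i hi).reg.finite (hW i hi) (hb.subset (hWV i hi))
  have hcard : (Zs g V y).ncard = ∑ i ∈ I, (Zs g (W i) y).ncard := by
    rw [hZ]
    rw [I.finite_toSet.ncard_biUnion (fun i hi => hfin i hi) (fun i hi j hj hij => (hd hi hj hij).mono (fun x hx => hx.1) (fun x hx => hx.1))]
    exact finsum_mem_coe_finset _ _
  rw [hcard]; push_cast; rfl

end
end

section
open MeasureTheory Metric Set Filter Topology

theorem deg_homeo {d : ℕ} (e : OpenPartialHomeomorph (XX d) (XX d)) {V : Set (XX d)} (hV : IsOpen V)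
    (hb : Bornology.IsBounded V) (hVe : closure V ⊆ e.source) {u : XX d} (hu : u ∈ V) :
    deg e V (e u) = 1 := by
  classical
  have hVs : V ⊆ e.source := subset_closure.trans hVe
  set y := e u with hy
  have hnb : e '' V ∈ 𝓝 y := (e.isOpen_image_of_subset_source hV hVs).mem_nhds ⟨u, hu, rfl⟩
  obtain ⟨s2, hs2, hs2b⟩ := nhds_basis_closedBall.mem_iff.1 hnb
  set s := s2 / 2 with hs
  have hs0 : 0 < s := by positivity
  have hs2s : s2 = 2 * s := by rw [hs]; ring
  rw [hs2s] at hs2b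
  have hout : ∀ x ∈ closure V, x ∉ V → 2 * s < dist (e x) y := by
    intro x hx hxV
    by_contra hle
    obtain ⟨x', hx', he⟩ := hs2b (mem_closedBall.2 (not_lt.1 hle))
    exact hxV (e.injOn (hVs hx') (hVe hx) he ▸ hx')
  have htar : closedBall y (2*s) ⊆ e.target := hs2b.trans (by
    rintro _ ⟨x, hx, rfl⟩; exact e.map_source (hVs hx))
  have hsymm : ContinuousOn e.symm (closedBall y (2*s)) := e.continuousOn_symm.mono htar
  have hsub : closedBall y s ⊆ closedBall y (2*s) := closedBall_subset_closedBall (by linarith)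
  have hsph : sphere y s ⊆ closedBall y (2*s) := sphere_subset_closedBall.trans hsub
  have hsu : e.symm y = u := e.left_inv (hVs hu)
  obtain ⟨m, hm, hm2⟩ := cpt_pos (isCompact_sphere y s) (f := fun z => dist (e.symm z) u)
    (cOn_dist (hsymm.mono hsph) continuousOn_const) (fun z hz => by
      rw [dist_pos]
      intro h
      rw [← hsu] at h
      have := e.symm.injOn (htar (hsph hz)) (htar (mem_closedBall_self (by positivity))) h
      rw [this, mem_sphere, dist_self] at hz
      exact hs0.ne hz)
  set V' := ball y s
  have hclV' : closure V' ⊆ closedBall y s := closure_ball_subset_closedBall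
  have hfrV' : frontier V' ⊆ sphere y s := frontier_ball_subset_sphere
  obtain ⟨Ψ, hΨs, hΨn, hΨd⟩ := smooth_approx (K := closedBall y s) isClosed_closedBall (hsymm.mono hsub) hm (countable_singleton u)
  have hΨr : RegAt Ψ V' u := ⟨hΨs, fun x _ hx => hΨd x hx, fun x hx he => by
    have h1 := hΨn x (sphere_subset_closedBall (hfrV' hx))
    rw [he, dist_comm] at h1
    linarith [hm2 x (hfrV' hx)]⟩
  have hQ := hΨr.finite isOpen_ball isBounded_ball
  set Q := Zs Ψ V' u with hQdef
  have huc : UniformContinuousOn e.symm (closedBall y (2*s)) :=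
    (isCompact_closedBall _ _).uniformContinuousOn_of_continuous hsymm
  obtain ⟨ε, hε, huc2⟩ := Metric.uniformContinuousOn_iff.1 huc m hm
  obtain ⟨ψ, hψs, hψn, hψd⟩ := smooth_approx (K := closure V) isClosed_closure (e.continuousOn.mono hVe)
    (lt_min hε hs0) hQ.countable
  have hψε : ∀ x ∈ closure V, dist (ψ x) (e x) < ε := fun x hx => (hψn x hx).trans_le (min_le_left _ _)
  have hψs' : ∀ x ∈ closure V, dist (ψ x) (e x) < s := fun x hx => (hψn x hx).trans_le (min_le_right _ _)
  have hfrV : ∀ x ∈ frontier V, 2 * s < dist (e x) y := fun x hx => hout x hx.1 (by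
    have := hx.2; rwa [hV.interior_eq] at this)
  -- counts
  have hcnt : ∀ q ∈ Q, RegAt ψ V q ∧ ((Zs ψ V q).ncard : ZMod 2) = deg e V y := by
    intro q hq
    have hqy : dist q y < s := hq.1
    have hne : ∀ x ∈ frontier V, dist (ψ x + (y - q)) (e x) < dist (e x) y := by
      intro x hx
      have h1 := hψs' x (frontier_subset_closure hx)
      have h2 := hfrV x hx
      have h3 : dist (ψ x + (y - q)) (ψ x) < s := by
        rw [dist_eq_norm, add_sub_cancel_left, ← dist_eq_norm, dist_comm]; exact hqy
      linarith [dist_triangle (ψ x + (y - q)) (ψ x) (e x)]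
    have hfr0 : ∀ x ∈ frontier V, ψ x ≠ q := by
      intro x hx he
      have := hne x hx
      rw [he, add_sub_cancel, dist_comm] at this
      exact lt_irrefl _ this
    refine ⟨⟨hψs, fun x _ hx => hψd x (by rw [hx]; exact hq), hfr0⟩, ?_⟩
    have hw : DegWit e V y (fun x => ψ x + (y - q)) := by
      refine ⟨⟨hψs.add contDiff_const, fun x _ hx => ?_, fun x hx h => ?_⟩, hne⟩
      · rw [fderiv_add_const]
        exact hψd x (by rw [show ψ x = q by simpa [add_sub, sub_eq_iff_eq_add, add_comm] using hx]; exact hq)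
      · exact hfr0 x hx (by simpa [add_sub, sub_eq_iff_eq_add, add_comm] using h)
    rw [hw.deg_eq hV hb]
    congr 2
    ext x
    simp [Zs, add_sub, sub_eq_iff_eq_add, add_comm]
  set V2 := {x ∈ V | ψ x ∈ V'}
  have hV2 : IsOpen V2 := hV.inter (isOpen_ball.preimage hψs.continuous)
  have hV2b : Bornology.IsBounded V2 := hb.subset fun x hx => hx.1
  have hfr2 : ∀ x ∈ frontier V2, x ∈ V ∧ dist (ψ x) y = s := by
    intro x hx
    have h1 : x ∈ closure V := closure_mono (fun x hx => hx.1) hx.1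
    have h2 : ψ x ∈ closedBall y s := by
      refine closure_minimal (s := V2) (t := ψ ⁻¹' closedBall y s) ?_ (isClosed_closedBall.preimage hψs.continuous) hx.1
      exact fun x hx => ball_subset_closedBall hx.2
    have h3 : x ∈ V := by
      by_contra h
      have := hout x h1 h
      have h4 := hψs' x h1
      rw [mem_closedBall] at h2
      linarith [dist_triangle_left (e x) y (ψ x)]
    refine ⟨h3, le_antisymm h2 (not_lt.1 fun hlt => ?_)⟩
    exact hx.2 (by rw [hV2.interior_eq]; exact ⟨h3, hlt⟩)
  have hnear : ∀ x ∈ frontier V2, dist (Ψ (ψ x)) (e.symm (ψ x)) < m ∧ dist x (e.symm (ψ x)) < m ∧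
      m ≤ dist (e.symm (ψ x)) u := by
    intro x hx
    obtain ⟨hxV, hxs⟩ := hfr2 x hx
    have hxc := subset_closure hxV
    have h1 : ψ x ∈ sphere y s := hxs
    refine ⟨hΨn _ (sphere_subset_closedBall h1), ?_, hm2 _ h1⟩
    have h2 : e x ∈ closedBall y (2*s) := by
      rw [mem_closedBall]
      linarith [dist_triangle_left (e x) y (ψ x), hψs' x hxc]
    have h3 := huc2 (e x) h2 (ψ x) (hsph h1) (by rw [dist_comm]; exact hψε x hxc)
    rwa [e.left_inv (hVe hxc)] at h3
  have hΦ : RegAt (Ψ ∘ ψ) V2 u := by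
    refine ⟨hΨs.comp hψs, fun x hx he => ?_, fun x hx he => ?_⟩
    · have hq : ψ x ∈ Q := ⟨hx.2, he⟩
      rw [fderiv_comp x ((hΨs.differentiable (by simp)) _) ((hψs.differentiable (by simp)) _)]
      have : ((fderiv ℝ Ψ (ψ x)).comp (fderiv ℝ ψ x)).det = (fderiv ℝ Ψ (ψ x)).det * (fderiv ℝ ψ x).det :=
        LinearMap.det_comp _ _
      rw [this]
      exact mul_ne_zero (hΨd _ he) (hψd x hq)
    · obtain ⟨h1, h2, h3⟩ := hnear x hx
      change Ψ (ψ x) = u at he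
      rw [he, dist_comm] at h1
      linarith
  have hid : RegAt (fun x : XX d => x) V2 u := by
    refine ⟨contDiff_id, fun x hx he => ?_, fun x hx he => ?_⟩
    · change (fderiv ℝ (id : XX d → XX d) x).det ≠ 0
      rw [fderiv_id]
      have : (ContinuousLinearMap.id ℝ (XX d)).det = 1 := LinearMap.det_id
      rw [this]; exact one_ne_zero
    · obtain ⟨h1, h2, h3⟩ := hnear x hx
      rw [he, dist_comm] at h2
      rw [he] at h3
      linarith
  have hpar := hΦ.parity hid hV2 hV2b (fun t ht x hx => by
    obtain ⟨h1, h2, h3⟩ := hnear x hx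
    exact seg_ne h1 h2 h3 ht)
  have hid1 : Zs (fun x : XX d => x) V2 u = {u} := by
    ext x
    constructor
    · exact fun h => h.2
    · rintro rfl
      exact ⟨⟨hu, hψs' _ (subset_closure hu)⟩, rfl⟩
  have hcomp : Zs (Ψ ∘ ψ) V2 u = ⋃ q ∈ Q, Zs ψ V q := by
    ext x
    simp only [mem_iUnion₂]
    constructor
    · intro hx
      exact ⟨ψ x, ⟨hx.1.2, hx.2⟩, hx.1.1, rfl⟩
    · rintro ⟨q, hq, hx, rfl⟩
      exact ⟨⟨hx, hq.1⟩, hq.2⟩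
  rw [hid1, hcomp, ncard_singleton, hQ.ncard_biUnion (fun q hq => (hcnt q hq).1.finite hV hb)
    (fun q _ q' _ hne => disjoint_left.2 fun x hx hx' => hne (hx.2.symm.trans hx'.2)),
    finsum_mem_eq_finite_toFinset_sum _ hQ] at hpar
  push_cast at hpar
  rw [Finset.sum_congr rfl (fun q hq => (hcnt q (hQ.mem_toFinset.1 hq)).2), Finset.sum_const, nsmul_eq_mul] at hpar
  have hdec : ∀ a b : ZMod 2, a * b = 1 → b = 1 := by decide
  exact hdec _ _ hpar

lemma image_closure_oph {α β : Type*} [TopologicalSpace α] [T2Space α] [TopologicalSpace β] [T2Space β] (e : OpenPartialHomeomorph α β) {V : Set α} (hV : IsOpen V)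
    (hc : IsCompact (closure V)) (hVe : closure V ⊆ e.source) :
    closure (e '' V) = e '' closure V ∧ frontier (e '' V) = e '' frontier V ∧ IsOpen (e '' V) := by
  have ho := e.isOpen_image_of_subset_source hV (subset_closure.trans hVe)
  have h1 : closure (e '' V) = e '' closure V := by
    apply Subset.antisymm
    · exact closure_minimal (image_mono subset_closure) (hc.image_of_continuousOn (e.continuousOn.mono hVe)).isClosed
    · exact (e.continuousOn.mono hVe).image_closure
  refine ⟨h1, ?_, ho⟩
  rw [frontier, h1, ho.interior_eq, frontier, hV.interior_eq]
  exact ((e.injOn.mono hVe).image_sdiff_subset subset_closure).symm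

theorem deg_chart {d : ℕ} (e : OpenPartialHomeomorph (XX d) (XX d)) {V : Set (XX d)} (hV : IsOpen V)
    (hb : Bornology.IsBounded V) (hVe : closure V ⊆ e.source) {f : XX d → XX d} {y : XX d}
    (hf : ContinuousOn f (e '' closure V)) (hfr : ∀ x ∈ frontier V, f (e x) ≠ y) :
    deg (f ∘ e) V y = deg f (e '' V) y := by
  classical
  obtain ⟨h1, h2, h3⟩ := image_closure_oph e hV hb.isCompact_closure hVe
  have hWb : Bornology.IsBounded (e '' V) := ((hb.isCompact_closure.image_of_continuousOn (e.continuousOn.mono hVe)).isBounded).subset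
    (image_mono subset_closure)
  have hec := e.continuousOn.mono hVe
  have hfrc : IsCompact (frontier (e '' V)) := hWb.isCompact_closure.of_isClosed_subset isClosed_frontier frontier_subset_closure
  obtain ⟨m, hm, hm2⟩ := cpt_pos hfrc (f := fun x => dist (f x) y)
    (cOn_dist (hf.mono (by rw [h2]; exact image_mono frontier_subset_closure)) continuousOn_const) (by
      rw [h2]; rintro _ ⟨x, hx, rfl⟩; exact dist_pos.2 (hfr x hx))
  obtain ⟨g, hg, hgn⟩ := exists_wit (f := f) (y := y) (V := e '' V) (f' := f) (by rwa [h1]) hm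
    (fun x hx => by simpa using hm2 x hx)
  rw [hg.deg_eq h3 hWb]
  have hgc := hg.reg.sm.continuous
  rw [deg_hom (f' := g ∘ e) hV hb ((hf.comp hec (mapsTo_image _ _)).mono frontier_subset_closure)
    (hgc.comp_continuousOn hec) (fun x hx => by
      rw [dist_comm]; exact hg.near (e x) (by rw [h2]; exact mem_image_of_mem _ hx))]
  have hfin := hg.reg.finite h3 hWb
  set Z := Zs g (e '' V) y
  have hloc : ∀ z ∈ Z, ∃ p : OpenPartialHomeomorph (XX d) (XX d), z ∈ p.source ∧ (p : XX d → XX d) = g := by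
    intro z hz
    have hdet := hg.reg.det z hz.1 hz.2
    have hs : HasStrictFDerivAt g (((fderiv ℝ g z).toContinuousLinearEquivOfDetNeZero hdet : XX d ≃L[ℝ] XX d) : XX d →L[ℝ] XX d) z := by
      have := hg.reg.sm.contDiffAt (x := z) |>.hasStrictFDerivAt (by simp)
      exact this
    exact ⟨hs.toOpenPartialHomeomorph g, hs.mem_toOpenPartialHomeomorph_source, rfl⟩
  haveI : Nonempty (OpenPartialHomeomorph (XX d) (XX d)) := ⟨e⟩
  choose! p hp1 hp2 using hloc
  obtain ⟨U, hU, hUd⟩ := hfin.t2_separation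
  have hW : ∀ z ∈ Z, ∃ W : Set (XX d), IsOpen W ∧ W ⊆ V ∧ e.symm z ∈ W ∧ W ⊆ e ⁻¹' (U z) ∧ closure W ⊆ (e.trans (p z)).source := by
    intro z hz
    obtain ⟨x, hx, rfl⟩ := hz.1
    have hxs := hVe (subset_closure hx)
    have hn : (V ∩ e ⁻¹' (U (e x))) ∩ (e.trans (p (e x))).source ∈ 𝓝 x :=
      inter_mem (inter_mem (hV.mem_nhds hx) ((e.continuousAt hxs).preimage_mem_nhds ((hU _).2.mem_nhds (hU _).1)))
        ((e.trans (p (e x))).open_source.mem_nhds (by simpa [hxs] using hp1 _ hz))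
    obtain ⟨r, hr, hrs⟩ := nhds_basis_closedBall.mem_iff.1 hn
    refine ⟨ball x r, isOpen_ball, fun w hw => (hrs (ball_subset_closedBall hw)).1.1, ?_,
      fun w hw => (hrs (ball_subset_closedBall hw)).1.2, fun w hw => (hrs (closure_ball_subset_closedBall hw)).2⟩
    rw [e.left_inv hxs]
    exact mem_ball_self hr
  choose! W hWo hWV hzW hWU hWs using hW
  rw [deg_add hfin.toFinset W hV hb (hgc.comp_continuousOn hec) (fun z hz => hWo z (hfin.mem_toFinset.1 hz))
    (fun z hz => hWV z (hfin.mem_toFinset.1 hz))]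
  · have : ∀ z ∈ hfin.toFinset, deg (g ∘ e) (W z) y = 1 := by
      intro z hz
      rw [hfin.mem_toFinset] at hz
      have h := deg_homeo (e.trans (p z)) (hWo z hz) (hb.subset (hWV z hz)) (hWs z hz) (hzW z hz)
      rw [OpenPartialHomeomorph.coe_trans, hp2 z hz] at h
      have hzt : z ∈ e.target := by
        obtain ⟨x, hx, rfl⟩ := hz.1
        exact e.map_source (hVe (subset_closure hx))
      rwa [Function.comp_apply, e.right_inv hzt, hz.2] at h
    rw [Finset.sum_congr rfl this, ncard_eq_toFinset_card _ hfin]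
    simp
  · intro z hz z' hz' hne
    rw [Finset.mem_coe, hfin.mem_toFinset] at hz hz'
    refine disjoint_left.2 fun x hx hx' => ?_
    exact disjoint_left.1 (hUd hz hz' hne) (hWU z hz hx) (hWU z' hz' hx')
  · intro x hx he
    have hxV : x ∈ V := by
      by_contra h
      have hxf : x ∈ frontier V := ⟨hx, by rwa [hV.interior_eq]⟩
      exact hg.reg.fr (e x) (by rw [h2]; exact mem_image_of_mem _ hxf) he
    have hz : e x ∈ Z := ⟨mem_image_of_mem _ hxV, he⟩
    refine ⟨e x, hfin.mem_toFinset.2 hz, ?_⟩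
    have := hzW _ hz
    rwa [e.left_inv (hVe hx)] at this
end

section
open MeasureTheory Metric Set Filter Topology

lemma exists_net {Y : Type*} [MetricSpace Y] [CompactSpace Y] (T : Set Y) {δ : ℝ} (hδ : 0 < δ) :
    ∃ s : Finset Y, (↑s ⊆ T) ∧ (∀ x ∈ s, ∀ y ∈ s, x ≠ y → δ ≤ dist x y) ∧ ∀ x ∈ T, ∃ y ∈ s, dist x y < δ := by
  classical
  obtain ⟨t, -, htf, ht⟩ := finite_cover_balls_of_compact (isCompact_univ (X := Y)) (half_pos hδ)
  let P : Finset Y → Prop := fun s => (↑s ⊆ T) ∧ (∀ x ∈ s, ∀ y ∈ s, x ≠ y → δ ≤ dist x y)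
  have hcard : ∀ s, P s → s.card ≤ htf.toFinset.card := by
    intro s hs
    have : ∀ x ∈ s, ∃ y ∈ htf.toFinset, dist x y < δ/2 := fun x _ => by
      obtain ⟨y, hy, hxy⟩ := mem_iUnion₂.1 (ht (mem_univ x))
      exact ⟨y, htf.mem_toFinset.2 hy, hxy⟩
    choose! g hg1 hg2 using this
    refine Finset.card_le_card_of_injOn g hg1 fun x hx y hy hxy => ?_
    by_contra hne
    have h1 := hs.2 x hx y hy hne
    have h2 := hg2 x hx
    have h3 := hg2 y hy
    rw [← hxy] at h3
    linarith [dist_triangle_right x y (g x)]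
  have hex : ∃ k, ∃ s, P s ∧ s.card = k := ⟨0, ∅, ⟨by simp, by simp⟩, rfl⟩
  obtain ⟨s, hs, hmax⟩ : ∃ s, P s ∧ ∀ s', P s' → s'.card ≤ s.card := by
    have hb := Nat.findGreatest_spec (P := fun k => ∃ s, P s ∧ s.card = k) (n := htf.toFinset.card) (Nat.zero_le _) ⟨∅, ⟨by simp, by simp⟩, rfl⟩
    obtain ⟨s, hs, hk⟩ := hb
    refine ⟨s, hs, fun s' hs' => ?_⟩
    rw [hk]
    exact Nat.le_findGreatest (hcard s' hs') ⟨s', hs', rfl⟩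
  refine ⟨s, hs.1, hs.2, fun x hx => ?_⟩
  by_contra hcon
  push Not at hcon
  have hxs : x ∉ s := fun h => by have := hcon x h; rw [dist_self] at this; linarith
  have := hmax (insert x s) ⟨by
    intro z hz
    rcases Finset.mem_insert.1 (Finset.mem_coe.1 hz) with rfl | h
    · exact hx
    · exact hs.1 h, by
    intro a ha b hb hab
    rcases Finset.mem_insert.1 ha with ha2 | ha2 <;> rcases Finset.mem_insert.1 hb with hb2 | hb2
    · exact absurd (ha2.trans hb2.symm) hab
    · rw [ha2]; exact hcon b hb2
    · rw [hb2, dist_comm]; exact hcon a ha2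
    · exact hs.2 a ha2 b hb2 hab⟩
  rw [Finset.card_insert_of_notMem hxs] at this
  omega

structure AReg {Y : Type*} [MetricSpace Y] [MeasurableSpace Y] (ν : Measure Y) (d : ℕ) (C D : ℝ) : Prop where
  Cpos : 0 < C
  Dpos : 0 < D
  lower : ∀ x r, 0 < r → r ≤ D → C⁻¹ * r ^ d ≤ ν.real (ball x r)
  upper : ∀ x r, 0 < r → ν.real (ball x r) ≤ C * r ^ d

section
variable {Y : Type*} [MetricSpace Y] [CompactSpace Y] [MeasurableSpace Y] [BorelSpace Y]
  {ν : Measure Y} [IsFiniteMeasure ν] {d : ℕ} {C D : ℝ}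

/-- cardinality of separated sets -/
lemma AReg.card_sep (hR : AReg ν d C D) {O : Set Y} {δ : ℝ} (hδ : 0 < δ)
    (hδD : δ ≤ D) (s : Finset Y) (hs : ∀ x ∈ s, ∀ y ∈ s, x ≠ y → 2 * δ ≤ dist x y)
    (hO : ∀ x ∈ s, ball x δ ⊆ O) : s.card * (C⁻¹ * δ ^ d) ≤ ν.real O := by
  classical
  have h1 : ν.real (⋃ x ∈ s, ball x δ) = ∑ x ∈ s, ν.real (ball x δ) := by
    refine measureReal_biUnion_finset (fun x hx y hy hxy => ?_) (fun x _ => measurableSet_ball)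
    exact ball_disjoint_ball (by linarith [hs x hx y hy hxy])
  calc s.card * (C⁻¹ * δ ^ d) = ∑ x ∈ s, (C⁻¹ * δ ^ d) := by simp
    _ ≤ ∑ x ∈ s, ν.real (ball x δ) := Finset.sum_le_sum fun x _ => hR.lower x δ hδ hδD
    _ = _ := h1.symm
    _ ≤ _ := measureReal_mono (iUnion₂_subset hO)

lemma mult_bound (hR : AReg ν d C D) {f : Y → XX d} {K : NNReal} (hf : LipschitzWith K f)
    {T O : Set Y} {δ0 : ℝ} (hδ0 : 0 < δ0) (hTO : ∀ x ∈ T, ball x δ0 ⊆ O) (M : ℕ) :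
    M * volume {y | ∃ s : Finset Y, ↑s ⊆ T ∧ M ≤ s.card ∧ ∀ x ∈ s, f x = y} ≤
      ENNReal.ofReal (C * (4 * K) ^ d * ν.real O) := by
  classical
  set S : ℕ → Set (XX d) := fun n => {y | ∃ s : Finset Y, ↑s ⊆ T ∧ M ≤ s.card ∧ (∀ x ∈ s, f x = y) ∧
    ∀ x ∈ s, ∀ x' ∈ s, x ≠ x' → 2 * (1 / ((n:ℝ)+1)) ≤ dist x x'}
  have hmono : Monotone S := by
    rintro n m hnm y ⟨s, h1, h2, h3, h4⟩
    refine ⟨s, h1, h2, h3, fun x hx x' hx' hne => le_trans ?_ (h4 x hx x' hx' hne)⟩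
    gcongr
  have hU : {y | ∃ s : Finset Y, ↑s ⊆ T ∧ M ≤ s.card ∧ ∀ x ∈ s, f x = y} ⊆ ⋃ n, S n := by
    rintro y ⟨s, h1, h2, h3⟩
    obtain ⟨m, hm, hm2⟩ : ∃ m > 0, ∀ p ∈ s.offDiag, m ≤ dist p.1 p.2 :=
      cpt_pos (K := (s.offDiag : Set (Y × Y))) s.offDiag.finite_toSet.isCompact continuous_dist.continuousOn
        (fun p hp => dist_pos.2 (Finset.mem_offDiag.1 hp).2.2)
    obtain ⟨n, hn⟩ := exists_nat_one_div_lt (half_pos hm)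
    refine mem_iUnion.2 ⟨n, s, h1, h2, h3, fun x hx x' hx' hne => ?_⟩
    have := hm2 (x, x') (Finset.mem_offDiag.2 ⟨hx, hx', hne⟩)
    simp only at this
    linarith
  have hkey : ∀ n : ℕ, 2 * (1 / ((n:ℝ)+1)) < min δ0 D → M * volume (S n) ≤ ENNReal.ofReal (C * (4 * K) ^ d * ν.real O) := by
    intro n hn
    set δ := 1 / ((n:ℝ)+1)
    have hδ : 0 < δ := by positivity
    have hn1 := hn.trans_le (min_le_left _ _)
    have hn2 := hn.trans_le (min_le_right _ _)
    obtain ⟨t, htT, hts, htc⟩ := exists_net T hδ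
    have hcard := hR.card_sep (O := O) (half_pos hδ) (by linarith) t (fun x hx y hy h => by linarith [hts x hx y hy h])
      (fun x hx => (ball_subset_ball (by linarith)).trans (hTO x (htT hx)))
    set N : XX d → ENNReal := fun y => ∑ x ∈ t, (closedBall (f x) (K * δ)).indicator (fun _ => 1) y
    have hN : S n ⊆ {y | (M : ENNReal) ≤ N y} := by
      rintro y ⟨s, h1, h2, h3, h4⟩
      have : ∀ x ∈ s, ∃ z ∈ t, dist x z < δ := fun x hx => htc x (h1 hx)
      choose! g hg1 hg2 using this
      have hinj : (s : Set Y).InjOn g := by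
        intro x hx x' hx' he
        by_contra hne
        have a1 := hg2 x hx
        have a2 := hg2 x' hx'
        rw [← he] at a2
        have a3 := h4 x hx x' hx' hne
        linarith [dist_triangle_right x x' (g x)]
      calc (M : ENNReal) ≤ s.card := by exact_mod_cast h2
        _ = (s.image g).card := by rw [Finset.card_image_of_injOn hinj]
        _ = ∑ z ∈ s.image g, (1 : ENNReal) := by simp
        _ = ∑ z ∈ s.image g, (closedBall (f z) (K * δ)).indicator (fun _ => 1) y := by
          refine Finset.sum_congr rfl fun z hz => ?_
          obtain ⟨x, hx, rfl⟩ := Finset.mem_image.1 hz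
          rw [indicator_of_mem]
          rw [mem_closedBall, ← h3 x hx]
          exact (hf.dist_le_mul _ _).trans (by gcongr; exact (hg2 x hx).le)
        _ ≤ _ := Finset.sum_le_sum_of_subset fun z hz => by
          obtain ⟨x, hx, rfl⟩ := Finset.mem_image.1 hz
          exact hg1 x hx
    calc M * volume (S n) ≤ M * volume {y | (M : ENNReal) ≤ N y} := by gcongr
      _ ≤ ∫⁻ y, N y := mul_meas_ge_le_lintegral (by
          exact Finset.measurable_sum _ fun x _ => measurable_const.indicator isClosed_closedBall.measurableSet) _
      _ = ∑ x ∈ t, volume (closedBall (f x) (K * δ)) := by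
          rw [lintegral_finsetSum _ fun x _ => measurable_const.indicator isClosed_closedBall.measurableSet]
          refine Finset.sum_congr rfl fun x _ => ?_
          rw [lintegral_indicator isClosed_closedBall.measurableSet]; simp
      _ = t.card * ENNReal.ofReal ((2 * (K * δ)) ^ d) := by
          simp [Real.volume_pi_closedBall (a := _) (show 0 ≤ K * δ by positivity)]
      _ = ENNReal.ofReal (t.card * (2 * (K * δ)) ^ d) := by
          rw [ENNReal.ofReal_mul (by positivity)]; simp
      _ ≤ _ := by
          apply ENNReal.ofReal_le_ofReal
          have h4 : (2 * ((K:ℝ) * δ)) ^ d = (4 * K)^d * (δ/2)^d := by rw [← mul_pow]; congr 1; ring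
          rw [h4]
          have hC := hR.Cpos
          calc (t.card : ℝ) * ((4 * K)^d * (δ/2)^d) = C * (4*K)^d * (t.card * (C⁻¹ * (δ/2)^d)) := by
                field_simp
            _ ≤ _ := by gcongr
  calc _ ≤ M * volume (⋃ n, S n) := by gcongr
    _ = M * ⨆ n, volume (S n) := by rw [hmono.measure_iUnion]
    _ = ⨆ n, M * volume (S n) := ENNReal.mul_iSup ..
    _ ≤ _ := iSup_le fun n => by
      obtain ⟨k, hk⟩ := exists_nat_one_div_lt (half_pos (lt_min hδ0 hR.Dpos))
      have hk2 := hkey (max n k) (by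
        have : 1 / (((max n k : ℕ):ℝ) + 1) ≤ 1 / ((k:ℝ)+1) := by
          gcongr; exact_mod_cast le_max_right _ _
        linarith)
      refine le_trans ?_ hk2
      gcongr
      exact hmono (le_max_left _ _)

/-- a.e. finite fibers -/
lemma ff_ae (hR : AReg ν d C D) {f : Y → XX d} {K : NNReal} (hf : LipschitzWith K f) :
    ∀ᵐ y, (f ⁻¹' {y}).Finite := by
  set B := {y | ¬ (f ⁻¹' {y}).Finite}
  have h : ∀ M : ℕ, M * volume B ≤ ENNReal.ofReal (C * (4 * K) ^ d * ν.real univ) := fun M => by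
    refine le_trans ?_ (mult_bound hR hf (T := univ) (O := univ) one_pos (by simp) M)
    gcongr
    intro y hy
    obtain ⟨s, hs, hc⟩ := Set.Infinite.exists_subset_card_eq hy M
    exact ⟨s, subset_univ _, hc.ge, fun x hx => hs hx⟩
  by_contra hne
  have hB : volume B ≠ 0 := hne
  have hlim : Tendsto (fun M : ℕ => (M : ENNReal) * volume B) atTop (𝓝 (⊤ * volume B)) :=
    ENNReal.Tendsto.mul_const ENNReal.tendsto_nat_nhds_top (Or.inl (by simp))
  have := le_of_tendsto' hlim h
  rw [ENNReal.top_mul hB] at this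
  simp at this
end
end

section
open MeasureTheory Metric Set Filter Topology
set_option linter.unusedSectionVars false

section
variable {Y : Type*} [MetricSpace Y] [CompactSpace Y] {d : ℕ}

/-- degree in a chart -/
noncomputable def dg (e : OpenPartialHomeomorph Y (XX d)) (f : Y → XX d) (W : Set Y) (y : XX d) : ZMod 2 :=
  deg (f ∘ e.symm) (e '' W) y

lemma dg_data {e : OpenPartialHomeomorph Y (XX d)} {W : Set Y} (hW : IsOpen W) (hWe : closure W ⊆ e.source) :
    closure (e '' W) = e '' closure W ∧ frontier (e '' W) = e '' frontier W ∧ IsOpen (e '' W) ∧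
      Bornology.IsBounded (e '' W) ∧ e '' closure W ⊆ e.target := by
  obtain ⟨h1, h2, h3⟩ := image_closure_oph e hW isClosed_closure.isCompact hWe
  refine ⟨h1, h2, h3, (isClosed_closure.isCompact.image_of_continuousOn (e.continuousOn.mono hWe)).isBounded.subset
    (image_mono subset_closure), ?_⟩
  rintro _ ⟨x, hx, rfl⟩
  exact e.map_source (hWe hx)

lemma dg_cont {e : OpenPartialHomeomorph Y (XX d)} {W : Set Y} (hW : IsOpen W) (hWe : closure W ⊆ e.source)
    {f : Y → XX d} (hf : Continuous f) : ContinuousOn (f ∘ e.symm) (closure (e '' W)) := by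
  obtain ⟨h1, h2, h3, h4, h5⟩ := dg_data hW hWe
  rw [h1]
  exact hf.comp_continuousOn (e.continuousOn_symm.mono h5)

lemma dg_hom {e : OpenPartialHomeomorph Y (XX d)} {W : Set Y} (hW : IsOpen W) (hWe : closure W ⊆ e.source)
    {f f' : Y → XX d} (hf : Continuous f) (hf' : Continuous f') {y : XX d}
    (h : ∀ x ∈ frontier W, dist (f x) (f' x) < dist (f x) y) : dg e f W y = dg e f' W y := by
  obtain ⟨h1, h2, h3, h4, h5⟩ := dg_data hW hWe
  refine deg_hom h3 h4 ((dg_cont hW hWe hf).mono frontier_subset_closure) (dg_cont hW hWe hf') ?_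
  rw [h2]
  rintro _ ⟨x, hx, rfl⟩
  simp only [Function.comp, e.left_inv (hWe (frontier_subset_closure hx))]
  exact h x hx

lemma dg_add {e : OpenPartialHomeomorph Y (XX d)} {W : Set Y} (hW : IsOpen W) (hWe : closure W ⊆ e.source)
    {f : Y → XX d} (hf : Continuous f) {y : XX d} {ι : Type*} (I : Finset ι) (V : ι → Set Y)
    (hV : ∀ i ∈ I, IsOpen (V i)) (hVW : ∀ i ∈ I, V i ⊆ W) (hd : (I : Set ι).Pairwise (Function.onFun Disjoint V))
    (hz : ∀ x ∈ closure W, f x = y → ∃ i ∈ I, x ∈ V i) : dg e f W y = ∑ i ∈ I, dg e f (V i) y := by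
  obtain ⟨h1, h2, h3, h4, h5⟩ := dg_data hW hWe
  refine deg_add I (fun i => e '' V i) h3 h4 (dg_cont hW hWe hf) ?_ ?_ ?_ ?_
  · exact fun i hi => e.isOpen_image_of_subset_source (hV i hi) ((hVW i hi).trans (subset_closure.trans hWe))
  · exact fun i hi => image_mono (hVW i hi)
  · intro i hi j hj hij
    exact (hd hi hj hij).image e.injOn ((hVW i hi).trans (subset_closure.trans hWe)) ((hVW j hj).trans (subset_closure.trans hWe))
  · rw [h1]
    rintro _ ⟨x, hx, rfl⟩ hxy
    rw [Function.comp, e.left_inv (hWe hx)] at hxy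
    obtain ⟨i, hi, hxi⟩ := hz x hx hxy
    exact ⟨i, hi, x, hxi, rfl⟩

lemma dg_indep {e e' : OpenPartialHomeomorph Y (XX d)} {W : Set Y} (hW : IsOpen W) (hWe : closure W ⊆ e.source)
    (hWe' : closure W ⊆ e'.source) {f : Y → XX d} (hf : Continuous f) {y : XX d}
    (hfr : ∀ x ∈ frontier W, f x ≠ y) : dg e f W y = dg e' f W y := by
  obtain ⟨h1, h2, h3, h4, h5⟩ := dg_data hW hWe
  obtain ⟨h1', h2', h3', h4', h5'⟩ := dg_data hW hWe'
  have hs : closure (e '' W) ⊆ (e.symm.trans e').source := by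
    rw [h1]
    rintro _ ⟨x, hx, rfl⟩
    simp [e.left_inv (hWe hx), e.map_source (hWe hx), hWe' hx]
  have him : ∀ A ⊆ closure W, (e.symm.trans e') '' (e '' A) = e' '' A := by
    intro A hA
    rw [image_image]
    refine image_congr fun x hx => ?_
    simp [e.left_inv (hWe (hA hx))]
  have := deg_chart (e.symm.trans e') h3 h4 hs (f := f ∘ e'.symm) (y := y)
    (by rw [h1, him _ Subset.rfl, ← h1']; exact dg_cont hW hWe' hf)
    (by
      rw [h2]
      rintro _ ⟨x, hx, rfl⟩
      have hx' := frontier_subset_closure hx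
      simpa [e.left_inv (hWe hx'), e'.left_inv (hWe' hx')] using hfr x hx)
  rw [him _ subset_closure] at this
  rw [dg, dg, ← this]
  have hval : ∀ x ∈ closure W, (f ∘ e.symm) (e x) = ((f ∘ e'.symm) ∘ (e.symm.trans e')) (e x) := fun x hx => by
    simp [e.left_inv (hWe hx), e'.left_inv (hWe' hx)]
  refine deg_hom h3 h4 ((dg_cont hW hWe hf).mono frontier_subset_closure)
    ((dg_cont hW hWe hf).congr ?_) ?_
  · rw [h1]
    rintro _ ⟨x, hx, rfl⟩
    exact (hval x hx).symm
  · rw [h2]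
    rintro _ ⟨x, hx, rfl⟩
    have hx' := frontier_subset_closure hx
    rw [← hval x hx', dist_self, dist_pos]
    simpa [e.left_inv (hWe hx')] using hfr x hx

structure IsoN (e : OpenPartialHomeomorph Y (XX d)) (f : Y → XX d) (W : Set Y) (x : Y) : Prop where
  op : IsOpen W
  mem : x ∈ W
  sub : closure W ⊆ e.source
  iso : ∀ x' ∈ closure W, f x' = f x → x' = x

open Classical in
noncomputable def ind (f : Y → XX d) (x : Y) : ZMod 2 :=
  if h : ∃ p : OpenPartialHomeomorph Y (XX d) × Set Y, IsoN p.1 f p.2 x then dg h.choose.1 f h.choose.2 (f x) else 0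

lemma IsoN.excise {e : OpenPartialHomeomorph Y (XX d)} {f : Y → XX d} {W W' : Set Y} {x : Y} (h : IsoN e f W x)
    (hf : Continuous f) (hW' : IsOpen W') (hx : x ∈ W') (hWW : W' ⊆ W) : dg e f W (f x) = dg e f W' (f x) := by
  rw [dg_add h.op h.sub hf {()} (fun _ => W') (fun _ _ => hW') (fun _ _ => hWW) (by simp)
    (fun x' hx' hxx => ⟨(), by simp, by rw [h.iso x' hx' hxx]; exact hx⟩)]
  simp

lemma ind_eq {e : OpenPartialHomeomorph Y (XX d)} {f : Y → XX d} {W : Set Y} {x : Y} (h : IsoN e f W x)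
    (hf : Continuous f) : ind f x = dg e f W (f x) := by
  have hex : ∃ p : OpenPartialHomeomorph Y (XX d) × Set Y, IsoN p.1 f p.2 x := ⟨(e, W), h⟩
  rw [ind, dif_pos hex]
  set e' := hex.choose.1
  set W' := hex.choose.2
  have h' : IsoN e' f W' x := hex.choose_spec
  have hI : IsOpen (W ∩ W') := h.op.inter h'.op
  rw [h.excise hf hI ⟨h.mem, h'.mem⟩ inter_subset_left, h'.excise hf hI ⟨h.mem, h'.mem⟩ inter_subset_right]
  refine dg_indep hI ((closure_mono inter_subset_right).trans h'.sub) ((closure_mono inter_subset_left).trans h.sub) hf ?_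
  intro z hz hzx
  have := h.iso z (closure_mono inter_subset_left (frontier_subset_closure hz)) hzx
  rw [this, hI.frontier_eq] at hz
  exact hz.2 ⟨h.mem, h'.mem⟩

/-- small isolating balls -/
lemma isoN_ball (e : OpenPartialHomeomorph Y (XX d)) {f : Y → XX d} {x : Y} (hx : x ∈ e.source)
    (hfin : (f ⁻¹' {f x}).Finite) {O : Set Y} (hO : O ∈ 𝓝 x) : ∃ r0 > 0, ∀ r, 0 < r → r ≤ r0 → IsoN e f (ball x r) x ∧ closedBall x r ⊆ O := by
  have hn : O ∩ e.source ∩ (f ⁻¹' {f x} \ {x})ᶜ ∈ 𝓝 x :=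
    inter_mem (inter_mem hO (e.open_source.mem_nhds hx))
      ((hfin.subset sdiff_subset).isClosed.isOpen_compl.mem_nhds (by simp))
  obtain ⟨r0, hr0, hs⟩ := Metric.nhds_basis_closedBall.mem_iff.1 hn
  refine ⟨r0, hr0, fun r hr hrr => ?_⟩
  have hcl : closure (ball x r) ⊆ O ∩ e.source ∩ (f ⁻¹' {f x} \ {x})ᶜ :=
    closure_ball_subset_closedBall.trans ((closedBall_subset_closedBall hrr).trans hs)
  refine ⟨⟨isOpen_ball, mem_ball_self hr, fun z hz => (hcl hz).1.2, fun z hz hzx => ?_⟩,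
    ((closedBall_subset_closedBall hrr).trans hs).trans fun z hz => hz.1.1⟩
  by_contra hne
  exact (hcl hz).2 ⟨hzx, hne⟩

lemma ind_germ (hch : ∀ x : Y, ∃ e : OpenPartialHomeomorph Y (XX d), x ∈ e.source) {f f' : Y → XX d} {x : Y}
    (hf : Continuous f) (hf' : Continuous f')
    (hfin : (f ⁻¹' {f x}).Finite) {O : Set Y} (hO : O ∈ 𝓝 x) (h : ∀ z ∈ O, f z = f' z) : ind f x = ind f' x := by
  obtain ⟨e, he⟩ := hch x
  obtain ⟨r, hr, hI⟩ := isoN_ball e he hfin hO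
  obtain ⟨h1, h2⟩ := hI r hr le_rfl
  have hcl : closure (ball x r) ⊆ O := closure_ball_subset_closedBall.trans h2
  have hx : f x = f' x := h x (mem_of_mem_nhds hO)
  have h1' : IsoN e f' (ball x r) x := ⟨h1.op, h1.mem, h1.sub, fun z hz hzx => h1.iso z hz (by rw [h z (hcl hz), hzx, hx])⟩
  rw [ind_eq h1 hf, ind_eq h1' hf', ← hx]
  refine dg_hom h1.op h1.sub hf hf' fun z hz => ?_
  rw [← h z (hcl (frontier_subset_closure hz)), dist_self, dist_pos]
  intro hzx
  have := h1.iso z (frontier_subset_closure hz) hzx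
  rw [this, h1.op.frontier_eq] at hz
  exact hz.2 h1.mem

lemma dg_sum {e : OpenPartialHomeomorph Y (XX d)} {W : Set Y} (hW : IsOpen W) (hWe : closure W ⊆ e.source)
    {f : Y → XX d} (hf : Continuous f) {y : XX d} (hfin : (f ⁻¹' {y}).Finite) (hfr : ∀ x ∈ frontier W, f x ≠ y) :
    dg e f W y = ∑ᶠ x ∈ {x | x ∈ W ∧ f x = y}, ind f x := by
  classical
  have hF : {x | x ∈ W ∧ f x = y}.Finite := hfin.subset fun x hx => hx.2
  obtain ⟨m, hm, hm2⟩ : ∃ m > 0, ∀ p ∈ hF.toFinset.offDiag, m ≤ dist p.1 p.2 :=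
      cpt_pos (K := (hF.toFinset.offDiag : Set (Y × Y))) hF.toFinset.offDiag.finite_toSet.isCompact continuous_dist.continuousOn
        (fun p hp => dist_pos.2 (Finset.mem_offDiag.1 hp).2.2)
  have hr : ∀ x, x ∈ W ∧ f x = y → ∃ r, 0 < r ∧ r ≤ m / 2 ∧ IsoN e f (ball x r) x ∧ closedBall x r ⊆ W := by
    intro x hx
    obtain ⟨r0, hr0, h⟩ := isoN_ball e (f := f) (hWe (subset_closure hx.1)) (by rw [hx.2]; exact hfin) (hW.mem_nhds hx.1)
    exact ⟨min r0 (m/2), by positivity, min_le_right _ _, h _ (by positivity) (min_le_left _ _)⟩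
  choose! r hr0 hrm hI hrW using hr
  rw [finsum_mem_eq_finite_toFinset_sum _ hF, dg_add hW hWe hf hF.toFinset (fun x => ball x (r x)) (fun _ _ => isOpen_ball)
    (fun x hx => ball_subset_closedBall.trans (hrW x (hF.mem_toFinset.1 hx)))]
  · refine Finset.sum_congr rfl fun x hx => ?_
    rw [hF.mem_toFinset] at hx
    rw [ind_eq (hI x hx) hf, hx.2]
  · intro a ha b hb hab
    have h1 := hm2 (a, b) (Finset.mem_offDiag.2 ⟨ha, hb, hab⟩)
    simp only [Finset.mem_coe, hF.mem_toFinset] at ha hb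
    exact ball_disjoint_ball (by linarith [hrm a ha, hrm b hb])
  · intro x hx hxy
    have hxW : x ∈ W := by
      by_contra hn
      exact hfr x (by rw [hW.frontier_eq]; exact ⟨hx, hn⟩) hxy
    exact ⟨x, hF.mem_toFinset.2 ⟨hxW, hxy⟩, mem_ball_self (hr0 x ⟨hxW, hxy⟩)⟩

noncomputable def NN (f : Y → XX d) (l : Y → ℝ) (y : XX d) : ZMod 2 := ∑ᶠ x ∈ {x | f x = y ∧ l x < 0}, ind f x

lemma NN_step (hch : ∀ x : Y, ∃ e : OpenPartialHomeomorph Y (XX d), x ∈ e.source) {f f' : Y → XX d} {l l' : Y → ℝ}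
    (hf : Continuous f) (hf' : Continuous f') (hl : Continuous l) {c : ℝ}
    (hn : ∀ x, c ≤ ‖f x‖ ∨ c ≤ |l x|) (hff : ∀ x, dist (f x) (f' x) < c / 4) (hll : ∀ x, |l x - l' x| < c / 4)
    {y : XX d} (hy : ‖y‖ < c / 4) (h1 : (f ⁻¹' {y}).Finite) (h2 : (f' ⁻¹' {y}).Finite)
    (e : OpenPartialHomeomorph Y (XX d)) {p : Y} {r1 r2 : ℝ} (hr : r1 < r2) (hpe : closedBall p r2 ⊆ e.source)
    (hout : ∀ x, r1 ≤ dist x p → f x = f' x) : NN f l y = NN f' l' y := by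
  have hc : ∀ x, f' x = y → c ≤ |l x| := by
    intro x hx
    refine (hn x).resolve_left fun h => ?_
    have := hff x
    rw [hx, dist_eq_norm] at this
    have h3 := norm_sub_norm_le (f x) y
    linarith [norm_nonneg y]
  have e2 : {x | f' x = y ∧ l' x < 0} = {x | f' x = y ∧ l x < 0} := by
    ext x
    simp only [mem_ofPred_eq, and_congr_right_iff]
    intro hx
    have a := hc x hx
    have b := abs_lt.1 (hll x)
    have hc0 : 0 < c := by linarith [norm_nonneg y]
    rcases abs_cases (l x) with ⟨h, h'⟩ | ⟨h, h'⟩ <;> constructor <;> intro <;> linarith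
  obtain ⟨s, hs, hsF⟩ : ∃ s ∈ Ioo r1 r2, s ∉ (fun x => dist x p) '' (f ⁻¹' {y} ∪ f' ⁻¹' {y}) :=
    ((Ioo_infinite hr).sdiff ((h1.union h2).image _)).nonempty
  have hsF' : ∀ x, f x = y ∨ f' x = y → dist x p ≠ s := fun x hx h => hsF ⟨x, hx, h⟩
  set W := ball p s ∩ {x | l x < 0} with hWdef
  have hW : IsOpen W := isOpen_ball.inter (isOpen_lt hl continuous_const)
  have hcl : closure W ⊆ closedBall p s ∩ {x | l x ≤ 0} :=
    closure_minimal (fun x hx => ⟨ball_subset_closedBall hx.1, (show l x < 0 from hx.2).le⟩)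
      (isClosed_closedBall.inter (isClosed_le hl continuous_const))
  have hWe : closure W ⊆ e.source := fun x hx => hpe (closedBall_subset_closedBall hs.2.le (hcl hx).1)
  have hfr : ∀ x ∈ frontier W, (r1 < dist x p ∧ dist x p = s) ∨ c ≤ ‖f x‖ := by
    intro x hx
    rw [hW.frontier_eq] at hx
    have h3 := hcl hx.1
    by_cases h4 : dist x p < s
    · right
      have h5 : l x = 0 := le_antisymm h3.2 (not_lt.1 fun h => hx.2 ⟨h4, h⟩)
      refine (hn x).resolve_right ?_
      rw [h5, abs_zero]
      linarith [norm_nonneg y]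
    · left
      have : dist x p = s := le_antisymm h3.1 (not_lt.1 h4)
      exact ⟨by rw [this]; exact hs.1, this⟩
  have hd0 : ∀ x ∈ frontier W, dist (f x) (f' x) < dist (f x) y := by
    intro x hx
    rcases hfr x hx with ⟨h3, h4⟩ | h3
    · rw [hout x h3.le, dist_self, dist_pos]
      exact fun h => hsF' x (Or.inr h) h4
    · have := hff x
      have h5 := norm_sub_norm_le (f x) y
      rw [dist_eq_norm _ y]
      linarith [norm_nonneg y]
  have hk := dg_hom hW hWe hf hf' hd0
  rw [dg_sum hW hWe hf h1 (fun x hx h => by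
      have := hd0 x hx
      rw [h, dist_self] at this
      linarith [dist_nonneg (x := y) (y := f' x)]),
    dg_sum hW hWe hf' h2 (fun x hx h => by
      have := hd0 x hx
      rw [h] at this
      exact lt_irrefl _ this)] at hk
  rw [NN, NN, e2]
  have fin1 : {x | f x = y ∧ l x < 0}.Finite := h1.subset fun x hx => hx.1
  have fin2 : {x | f' x = y ∧ l x < 0}.Finite := h2.subset fun x hx => hx.1
  rw [← finsum_mem_inter_add_sdiff (ball p s) fin1, ← finsum_mem_inter_add_sdiff (ball p s) fin2]
  have i1 : {x | f x = y ∧ l x < 0} ∩ ball p s = {x | x ∈ W ∧ f x = y} := by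
    ext x; simp only [hWdef, mem_inter_iff, mem_ofPred_eq]; tauto
  have i2 : {x | f' x = y ∧ l x < 0} ∩ ball p s = {x | x ∈ W ∧ f' x = y} := by
    ext x; simp only [hWdef, mem_inter_iff, mem_ofPred_eq]; tauto
  rw [i1, i2, hk]
  congr 1
  have hset : {x | f x = y ∧ l x < 0} \ ball p s = {x | f' x = y ∧ l x < 0} \ ball p s := by
    ext x
    simp only [Set.mem_sdiff, mem_ofPred_eq, mem_ball, not_lt]
    constructor
    · rintro ⟨⟨a, b⟩, c⟩; exact ⟨⟨by rw [← hout x (by linarith [hs.1])]; exact a, b⟩, c⟩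
    · rintro ⟨⟨a, b⟩, c⟩; exact ⟨⟨by rw [hout x (by linarith [hs.1])]; exact a, b⟩, c⟩
  rw [← hset]
  refine finsum_mem_congr rfl fun x hx => ?_
  have hxs : s ≤ dist x p := by simpa using hx.2
  refine ind_germ hch hf hf' (by rw [hx.1.1]; exact h1) (O := {x | r1 < dist x p})
    ((isOpen_lt continuous_const (continuous_id.dist continuous_const)).mem_nhds ?_) fun z hz => hout z (le_of_lt hz)
  exact hs.1.trans_le hxs
end
end

section
open MeasureTheory Metric Set Filter Topology
set_option linter.unusedSectionVars false

section
variable {Y : Type*} [MetricSpace Y] [CompactSpace Y] {d : ℕ}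

def Lip {Y E : Type*} [MetricSpace Y] [PseudoMetricSpace E] (f : Y → E) : Prop := ∃ K : NNReal, LipschitzWith K f

lemma Lip.cont {E : Type*} [PseudoMetricSpace E] {f : Y → E} (h : Lip f) : Continuous f := h.choose_spec.continuous

lemma Lip.add {E : Type*} [NormedAddCommGroup E] {f g : Y → E} (h : Lip f) (hg : Lip g) : Lip fun x => f x + g x :=
  ⟨_, h.choose_spec.add hg.choose_spec⟩
lemma Lip.sub {E : Type*} [NormedAddCommGroup E] {f g : Y → E} (h : Lip f) (hg : Lip g) : Lip fun x => f x - g x :=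
  ⟨_, h.choose_spec.sub hg.choose_spec⟩
lemma Lip.smul {E : Type*} [NormedAddCommGroup E] [NormedSpace ℝ E] {m : Y → ℝ} {f : Y → E} (hm : Lip m) (hf : Lip f) :
    Lip fun x => m x • f x := by
  obtain ⟨A, hA⟩ := isCompact_univ.exists_bound_of_continuousOn hm.cont.continuousOn
  obtain ⟨B, hB⟩ := isCompact_univ.exists_bound_of_continuousOn hf.cont.continuousOn
  obtain ⟨K, hK⟩ := hm
  obtain ⟨L, hL⟩ := hf
  refine ⟨Real.toNNReal (|A| * L + K * |B|), LipschitzWith.of_dist_le_mul fun x y => ?_⟩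
  rw [Real.coe_toNNReal _ (by positivity), dist_eq_norm]
  have : m x • f x - m y • f y = m x • (f x - f y) + (m x - m y) • f y := by rw [smul_sub, sub_smul]; abel
  rw [this]
  have h1 := hK.dist_le_mul x y
  have h2 := hL.dist_le_mul x y
  rw [dist_eq_norm] at h1 h2
  calc _ ≤ ‖m x‖ * ‖f x - f y‖ + ‖m x - m y‖ * ‖f y‖ := by
        rw [← norm_smul, ← norm_smul]; exact norm_add_le _ _
    _ ≤ |A| * (L * dist x y) + K * dist x y * |B| := by
        gcongr
        · exact (hA x (mem_univ _)).trans (le_abs_self _)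
        · exact (hB y (mem_univ _)).trans (le_abs_self _)
    _ = _ := by ring

lemma lip_approx_real {f : Y → ℝ} (hf : Continuous f) {ε : ℝ} (hε : 0 < ε) :
    ∃ K : NNReal, ∃ g : Y → ℝ, LipschitzWith K g ∧ ∀ x, |g x - f x| ≤ ε := by
  obtain ⟨M, hM⟩ := isCompact_univ.exists_bound_of_continuousOn hf.continuousOn
  obtain ⟨δ, hδ, hu⟩ := Metric.uniformContinuous_iff.1 (CompactSpace.uniformContinuous_of_continuous hf) ε hε
  have hM' : ∀ x, -|M| ≤ f x ∧ f x ≤ |M| := fun x => abs_le.1 ((hM x (mem_univ _)).trans (le_abs_self _))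
  set K : NNReal := Real.toNNReal (2 * |M| / δ) with hK
  have hKc : (K : ℝ) = 2 * |M| / δ := Real.coe_toNNReal _ (by positivity)
  have hlow : ∀ x y, f x - ε ≤ f y + K * dist x y := by
    intro x y
    rcases lt_or_ge (dist x y) δ with h | h
    · have := hu h
      rw [Real.dist_eq] at this
      have := (abs_lt.1 this).2
      have : 0 ≤ K * dist x y := by positivity
      linarith
    · have : 2 * |M| ≤ K * dist x y := by
        rw [hKc, div_mul_eq_mul_div, le_div_iff₀ hδ]; gcongr
      linarith [(hM' x).2, (hM' y).1]
  have hbdd : ∀ x, BddBelow (range fun y => f y + K * dist x y) := fun x =>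
    ⟨f x - ε, by rintro _ ⟨y, rfl⟩; exact hlow x y⟩
  refine ⟨K, fun x => ⨅ y, f y + K * dist x y, LipschitzWith.of_le_add_mul K fun x x' => ?_, fun x => ?_⟩
  · have : Nonempty Y := ⟨x⟩
    rw [← sub_le_iff_le_add]
    refine le_ciInf fun y => ?_
    have h1 := ciInf_le (hbdd x) y
    have : (K:ℝ) * dist x y ≤ K * dist x x' + K * dist x' y := by rw [← mul_add]; gcongr; exact dist_triangle _ _ _
    linarith
  · have : Nonempty Y := ⟨x⟩
    have h1 := ciInf_le (hbdd x) x
    simp only [dist_self, mul_zero, add_zero] at h1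
    have h2 := le_ciInf (hlow x)
    rw [abs_le]
    constructor <;> linarith

lemma lip_approx {f : Y → XX d} (hf : Continuous f) {ε : ℝ} (hε : 0 < ε) :
    ∃ g : Y → XX d, Lip g ∧ ∀ x, dist (g x) (f x) < ε := by
  choose K g hg hgf using fun i => lip_approx_real (Y := Y) (f := fun x => f x i) (by fun_prop) (half_pos hε)
  refine ⟨fun x i => g i x, ⟨∑ i, K i, LipschitzWith.of_dist_le_mul fun x y => ?_⟩, fun x => ?_⟩
  · rw [dist_pi_le_iff (by positivity)]
    intro i
    refine ((hg i).dist_le_mul x y).trans ?_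
    gcongr
    exact_mod_cast Finset.single_le_sum (fun j _ => zero_le (a := K j)) (Finset.mem_univ i)
  · refine lt_of_le_of_lt ((dist_pi_le_iff (by positivity)).2 fun i => ?_) (half_lt_self hε)
    rw [Real.dist_eq]; exact hgf i x

variable (hch : ∀ x : Y, ∃ e : OpenPartialHomeomorph Y (XX d), x ∈ e.source)
  (hFF : ∀ f : Y → XX d, Lip f → ∀ᵐ y, (f ⁻¹' {y}).Finite)
include hch hFF

lemma NN_interp {f f' : Y → XX d} {l l' : Y → ℝ} (hf : Lip f) (hf' : Lip f')
    (hl : Continuous l) (hl' : Continuous l') {c : ℝ} (hn : ∀ x, c ≤ ‖f x‖ ∨ c ≤ |l x|)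
    (hff : ∀ x, dist (f x) (f' x) < c / 16) (hll : ∀ x, |l x - l' x| < c / 16) :
    ∀ᵐ y, ‖y‖ < c / 16 → NN f l y = NN f' l' y := by
  classical
  have hr : ∀ x : Y, ∃ e : OpenPartialHomeomorph Y (XX d), ∃ r > 0, closedBall x (3 * r) ⊆ e.source := fun x => by
    obtain ⟨e, he⟩ := hch x
    obtain ⟨r, hr, h⟩ := Metric.nhds_basis_closedBall.mem_iff.1 (e.open_source.mem_nhds he)
    exact ⟨e, r / 3, by positivity, by rwa [mul_div_cancel₀ _ (by norm_num)]⟩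
  choose e r hr0 hre using hr
  have key : ∀ s : Finset Y, ∃ m : Y → ℝ, Lip m ∧ (∀ x, 0 ≤ m x ∧ m x ≤ 1) ∧
      (∀ p ∈ s, ∀ x ∈ ball p (r p), m x = 1) ∧
      ∀ᵐ y, ‖y‖ < c / 16 → NN f l y = NN (fun x => f x + m x • (f' x - f x)) (fun x => l x + m x * (l' x - l x)) y := by
    intro s
    induction s using Finset.induction_on with
    | empty => exact ⟨fun _ => 0, ⟨0, LipschitzWith.const 0⟩, by simp, by simp, by simp⟩
    | insert p s hp ih =>
      obtain ⟨m, hm, hm01, hm1, hN⟩ := ih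
      set b : Y → ℝ := fun x => max 0 (min 1 (2 - (r p)⁻¹ * dist x p)) with hb
      have hbl : Lip b := by
        obtain ⟨K, hK⟩ := Lip.sub (Y := Y) (E := ℝ) (f := fun _ => 2) ⟨0, LipschitzWith.const _⟩
          (Lip.smul (m := fun _ => (r p)⁻¹) (f := fun x => dist x p) ⟨0, LipschitzWith.const _⟩ ⟨1, LipschitzWith.dist_left p⟩)
        exact ⟨K, (hK.const_min 1).const_max 0⟩
      have hb01 : ∀ x, 0 ≤ b x ∧ b x ≤ 1 := fun x => ⟨le_max_left _ _, max_le zero_le_one (min_le_left _ _)⟩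
      have hb1 : ∀ x ∈ ball p (r p), b x = 1 := fun x hx => by
        have : (r p)⁻¹ * dist x p ≤ 1 := by rw [inv_mul_le_iff₀ (hr0 p)]; linarith [mem_ball.1 hx]
        simp only [hb]
        rw [min_eq_left (by linarith), max_eq_right zero_le_one]
      have hb0 : ∀ x, 2 * r p ≤ dist x p → b x = 0 := fun x hx => by
        have : 2 ≤ (r p)⁻¹ * dist x p := by rw [le_inv_mul_iff₀ (hr0 p)]; linarith
        simp only [hb]
        rw [max_eq_left ((min_le_right _ _).trans (by linarith))]
      set m' : Y → ℝ := fun x => m x + b x • ((1 : ℝ) - m x) with hm'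
      have hm'l : Lip m' := hm.add (hbl.smul (Lip.sub ⟨0, LipschitzWith.const (1:ℝ)⟩ hm))
      have hmm : ∀ x, 0 ≤ m' x - m x ∧ m' x ≤ 1 := fun x => by
        have h1 := hb01 x
        have h2 := hm01 x
        simp only [hm', smul_eq_mul]
        constructor <;> nlinarith
      have hFl : ∀ {m : Y → ℝ}, Lip m → Lip (fun x => f x + m x • (f' x - f x)) := fun h =>
        hf.add (h.smul (hf'.sub hf))
      have hm'01 : ∀ x, 0 ≤ m' x ∧ m' x ≤ 1 := fun x => ⟨by linarith [(hmm x).1, (hm01 x).1], (hmm x).2⟩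
      refine ⟨m', hm'l, hm'01, ?_, ?_⟩
      · intro q hq x hx
        rcases Finset.mem_insert.1 hq with rfl | hq
        · simp [hm', hb1 x hx]
        · simp [hm', hm1 q hq x hx]
      · filter_upwards [hN, hFF _ (hFl hm), hFF _ (hFl hm'l)] with y hy h1 h2 hyc
        rw [hy hyc]
        have hc0 : 0 < c := by linarith [norm_nonneg y]
        refine NN_step hch (c := 15 * c / 16) (hFl hm).cont (hFl hm'l).cont (by have := hm.cont; fun_prop) ?_ ?_ ?_ (by linarith) h1 h2 (e p)
          (p := p) (r1 := 2 * r p) (r2 := 3 * r p) (by linarith [hr0 p]) (hre p) ?_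
        · intro x
          have h3 : ‖m x • (f' x - f x)‖ ≤ c / 16 := by
            rw [norm_smul, Real.norm_eq_abs, abs_of_nonneg (hm01 x).1, ← dist_eq_norm, dist_comm]
            nlinarith [hff x, hm01 x, dist_nonneg (x := f x) (y := f' x)]
          have h4 : |m x * (l' x - l x)| ≤ c / 16 := by
            rw [abs_mul, abs_of_nonneg (hm01 x).1, abs_sub_comm]
            nlinarith [hll x, hm01 x, abs_nonneg (l x - l' x)]
          rcases hn x with h | h
          · left
            have := norm_sub_le (f x + m x • (f' x - f x)) (m x • (f' x - f x))
            rw [add_sub_cancel_right] at this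
            linarith
          · right
            have := abs_sub (l x + m x * (l' x - l x)) (m x * (l' x - l x))
            rw [add_sub_cancel_right] at this
            linarith
        · intro x
          rw [dist_comm, dist_eq_norm, show f x + m' x • (f' x - f x) - (f x + m x • (f' x - f x)) = (m' x - m x) • (f' x - f x) by
            rw [sub_smul]; abel, norm_smul, Real.norm_eq_abs, abs_of_nonneg (hmm x).1, ← dist_eq_norm, dist_comm]
          have : m' x - m x ≤ 1 := by linarith [(hmm x).2, (hm01 x).1]
          nlinarith [hff x, (hmm x).1, dist_nonneg (x := f x) (y := f' x)]
        · intro x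
          rw [abs_sub_comm, show l x + m' x * (l' x - l x) - (l x + m x * (l' x - l x)) = (m' x - m x) * (l' x - l x) by ring,
            abs_mul, abs_of_nonneg (hmm x).1, abs_sub_comm]
          have : m' x - m x ≤ 1 := by linarith [(hmm x).2, (hm01 x).1]
          nlinarith [hll x, (hmm x).1, abs_nonneg (l x - l' x)]
        · intro x hx
          simp [hm', hb0 x hx]
  obtain ⟨t, ht⟩ := isCompact_univ.elim_finite_subcover (fun p : Y => ball p (r p)) (fun _ => isOpen_ball)
    (fun x _ => mem_iUnion.2 ⟨x, mem_ball_self (hr0 x)⟩)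
  obtain ⟨m, hm, hm01, hm1, hN⟩ := key t
  have : ∀ x, m x = 1 := fun x => by
    obtain ⟨p, hp, hx⟩ := mem_iUnion₂.1 (ht (mem_univ x))
    exact hm1 p hp x hx
  simpa [this] using hN

omit hch hFF in
/-- the odd-degree property -/
def OddG (f : Y → XX d) (l : Y → ℝ) : Prop :=
  ∃ κ > 0, ∀ g : Y → XX d, Lip g → (∀ x, dist (g x) (f x) < κ) → ∀ᵐ y, ‖y‖ < κ → NN g l y = 1

lemma OddG.near {f f' : Y → XX d} {l l' : Y → ℝ} (hf : Continuous f)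
    (hl : Continuous l) (hl' : Continuous l') {c : ℝ} (hc : 0 < c) (hn : ∀ x, c ≤ ‖f x‖ ∨ c ≤ |l x|)
    (hff : ∀ x, dist (f x) (f' x) < c / 64) (hll : ∀ x, |l x - l' x| < c / 64) (h : OddG f l) : OddG f' l' := by
  obtain ⟨κ, hκ, h⟩ := h
  refine ⟨min κ (c / 128), by positivity, fun g hg hgf => ?_⟩
  obtain ⟨g0, hg0, hg0f⟩ := lip_approx hf (show 0 < min κ (c/128) by positivity)
  have a := h g0 hg0 fun x => (hg0f x).trans_le (min_le_left _ _)
  have b := NN_interp hch hFF hg0 hg hl hl' (c := c / 2) ?_ ?_ ?_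
  · filter_upwards [a, b] with y ha hb hy
    rw [← ha (hy.trans_le (min_le_left _ _)), hb]
    have := hy.trans_le (min_le_right _ _)
    linarith
  · intro x
    rcases hn x with h | h
    · left
      have h1 := (hg0f x).trans_le (min_le_right _ _)
      rw [dist_comm, dist_eq_norm] at h1
      have := norm_sub_norm_le (f x) (g0 x)
      linarith
    · right; linarith
  · intro x
    have h1 := (hg0f x).trans_le (min_le_right _ _)
    have h2 := (hgf x).trans_le (min_le_right _ _)
    have h3 := dist_triangle4 (g0 x) (f x) (f' x) (g x)
    rw [dist_comm (f' x)] at h3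
    linarith [hff x]
  · intro x; linarith [hll x]

/-- homotopy invariance -/
lemma OddG.hom {F : ℝ → Y → XX d} {l : ℝ → Y → ℝ} (hF : ContinuousOn (fun p : ℝ × Y => F p.1 p.2) (Icc 0 1 ×ˢ univ))
    (hl : ContinuousOn (fun p : ℝ × Y => l p.1 p.2) (Icc 0 1 ×ˢ univ))
    (hn : ∀ t ∈ Icc (0:ℝ) 1, ∀ x, F t x ≠ 0 ∨ l t x ≠ 0) (h : OddG (F 0) (l 0)) : OddG (F 1) (l 1) := by
  have hK : IsCompact (Icc (0:ℝ) 1 ×ˢ (univ : Set Y)) := isCompact_Icc.prod isCompact_univ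
  obtain ⟨c, hc, hcn⟩ := cpt_pos hK (f := fun p => ‖F p.1 p.2‖ ⊔ |l p.1 p.2|) (hF.norm.sup hl.abs) (by
    rintro ⟨t, x⟩ ⟨ht, -⟩
    rcases hn t ht x with h | h
    · exact lt_sup_of_lt_left (norm_pos_iff.2 h)
    · exact lt_sup_of_lt_right (abs_pos.2 h))
  have hn' : ∀ t ∈ Icc (0:ℝ) 1, ∀ x, c ≤ ‖F t x‖ ∨ c ≤ |l t x| := fun t ht x => le_sup_iff.1 (hcn (t, x) ⟨ht, trivial⟩)
  obtain ⟨δ1, hδ1, hu1⟩ := Metric.uniformContinuousOn_iff.1 (hK.uniformContinuousOn_of_continuous hF) (c / 64) (by positivity)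
  obtain ⟨δ2, hδ2, hu2⟩ := Metric.uniformContinuousOn_iff.1 (hK.uniformContinuousOn_of_continuous hl) (c / 64) (by positivity)
  obtain ⟨n, hn1⟩ := exists_nat_one_div_lt (lt_min hδ1 hδ2)
  have hcF : ∀ t ∈ Icc (0:ℝ) 1, Continuous (F t) := fun t ht =>
    hF.comp_continuous (by fun_prop : Continuous fun x : Y => (t, x)) fun x => ⟨ht, trivial⟩
  have hcl : ∀ t ∈ Icc (0:ℝ) 1, Continuous (l t) := fun t ht =>
    hl.comp_continuous (by fun_prop : Continuous fun x : Y => (t, x)) fun x => ⟨ht, trivial⟩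
  have hmem : ∀ k : ℕ, k ≤ n + 1 → (k : ℝ) / (n + 1) ∈ Icc (0:ℝ) 1 := fun k hk =>
    ⟨by positivity, by rw [div_le_one (by positivity)]; exact_mod_cast hk⟩
  have key : ∀ k : ℕ, k ≤ n + 1 → OddG (F (k / (n + 1))) (l (k / (n+1))) := by
    intro k
    induction k with
    | zero => intro _; simpa using h
    | succ k ih =>
      intro hk
      have a := hmem k (by omega)
      have b := hmem (k+1) hk
      have hd : ∀ x : Y, dist (((k:ℝ)/(n+1), x) : ℝ × Y) (((k+1 : ℕ):ℝ)/(n+1), x) < min δ1 δ2 := fun x => by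
        rw [Prod.dist_eq, dist_self, max_eq_left dist_nonneg, dist_comm, Real.dist_eq, ← sub_div]
        push_cast
        rwa [add_sub_cancel_left, abs_of_pos (by positivity)]
      exact (ih (by omega)).near hch hFF (hcF _ a) (hcl _ a) (hcl _ b) hc (hn' _ a)
        (fun x => hu1 _ ⟨a, trivial⟩ _ ⟨b, trivial⟩ ((hd x).trans_le (min_le_left _ _)))
        (fun x => hu2 _ ⟨a, trivial⟩ _ ⟨b, trivial⟩ ((hd x).trans_le (min_le_right _ _)))
  have := key (n+1) le_rfl
  rwa [show ((n + 1 : ℕ) : ℝ) / (n + 1) = 1 by push_cast; field_simp] at this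

lemma OddG.start {f : Y → XX d} {l : Y → ℝ} (hf : Continuous f) (hl : Continuous l) {p : Y}
    (hn : ∀ x, f x ≠ 0 ∨ l x ≠ 0) (hz : ∀ x, f x = 0 → l x < 0 → x = p) (hp : l p < 0)
    (e : OpenPartialHomeomorph Y (XX d)) (hpe : p ∈ e.source) (hep : e p = 0) {O : Set Y} (hO : O ∈ 𝓝 p)
    (hfe : ∀ x ∈ O, f x = e x) : OddG f l := by
  have hnb : O ∩ e.source ∩ {x | l x < 0} ∈ 𝓝 p :=
    inter_mem (inter_mem hO (e.open_source.mem_nhds hpe)) ((isOpen_lt hl continuous_const).mem_nhds hp)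
  obtain ⟨r, hr, hs⟩ := Metric.nhds_basis_closedBall.mem_iff.1 hnb
  set W := ball p r
  have hW : IsOpen W := isOpen_ball
  have hcl : closure W ⊆ O ∩ e.source ∩ {x | l x < 0} := closure_ball_subset_closedBall.trans hs
  have hWe : closure W ⊆ e.source := fun x hx => (hcl hx).1.2
  obtain ⟨κ, hκ, hk⟩ := cpt_pos (K := {x | l x ≤ 0} \ W) (f := fun x => ‖f x‖)
    (((isClosed_le hl continuous_const).sdiff hW).isCompact) hf.norm.continuousOn (by
      rintro x ⟨h1, h2⟩
      rw [norm_pos_iff]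
      intro h0
      have h3 : l x < 0 := lt_of_le_of_ne h1 ((hn x).resolve_left (not_not.2 h0))
      exact h2 (by rw [hz x h0 h3]; exact mem_ball_self hr))
  obtain ⟨ρ, hρ0, hρ⟩ := Metric.mem_nhds_iff.1 ((dg_data hW hWe).2.2.1.mem_nhds
    (show (0 : XX d) ∈ e '' W from ⟨p, mem_ball_self hr, hep⟩))
  refine ⟨min (κ / 4) ρ, by positivity, fun g hg hgf => ?_⟩
  replace hgf := fun x => (hgf x).trans_le (min_le_left _ _)
  filter_upwards [hFF g hg] with y hy hyk
  have hyk2 := hyk.trans_le (min_le_right _ _)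
  replace hyk := hyk.trans_le (min_le_left _ _)
  have hout : ∀ x, l x ≤ 0 → x ∉ W → κ / 2 ≤ dist (f x) y - dist (g x) (f x) := fun x h1 h2 => by
    have a := hk x ⟨h1, h2⟩
    have b := hgf x
    have := norm_sub_norm_le (f x) y
    rw [dist_eq_norm _ y]
    linarith
  have hfrl : ∀ x ∈ frontier W, l x ≤ 0 ∧ x ∉ W := fun x hx =>
    ⟨(show l x < 0 from (hcl (frontier_subset_closure hx)).2).le, by rw [hW.frontier_eq] at hx; exact hx.2⟩
  have h1 : NN g l y = dg e g W y := by
    rw [dg_sum hW hWe hg.cont hy (fun x hx h => by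
      have := hout x (hfrl x hx).1 (hfrl x hx).2
      rw [h, dist_comm] at this
      linarith), NN]
    refine finsum_mem_congr (Set.ext fun x => ?_) fun _ _ => rfl
    constructor
    · rintro ⟨a, b⟩
      refine ⟨by_contra fun h => ?_, a⟩
      have := hout x (le_of_lt b) h
      rw [a, dist_comm] at this
      linarith
    · rintro ⟨a, b⟩
      exact ⟨b, (hcl (subset_closure a)).2⟩
  rw [h1, ← dg_hom hW hWe hf hg.cont (fun x hx => by
    have := hout x (hfrl x hx).1 (hfrl x hx).2
    rw [dist_comm (f x) (g x)]
    linarith)]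
  obtain ⟨a1, a2, a3, a4, a5⟩ := dg_data hW hWe
  have hid : ∀ u ∈ closure (e '' W), (f ∘ e.symm) u = u := by
    rw [a1]
    rintro _ ⟨x, hx, rfl⟩
    rw [Function.comp, e.left_inv (hWe hx), hfe x (hcl hx).1.1]
  have hdist : ∀ u ∈ frontier (e '' W), κ ≤ ‖u‖ := by
    rw [a2]
    rintro _ ⟨x, hx, rfl⟩
    have := hk x (hfrl x hx)
    rwa [hfe x (hcl (frontier_subset_closure hx)).1.1] at this
  have hyW : y ∈ e '' W := hρ (mem_ball_zero_iff.2 hyk2)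
  rw [dg, deg_hom (f' := (OpenPartialHomeomorph.refl (XX d))) a3 a4 ((dg_cont hW hWe hf).mono frontier_subset_closure) (by exact continuousOn_id)
    (fun u hu => by
      rw [hid u (frontier_subset_closure hu), OpenPartialHomeomorph.refl_apply, id, dist_self, dist_pos]
      intro huy
      have := hdist u hu
      rw [huy] at this
      linarith)]
  exact deg_homeo (OpenPartialHomeomorph.refl (XX d)) a3 a4 (by simp) hyW

lemma OddG.exists {f : Y → XX d} {l : Y → ℝ} (hf : Continuous f) (hl : Continuous l) (h : OddG f l)
    (hn : ∀ x, f x ≠ 0 ∨ l x ≠ 0) : ∃ x, f x = 0 ∧ l x < 0 := by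
  by_contra! hcon
  obtain ⟨κ', hκ', h⟩ := h
  obtain ⟨κ, hκ, hk⟩ := cpt_pos (K := {x | l x ≤ 0}) (f := fun x => ‖f x‖)
    (((isClosed_le hl continuous_const)).isCompact) hf.norm.continuousOn (by
      intro x h1
      rw [norm_pos_iff]
      intro h0
      exact (hn x).elim (fun h => h h0) fun h => h (le_antisymm h1 (hcon x h0)))
  obtain ⟨g, hg, hgf⟩ := lip_approx hf (show 0 < min κ' (κ/2) by positivity)
  have h1 := h g hg fun x => (hgf x).trans_le (min_le_left _ _)
  have hb : (volume (ball (0 : XX d) (min κ' (κ / 2)))) ≠ 0 := (measure_ball_pos _ _ (by positivity)).ne'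
  obtain ⟨y, hyb, hy⟩ := Frequently.and_eventually (frequently_ae_mem_iff.2 hb) h1 |>.exists
  rw [mem_ball_zero_iff] at hyb
  have := hy (hyb.trans_le (min_le_left _ _))
  have he : {x | g x = y ∧ l x < 0} = ∅ := by
    ext x
    simp only [mem_ofPred_eq, mem_empty_iff_false, iff_false, not_and]
    intro hgx hlx
    have a := hk x (le_of_lt hlx)
    have b := (hgf x).trans_le (min_le_right _ _)
    have c := hyb.trans_le (min_le_right _ _)
    rw [hgx, dist_comm, dist_eq_norm] at b
    have := norm_sub_norm_le (f x) y
    linarith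
  rw [NN, he] at this
  simp at this
end
end

section
open MeasureTheory Metric Set Filter Topology
set_option linter.unusedSectionVars false

lemma abs_prod_sub_prod {ι : Type*} (s : Finset ι) (a b : ι → ℝ) (ha : ∀ i, 0 ≤ a i ∧ a i ≤ 1) (hb : ∀ i, 0 ≤ b i ∧ b i ≤ 1) :
    |∏ i ∈ s, a i - ∏ i ∈ s, b i| ≤ ∑ i ∈ s, |a i - b i| := by
  classical
  induction s using Finset.induction_on with
  | empty => simp
  | insert i s hi ih =>
    rw [Finset.prod_insert hi, Finset.prod_insert hi, Finset.sum_insert hi]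
    have h1 : |∏ i ∈ s, a i| ≤ 1 := by
      rw [Finset.abs_prod]; exact Finset.prod_le_one (fun i _ => abs_nonneg _) fun i _ => by
        rw [abs_of_nonneg (ha i).1]; exact (ha i).2
    calc _ = |(a i - b i) * ∏ i ∈ s, a i + b i * (∏ i ∈ s, a i - ∏ i ∈ s, b i)| := by congr 1; ring
      _ ≤ |a i - b i| * |∏ i ∈ s, a i| + |b i| * |∏ i ∈ s, a i - ∏ i ∈ s, b i| := by
        rw [← abs_mul, ← abs_mul]; exact abs_add_le _ _
      _ ≤ |a i - b i| * 1 + 1 * ∑ i ∈ s, |a i - b i| := by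
        gcongr
        rw [abs_of_nonneg (hb i).1]; exact (hb i).2
      _ = _ := by ring

section
variable {Y : Type*} [MetricSpace Y] [CompactSpace Y] [MeasurableSpace Y] [BorelSpace Y]
  {ν : Measure Y} [IsFiniteMeasure ν] {d : ℕ} {C D : ℝ}

def Lay (s δ : ℝ) (v : Y) (j : ℕ) : Set Y := {y | s + (3 * j - 1) * (δ * s) ≤ dist y v ∧ dist y v < s + (3 * j + 2) * (δ * s)}

lemma Lay_meas (s δ : ℝ) (v : Y) (j : ℕ) : MeasurableSet (Lay s δ v j) :=
  (measurableSet_le measurable_const (measurable_id.dist measurable_const)).inter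
    (measurableSet_lt (measurable_id.dist measurable_const) measurable_const)

lemma Lay_disj {s δ : ℝ} (h : 0 < δ * s) (v : Y) : Pairwise (Function.onFun Disjoint (Lay s δ v)) := by
  intro i j hij
  rw [Function.onFun, Set.disjoint_left]
  rintro y ⟨h1, h2⟩ ⟨h3, h4⟩
  have key : ∀ i j : ℕ, i < j → s + (3 * (j:ℝ) - 1) * (δ * s) ≤ dist y v → dist y v < s + (3 * (i:ℝ) + 2) * (δ * s) → False := by
    intro i j hij h5 h6
    have : (i:ℝ) + 1 ≤ j := by exact_mod_cast hij
    nlinarith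
  rcases lt_or_gt_of_ne hij with h | h
  · exact key i j h h3 h2
  · exact key j i h h1 h4

lemma AReg.card_near (hR : AReg ν d C D) {s : ℝ} (hs : 0 < s) (hsD : s ≤ D) (N : Finset Y)
    (hN : ∀ x ∈ N, ∀ y ∈ N, x ≠ y → s ≤ dist x y) (w : Y) (hw : ∀ x ∈ N, dist x w < 5 * s) :
    (N.card : ℝ) ≤ C ^ 2 * 12 ^ d := by
  have h := hR.card_sep (O := ball w (6 * s)) (half_pos hs) (by linarith) N (fun x hx y hy h => by linarith [hN x hx y hy h])
    (fun x hx => ball_subset_ball' (by linarith [hw x hx]))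
  have h2 := hR.upper w (6 * s) (by linarith)
  have hC := hR.Cpos
  have h3 : (N.card : ℝ) * (C⁻¹ * (s / 2) ^ d) ≤ C * (6 * s) ^ d := h.trans h2
  rw [show 6 * s = 12 * (s / 2) by ring, mul_pow] at h3
  have h4 : 0 < (s/2) ^ d := by positivity
  have h5 : (N.card : ℝ) * (C⁻¹ * (s / 2) ^ d) ≤ (C^2 * 12 ^ d) * (C⁻¹ * (s/2)^d) := by
    refine h3.trans (le_of_eq ?_); field_simp
  exact le_of_mul_le_mul_right h5 (by positivity)

/-- greedy choice of radii -/
lemma layers (hR : AReg ν d C D) {s : ℝ} (hs : 0 < s) (hsD : s ≤ D) {J : ℕ} (hJ : 0 < J) {Q : ℝ}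
    (hQ : (2:ℝ) ^ ⌈C ^ 2 * 12 ^ d⌉₊ ≤ Q) (N : Finset Y)
    (hN : ∀ x ∈ N, ∀ y ∈ N, x ≠ y → s ≤ dist x y) :
    ∃ j : Y → ℕ, (∀ v, j v < J) ∧ ∀ T ⊆ N, T.Nonempty →
      ν.real (⋂ v ∈ T, Lay s (1 / (3 * J)) v (j v)) ≤ (Q / J) ^ T.card * (C * (3 * s) ^ d) := by
  classical
  set δ : ℝ := 1 / (3 * J) with hδ
  have hJ' : (0:ℝ) < J := by exact_mod_cast hJ
  have hδ0 : 0 < δ := by positivity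
  have hJδ : 3 * J * δ = 1 := by rw [hδ]; field_simp
  have hQ0 : 0 < Q := lt_of_lt_of_le (by positivity) hQ
  have hball : ∀ v : Y, ∀ i < J, Lay s δ v i ⊆ ball v (5 / 2 * s) := by
    rintro v i hi y ⟨-, h⟩
    have : (i:ℝ) + 1 ≤ J := by exact_mod_cast hi
    have h2 : (3 * (i:ℝ) + 2) * δ ≤ 1 := by nlinarith
    have : (3 * (i:ℝ) + 2) * (δ * s) ≤ s := by nlinarith
    exact mem_ball.2 (by linarith)
  induction N using Finset.induction_on with
  | empty => exact ⟨fun _ => 0, fun _ => hJ, fun T hT hne => by simp [Finset.subset_empty.1 hT] at hne⟩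
  | insert w M hw ih =>
    obtain ⟨j, hj, hT⟩ := ih fun x hx y hy => hN x (Finset.mem_insert_of_mem hx) y (Finset.mem_insert_of_mem hy)
    set A : Finset Y → Set Y := fun T => ⋂ v ∈ T, Lay s δ v (j v) with hA
    have hAm : ∀ T, MeasurableSet (A T) := fun T => T.measurableSet_biInter fun v _ => Lay_meas _ _ _ _
    set 𝒯 := (M.filter fun v => dist v w < 5 * s).powerset with h𝒯
    have hcard : (𝒯.card : ℝ) ≤ Q := by
      refine le_trans ?_ hQ
      rw [h𝒯, Finset.card_powerset]
      push_cast
      gcongr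
      · norm_num
      · have := hR.card_near hs hsD (M.filter fun v => dist v w < 5 * s)
          (fun x hx y hy => hN x (Finset.mem_insert_of_mem (Finset.mem_of_mem_filter x hx)) y (Finset.mem_insert_of_mem (Finset.mem_of_mem_filter y hy)))
          w (fun x hx => (Finset.mem_filter.1 hx).2)
        exact_mod_cast this.trans (Nat.le_ceil _)
    set B : Finset Y → Set Y := fun T => A T ∩ ball w (3 * s) with hB
    have hBm : ∀ T, MeasurableSet (B T) := fun T => (hAm T).inter measurableSet_ball
    have hsum : ∀ T, ∑ i ∈ Finset.range J, ν.real (B T ∩ Lay s δ w i) / ν.real (B T) ≤ 1 := by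
      intro T
      rw [← Finset.sum_div]
      refine div_le_one_of_le₀ ?_ measureReal_nonneg
      rw [← measureReal_biUnion_finset]
      · exact measureReal_mono (iUnion₂_subset fun i _ => inter_subset_left)
      · intro a _ b _ hab
        exact (Lay_disj (by positivity) w hab).mono inter_subset_right inter_subset_right
      · exact fun i _ => (hBm T).inter (Lay_meas _ _ _ _)
    obtain ⟨i, hi, hi2⟩ := Finset.exists_le_of_sum_le (s := Finset.range J) (f := fun i => ∑ T ∈ 𝒯, ν.real (B T ∩ Lay s δ w i) / ν.real (B T))
      (g := fun _ => Q / J) ⟨0, Finset.mem_range.2 hJ⟩ (by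
        rw [Finset.sum_comm]
        calc _ ≤ ∑ T ∈ 𝒯, (1:ℝ) := Finset.sum_le_sum fun T _ => hsum T
          _ = 𝒯.card := by simp
          _ ≤ Q := hcard
          _ = _ := by simp; field_simp)
    have hi3 : ∀ T ∈ 𝒯, ν.real (B T ∩ Lay s δ w i) ≤ Q / J * ν.real (B T) := by
      intro T hT
      rcases (measureReal_nonneg (μ := ν) (s := B T)).eq_or_lt with h0 | h0
      · rw [← h0, mul_zero, h0]; exact measureReal_mono inter_subset_left
      · rw [← div_le_iff₀ h0]
        exact le_trans (Finset.single_le_sum (f := fun T => ν.real (B T ∩ Lay s δ w i) / ν.real (B T)) (fun T _ => by positivity) hT) hi2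
    have hiJ := Finset.mem_range.1 hi
    refine ⟨Function.update j w i, fun v => ?_, fun T hTN hTne => ?_⟩
    · rcases eq_or_ne v w with rfl | h
      · simpa using hiJ
      · simpa [h] using hj v
    have hsame : ∀ T ⊆ M, (⋂ v ∈ T, Lay s δ v (Function.update j w i v)) = A T := fun T hT => by
      refine iInter₂_congr fun v hv => ?_
      have hvw : v ≠ w := fun h => hw (h ▸ hT hv)
      rw [Function.update_of_ne hvw]
    by_cases hwT : w ∈ T
    · set T' := T.erase w
      have hT'M : T' ⊆ M := fun v hv => (Finset.mem_insert.1 (hTN (Finset.mem_of_mem_erase hv))).resolve_left (Finset.ne_of_mem_erase hv)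
      have hTi : T = insert w T' := (Finset.insert_erase hwT).symm
      have hset : (⋂ v ∈ T, Lay s δ v (Function.update j w i v)) = A T' ∩ Lay s δ w i := by
        rw [hTi, Finset.set_biInter_insert, hsame T' hT'M, inter_comm, Function.update_self]
      rw [hset]
      have hcardT : T.card = T'.card + 1 := by rw [hTi, Finset.card_insert_of_notMem (Finset.notMem_erase _ _)]
      have hsub : A T' ∩ Lay s δ w i ⊆ B T' ∩ Lay s δ w i := fun y hy =>
        ⟨⟨hy.1, ball_subset_ball (by linarith) (hball w i hiJ hy.2)⟩, hy.2⟩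
      by_cases hT𝒯 : T' ∈ 𝒯
      · calc _ ≤ ν.real (B T' ∩ Lay s δ w i) := measureReal_mono hsub
          _ ≤ Q / J * ν.real (B T') := hi3 T' hT𝒯
          _ ≤ Q / J * ((Q/J)^T'.card * (C * (3 * s)^d)) := by
            gcongr
            rcases T'.eq_empty_or_nonempty with h0 | h0
            · rw [h0]; simp only [Finset.card_empty, pow_zero, one_mul]
              exact (measureReal_mono inter_subset_right).trans (hR.upper w _ (by linarith))
            · exact (measureReal_mono inter_subset_left).trans (hT T' hT'M h0)
          _ = _ := by rw [hcardT]; ring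
      · have : A T' ∩ Lay s δ w i = ∅ := by
          rw [h𝒯, Finset.mem_powerset, Finset.not_subset] at hT𝒯
          obtain ⟨v, hv, hv2⟩ := hT𝒯
          rw [eq_empty_iff_forall_notMem]
          rintro y ⟨h1, h2⟩
          have h3 := hball v _ (hj v) (mem_iInter₂.1 h1 v hv)
          have h4 := hball w i hiJ h2
          refine hv2 (Finset.mem_filter.2 ⟨hT'M hv, ?_⟩)
          rw [mem_ball] at h3 h4
          linarith [dist_triangle_left v w y]
        rw [this]
        have hC := hR.Cpos
        simp only [measureReal_empty]
        positivity
    · have hTM : T ⊆ M := fun v hv => (Finset.mem_insert.1 (hTN hv)).resolve_left fun h => hwT (h ▸ hv)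
      rw [hsame T hTM]
      exact hT T hTM hTne

lemma C1_cover (hR : AReg ν d C D) : ∃ Λ > 0, ∀ s, 0 < s → s ≤ D → ∃ (n : ℕ) (v : Fin n → Y) (φ : Fin n → Y → ℝ),
    (∀ i y, 0 ≤ φ i y) ∧ (∀ y, ∑ i, φ i y = 1) ∧ (∀ i y, 0 < φ i y → dist y (v i) < 2 * s) ∧
    (∀ y, (Finset.univ.filter fun i => 0 < φ i y).card ≤ d + 1) ∧
    ∀ i y y', |φ i y - φ i y'| ≤ Λ / s * dist y y' := by
  classical
  have hC := hR.Cpos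
  set N0 : ℕ := ⌈C ^ 2 * 12 ^ d⌉₊ with hN0
  set Q : ℝ := 2 ^ N0 with hQ
  obtain ⟨J, hJ⟩ := exists_nat_gt (Q ^ (d + 1) * C ^ 2 * 9 ^ d)
  have hJ0 : (0:ℝ) < J := lt_trans (by positivity) hJ
  have hJn : 0 < J := by exact_mod_cast hJ0
  set δ : ℝ := 1 / (3 * J) with hδ
  have hδ0 : 0 < δ := by positivity
  have hJδ : 3 * J * δ = 1 := by rw [hδ]; field_simp
  refine ⟨(2 * N0 + 1) * δ⁻¹, by positivity, fun s hs hsD => ?_⟩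
  have hδs : 0 < δ * s := by positivity
  obtain ⟨N, -, hNsep, hNnet⟩ := exists_net (univ : Set Y) hs
  obtain ⟨j, hj, hlay⟩ := layers hR hs hsD hJn (Q := Q) le_rfl N hNsep
  set ρ : Y → ℝ := fun v => s + 3 * j v * (δ * s) with hρ
  have hρ1 : ∀ v, ρ v + 3 * (δ * s) ≤ 2 * s ∧ s ≤ ρ v := fun v => by
    have : (j v : ℝ) + 1 ≤ J := by exact_mod_cast hj v
    refine ⟨?_, by simp only [hρ]; linarith [show 0 ≤ 3 * (j v : ℝ) * (δ * s) by positivity]⟩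
    have : 3 * ((j v : ℝ) + 1) * δ ≤ 1 := by nlinarith
    simp only [hρ]
    nlinarith
  set χ : Y → Y → ℝ := fun v y => max 0 (min 1 ((ρ v + δ * s - dist y v) / (δ * s))) with hχ
  have h01 : ∀ v y, 0 ≤ χ v y ∧ χ v y ≤ 1 := fun v y => ⟨le_max_left _ _, max_le zero_le_one (min_le_left _ _)⟩
  have h01' : ∀ v y, 0 ≤ 1 - χ v y ∧ 1 - χ v y ≤ 1 := fun v y => ⟨by linarith [(h01 v y).2], by linarith [(h01 v y).1]⟩
  have hpos : ∀ v y, 0 < χ v y → dist y v < ρ v + δ * s := fun v y h => by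
    by_contra! hc
    have : (ρ v + δ * s - dist y v) / (δ * s) ≤ 0 := div_nonpos_of_nonpos_of_nonneg (by linarith) hδs.le
    have h2 : χ v y = 0 := max_eq_left ((min_le_right _ _).trans this)
    linarith
  have hone : ∀ v y, dist y v ≤ ρ v → χ v y = 1 := fun v y h => by
    have : 1 ≤ (ρ v + δ * s - dist y v) / (δ * s) := by rw [le_div_iff₀ hδs]; linarith
    simp only [hχ]
    rw [min_eq_left this, max_eq_right zero_le_one]
  have hLip : ∀ v y y', |χ v y - χ v y'| ≤ δ⁻¹ / s * dist y y' := fun v y y' => by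
    have h1 : |(ρ v + δ * s - dist y v) / (δ * s) - (ρ v + δ * s - dist y' v) / (δ * s)| ≤ δ⁻¹ / s * dist y y' := by
      rw [← sub_div, abs_div, abs_of_pos hδs, div_le_iff₀ hδs]
      have : δ⁻¹ / s * dist y y' * (δ * s) = dist y y' := by field_simp
      rw [this, show ρ v + δ * s - dist y v - (ρ v + δ * s - dist y' v) = dist y' v - dist y v by ring, dist_comm y y']
      exact abs_dist_sub_le _ _ _
    exact ((((LipschitzWith.id (α := ℝ)).const_min 1).const_max 0).dist_le_mul _ _).trans (by simpa [Real.dist_eq] using h1)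
  set v : Fin N.card → Y := fun i => (N.equivFin.symm i : Y) with hv
  have hvinj : Function.Injective v := fun a b h => N.equivFin.symm.injective (Subtype.ext h)
  have hvN : ∀ i, v i ∈ N := fun i => (N.equivFin.symm i).2
  have hcov : ∀ y, ∃ i, dist y (v i) < s := fun y => by
    obtain ⟨w, hw, hyw⟩ := hNnet y (mem_univ _)
    exact ⟨N.equivFin ⟨w, hw⟩, by simpa [hv] using hyw⟩
  set φ : Fin N.card → Y → ℝ := fun i y => χ (v i) y * ∏ k ∈ Finset.univ.filter (fun k => k < i), (1 - χ (v k) y) with hφ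
  have hprod0 : ∀ i y, 0 ≤ ∏ k ∈ Finset.univ.filter (fun k => k < i), (1 - χ (v k) y) := fun i y =>
    Finset.prod_nonneg fun k _ => (h01' _ _).1
  have hφχ : ∀ i y, 0 < φ i y → 0 < χ (v i) y := fun i y h => by
    refine lt_of_le_of_ne (h01 _ _).1 fun h0 => ?_
    simp only [hφ, ← h0, zero_mul, lt_irrefl] at h
  refine ⟨N.card, v, φ, fun i y => mul_nonneg (h01 _ _).1 (hprod0 i y), fun y => ?_, fun i y h => ?_, fun y => ?_, fun i y y' => ?_⟩
  · have := Finset.prod_one_sub_ordered Finset.univ (fun i => χ (v i) y)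
    have h0 : ∏ i, (1 - χ (v i) y) = 0 := by
      obtain ⟨i, hi⟩ := hcov y
      exact Finset.prod_eq_zero (Finset.mem_univ i) (by rw [hone _ _ (hi.le.trans (hρ1 _).2)]; ring)
    rw [h0] at this
    simp only [hφ]
    linarith
  · linarith [hpos _ _ (hφχ i y h), hρ1 (v i)]
  · by_contra! hcon
    set P := Finset.univ.filter fun i => 0 < φ i y with hP
    have hPne : P.Nonempty := Finset.card_pos.1 (by omega)
    set i0 := P.max' hPne
    have hi0 : i0 ∈ P := P.max'_mem hPne
    set T := (P.erase i0).image v with hT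
    have hTc : T.card = P.card - 1 := by rw [hT, Finset.card_image_of_injective _ hvinj, Finset.card_erase_of_mem hi0]
    obtain ⟨T', hT'T, hT'c⟩ := Finset.exists_subset_card_eq (s := T) (n := d + 1) (by omega)
    have hT'ne : T'.Nonempty := Finset.card_pos.1 (by omega)
    have hT'N : T' ⊆ N := fun w hw => by
      obtain ⟨i, -, rfl⟩ := Finset.mem_image.1 (hT'T hw)
      exact hvN i
    have hb := hlay T' hT'N hT'ne
    have hsub : ball y (δ * s) ⊆ ⋂ w ∈ T', Lay s δ w (j w) := by
      intro z hz
      refine mem_iInter₂.2 fun w hw => ?_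
      obtain ⟨i, hi, rfl⟩ := Finset.mem_image.1 (hT'T hw)
      have hiP := Finset.mem_of_mem_erase hi
      have hlt : i < i0 := lt_of_le_of_ne (P.le_max' i hiP) (Finset.ne_of_mem_erase hi)
      have h1 := hpos _ _ (hφχ i y (Finset.mem_filter.1 hiP).2)
      have h2 : ρ (v i) < dist y (v i) := by
        by_contra! hc
        have h3 : φ i0 y = 0 := by
          simp only [hφ]
          rw [Finset.prod_eq_zero (i := i) (by simpa using hlt) (by rw [hone _ _ hc]; ring), mul_zero]
        have := (Finset.mem_filter.1 hi0).2
        rw [h3] at this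
        exact lt_irrefl _ this
      rw [mem_ball] at hz
      simp only [hρ] at h1 h2
      have h4 := dist_triangle_left y (v i) z
      have h5 := dist_triangle z y (v i)
      constructor <;> nlinarith
    have hlow := hR.lower y (δ * s) hδs (by
      have : δ ≤ 1 := by
        have : (1:ℝ) ≤ J := by exact_mod_cast hJn
        nlinarith
      nlinarith)
    have : C⁻¹ * (δ ^ d * s ^ d) ≤ Q ^ (d + 1) / (J:ℝ) ^ (d + 1) * (C * (3 ^ d * s ^ d)) := by
      rw [← mul_pow, ← mul_pow, ← div_pow]
      rw [hT'c] at hb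
      exact hlow.trans ((measureReal_mono hsub).trans hb)
    have hsd : 0 < s ^ d := by positivity
    have e1 : C⁻¹ * (δ ^ d * s ^ d) = (C * 3 ^ d * J ^ (d+1))⁻¹ * s ^ d * J := by
      rw [hδ, div_pow, mul_pow, one_pow]; field_simp; rw [pow_succ]
    have e2 : Q ^ (d + 1) / (J:ℝ) ^ (d + 1) * (C * (3 ^ d * s ^ d)) = (C * 3 ^ d * J ^ (d+1))⁻¹ * s ^ d * (Q ^ (d+1) * C ^ 2 * 9 ^ d) := by
      rw [show (9:ℝ) = 3 * 3 by norm_num, mul_pow]; field_simp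
    rw [e1, e2] at this
    exact absurd (le_of_mul_le_mul_left this (by positivity)) (not_le.2 hJ)
  · have hl0 : 0 ≤ δ⁻¹ / s * dist y y' := by positivity
    set F := Finset.univ.filter fun k => χ (v k) y ≠ χ (v k) y' with hF
    have hnear : ∀ y0 : Y, ((Finset.univ.filter fun k => 0 < χ (v k) y0).card : ℝ) ≤ N0 := fun y0 => by
      have := hR.card_near hs hsD ((Finset.univ.filter fun k => 0 < χ (v k) y0).image v) (fun x hx y hy => by
        obtain ⟨a, -, rfl⟩ := Finset.mem_image.1 hx
        obtain ⟨b, -, rfl⟩ := Finset.mem_image.1 hy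
        exact hNsep _ (hvN a) _ (hvN b)) y0 (fun x hx => by
        obtain ⟨a, ha, rfl⟩ := Finset.mem_image.1 hx
        rw [dist_comm]
        linarith [hpos _ _ (Finset.mem_filter.1 ha).2, hρ1 (v a)])
      rw [Finset.card_image_of_injective _ hvinj] at this
      exact this.trans (Nat.le_ceil _)
    have hFc : (F.card : ℝ) ≤ 2 * N0 := by
      have : F ⊆ (Finset.univ.filter fun k => 0 < χ (v k) y) ∪ (Finset.univ.filter fun k => 0 < χ (v k) y') := fun k hk => by
        simp only [Finset.mem_union, Finset.mem_filter, Finset.mem_univ, true_and]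
        by_contra! hc
        refine (Finset.mem_filter.1 hk).2 ?_
        rw [le_antisymm hc.1 (h01 _ _).1, le_antisymm hc.2 (h01 _ _).1]
      have h2 := (Finset.card_le_card this).trans (Finset.card_union_le _ _)
      have h3 : (F.card : ℝ) ≤ (Finset.univ.filter fun k => 0 < χ (v k) y).card + (Finset.univ.filter fun k => 0 < χ (v k) y').card := by exact_mod_cast h2
      linarith [hnear y, hnear y']
    have hprod : |∏ k ∈ Finset.univ.filter (fun k => k < i), (1 - χ (v k) y) - ∏ k ∈ Finset.univ.filter (fun k => k < i), (1 - χ (v k) y')| ≤ 2 * N0 * (δ⁻¹ / s * dist y y') := by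
      refine (abs_prod_sub_prod _ _ _ (fun k => h01' _ _) (fun k => h01' _ _)).trans ?_
      calc _ ≤ ∑ k, |(1 - χ (v k) y) - (1 - χ (v k) y')| := Finset.sum_le_sum_of_subset_of_nonneg (Finset.filter_subset _ _) fun _ _ _ => abs_nonneg _
        _ = ∑ k ∈ F, |(1 - χ (v k) y) - (1 - χ (v k) y')| := by
          refine (Finset.sum_subset (Finset.subset_univ _) fun k _ hk => ?_).symm
          have : χ (v k) y = χ (v k) y' := by simpa [hF] using hk
          simp [this]
        _ ≤ ∑ k ∈ F, δ⁻¹ / s * dist y y' := Finset.sum_le_sum fun k _ => by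
          rw [show (1 - χ (v k) y) - (1 - χ (v k) y') = -(χ (v k) y - χ (v k) y') by ring, abs_neg]; exact hLip _ _ _
        _ ≤ _ := by rw [Finset.sum_const, nsmul_eq_mul]; gcongr
    have hp1 : |∏ k ∈ Finset.univ.filter (fun k => k < i), (1 - χ (v k) y')| ≤ 1 := by
      rw [abs_of_nonneg (hprod0 i y')]
      exact Finset.prod_le_one (fun k _ => (h01' _ _).1) fun k _ => (h01' _ _).2
    simp only [hφ]
    set p := ∏ k ∈ Finset.univ.filter (fun k => k < i), (1 - χ (v k) y)
    set p' := ∏ k ∈ Finset.univ.filter (fun k => k < i), (1 - χ (v k) y')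
    calc _ = |χ (v i) y * (p - p') + (χ (v i) y - χ (v i) y') * p'| := by congr 1; ring
      _ ≤ |χ (v i) y| * |p - p'| + |χ (v i) y - χ (v i) y'| * |p'| := by
        rw [← abs_mul, ← abs_mul]; exact abs_add_le _ _
      _ ≤ 1 * (2 * N0 * (δ⁻¹ / s * dist y y')) + (δ⁻¹ / s * dist y y') * 1 := by
        gcongr
        · rw [abs_of_nonneg (h01 _ _).1]; exact (h01 _ _).2
        · exact hLip _ _ _
      _ = _ := by ring
end
end

section
open MeasureTheory Metric Set Filter Topology
set_option linter.unusedSectionVars false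

section C2
variable {ι : Type} [Fintype ι] [DecidableEq ι]

def Dl (S : Finset ι) : Set (ι → ℝ) := {w | (∀ i, 0 ≤ w i) ∧ (∀ i, i ∉ S → w i = 0) ∧ ∑ i, w i = 1}
noncomputable def sp (w : ι → ℝ) : Finset ι := Finset.univ.filter fun i => 0 < w i
def Good (adj : ι → ι → Prop) (n : ℕ) (S : Finset ι) : Prop := S.card ≤ n + 1 ∧ ∀ i ∈ S, ∀ j ∈ S, adj i j
def KK (adj : ι → ι → Prop) (n : ℕ) : Set (ι → ℝ) := {w | w ∈ Dl (Finset.univ : Finset ι) ∧ Good adj n (sp w)}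

theorem mem_sp {w : ι → ℝ} {i : ι} : i ∈ sp w ↔ 0 < w i := by simp [sp]

theorem Good.mono {adj : ι → ι → Prop} {n m : ℕ} {S T : Finset ι} (h : Good adj n S) (hT : T ⊆ S) (hn : n ≤ m) : Good adj m T :=
  ⟨(Finset.card_le_card hT).trans (by have := h.1; omega), fun i hi j hj => h.2 i (hT hi) j (hT hj)⟩

theorem Dl_sp {S : Finset ι} {w : ι → ℝ} (h : w ∈ Dl S) : sp w ⊆ S := fun i hi => by
  by_contra hc
  exact (mem_sp.1 hi).ne' (h.2.1 i hc)

theorem Dl_mono {S T : Finset ι} (h : S ⊆ T) : Dl S ⊆ Dl T := fun _ hw => ⟨hw.1, fun i hi => hw.2.1 i fun hc => hi (h hc), hw.2.2⟩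

theorem Dl_self {w : ι → ℝ} (h : w ∈ Dl (Finset.univ : Finset ι)) : w ∈ Dl (sp w) :=
  ⟨h.1, fun i hi => le_antisymm (not_lt.1 fun hc => hi (mem_sp.2 hc)) (h.1 i), h.2.2⟩

theorem Dl_closed (S : Finset ι) : IsClosed (Dl S) := by
  have e : Dl S = (⋂ i, {w : ι → ℝ | 0 ≤ w i}) ∩ (⋂ i, {w : ι → ℝ | i ∉ S → w i = 0}) ∩ {w : ι → ℝ | ∑ i, w i = 1} := by
    ext w; simp [Dl, and_assoc]
  rw [e]
  refine ((isClosed_iInter fun i => ?_).inter (isClosed_iInter fun i => ?_)).inter (isClosed_eq (by fun_prop) continuous_const)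
  · exact isClosed_le continuous_const (continuous_apply i)
  · by_cases hi : i ∈ S
    · simp [hi]
    · simpa [hi] using isClosed_eq (continuous_apply i) continuous_const

theorem Dl_le_one {S : Finset ι} {w : ι → ℝ} (h : w ∈ Dl S) (i : ι) : w i ≤ 1 := by
  rw [← h.2.2]
  exact Finset.single_le_sum (f := w) (fun j _ => h.1 j) (Finset.mem_univ i)

theorem Dl_compact (S : Finset ι) : IsCompact (Dl S) :=
  (isCompact_Icc (a := (0 : ι → ℝ)) (b := 1)).of_isClosed_subset (Dl_closed S) fun _ hw => ⟨fun i => hw.1 i, fun i => Dl_le_one hw i⟩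

theorem KK_eq (adj : ι → ι → Prop) (n : ℕ) : KK adj n = ⋃ S : {S : Finset ι // Good adj n S}, Dl S.1 := by
  ext w
  simp only [KK, mem_iUnion]
  exact ⟨fun h => ⟨⟨sp w, h.2⟩, Dl_self h.1⟩, fun ⟨S, h⟩ => ⟨Dl_mono (Finset.subset_univ _) h, S.2.mono (Dl_sp h) le_rfl⟩⟩

theorem KK_compact (adj : ι → ι → Prop) (n : ℕ) : IsCompact (KK adj n) := by
  rw [KK_eq]; exact isCompact_iUnion fun S => Dl_compact _

theorem Dl_conv {S : Finset ι} {v w : ι → ℝ} (hv : v ∈ Dl S) (hw : w ∈ Dl S) {t : ℝ} (ht : t ∈ Icc (0:ℝ) 1) :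
    (fun i => (1 - t) * v i + t * w i) ∈ Dl S := by
  refine ⟨fun i => ?_, fun i hi => by simp [hv.2.1 i hi, hw.2.1 i hi], ?_⟩
  · have := ht.1; have := ht.2; have := hv.1 i; have := hw.1 i
    have : 0 ≤ 1 - t := by linarith
    positivity
  · rw [Finset.sum_add_distrib, ← Finset.mul_sum, ← Finset.mul_sum, hv.2.2, hw.2.2]; ring

theorem Dl_nonempty {S : Finset ι} {w : ι → ℝ} (h : w ∈ Dl S) : (sp w).Nonempty := by
  by_contra hc
  rw [Finset.not_nonempty_iff_eq_empty] at hc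
  have : ∑ i, w i = 0 := Finset.sum_eq_zero fun i _ => (Dl_self (Dl_mono (Finset.subset_univ _) h)).2.1 i (by simp [hc])
  rw [h.2.2] at this
  exact one_ne_zero this

/-- factorization through a quotient by a compact set -/
theorem quot_fac {X W Z : Type*} [TopologicalSpace X] [TopologicalSpace W] [T2Space W] [TopologicalSpace Z] [Nonempty Z]
    {K : Set X} (hK : IsCompact K) {π : X → W} {g : X → Z} (hπ : ContinuousOn π K) (hg : ContinuousOn g K)
    (h : ∀ a ∈ K, ∀ b ∈ K, π a = π b → g a = g b) :
    ∃ ρ : W → Z, ContinuousOn ρ (π '' K) ∧ ∀ a ∈ K, ρ (π a) = g a := by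
  classical
  set ρ : W → Z := fun w => if hw : ∃ a ∈ K, π a = w then g hw.choose else Classical.arbitrary Z with hρ
  have key : ∀ a ∈ K, ρ (π a) = g a := fun a ha => by
    have hw : ∃ b ∈ K, π b = π a := ⟨a, ha, rfl⟩
    simp only [hρ, dif_pos hw]
    exact h _ hw.choose_spec.1 _ ha hw.choose_spec.2
  refine ⟨ρ, ?_, key⟩
  rw [continuousOn_iff_isClosed]
  intro t ht
  obtain ⟨u, hu, hu2⟩ := continuousOn_iff_isClosed.1 hg t ht
  refine ⟨π '' (u ∩ K), ((hK.inter_left hu).image_of_continuousOn (hπ.mono inter_subset_right)).isClosed, ?_⟩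
  ext w
  constructor
  · rintro ⟨h1, a, ha, rfl⟩
    have : a ∈ g ⁻¹' t ∩ K := ⟨by simpa [key a ha] using h1, ha⟩
    rw [hu2] at this
    exact ⟨⟨a, this, rfl⟩, a, ha, rfl⟩
  · rintro ⟨⟨a, ha, rfl⟩, -⟩
    rw [← hu2] at ha
    exact ⟨by simpa [key a ha.2] using ha.1, a, ha.2, rfl⟩

noncomputable def bar (S : Finset ι) : ι → ℝ := fun i => if i ∈ S then (S.card : ℝ)⁻¹ else 0

theorem bar_mem {S : Finset ι} (h : S.Nonempty) : bar S ∈ Dl S := by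
  have hc : (0:ℝ) < S.card := by exact_mod_cast h.card_pos
  refine ⟨fun i => ?_, fun i hi => by simp [bar, hi], ?_⟩
  · unfold bar; split_ifs <;> positivity
  · simp [bar, hc.ne']

noncomputable def pj (S : Finset ι) (p : ℝ × (ι → ℝ)) : ι → ℝ := fun i => (1 - p.1) * p.2 i + p.1 * bar S i

def Bd (S : Finset ι) : Set (ι → ℝ) := {w | w ∈ Dl S ∧ ∃ j ∈ S, w j = 0}

theorem Bd_compact (S : Finset ι) : IsCompact (Bd S) := by
  have e : Bd S = ⋃ j ∈ (S : Set ι), Dl S ∩ {w : ι → ℝ | w j = 0} := by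
    ext w; simp [Bd]
  rw [e]
  exact S.finite_toSet.isCompact_biUnion fun j _ => (Dl_compact S).inter_right (isClosed_eq (continuous_apply j) continuous_const)

theorem pj_surj {S : Finset ι} (hS : 2 ≤ S.card) {w : ι → ℝ} (hw : w ∈ Dl S) :
    ∃ p ∈ Icc (0:ℝ) 1 ×ˢ Bd S, pj S p = w := by
  have hne : S.Nonempty := Finset.card_pos.1 (by omega)
  obtain ⟨j, hj, hmin⟩ := S.exists_min_image w hne
  have hc : (0:ℝ) < S.card := by exact_mod_cast hne.card_pos
  have hsum : ∑ i ∈ S, w i = 1 := by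
    rw [← hw.2.2]; exact Finset.sum_subset (Finset.subset_univ _) fun i _ hi => hw.2.1 i hi
  have hdiff : ∑ i ∈ S, (w i - w j) = 1 - S.card * w j := by
    rw [Finset.sum_sub_distrib, hsum]; simp
  have ht1 : S.card * w j ≤ 1 := by
    have := Finset.sum_nonneg (s := S) (f := fun i => w i - w j) fun i hi => by linarith [hmin i hi]
    linarith
  rcases ht1.lt_or_eq with h | h
  · have h' : 0 < 1 - S.card * w j := by linarith
    refine ⟨(S.card * w j, fun i => if i ∈ S then (w i - w j) / (1 - S.card * w j) else 0), ⟨⟨mul_nonneg hc.le (hw.1 j), ht1⟩, ⟨fun i => ?_, fun i hi => by simp [hi], ?_⟩, j, hj, by simp⟩, ?_⟩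
    · simp only
      split_ifs with hi
      · exact div_nonneg (by linarith [hmin i hi]) h'.le
      · exact le_rfl
    · simp only [Finset.sum_ite_mem, Finset.univ_inter]
      rw [← Finset.sum_div, hdiff, div_self h'.ne']
    · ext i
      simp only [pj, bar]
      split_ifs with hi
      · field_simp; ring
      · simp [hw.2.1 i hi]
  · rw [h, sub_self, Finset.sum_eq_zero_iff_of_nonneg (fun i hi => by linarith [hmin i hi])] at hdiff
    obtain ⟨i0, hi0, hij⟩ := Finset.exists_mem_ne (by omega : 1 < S.card) j
    refine ⟨(1, Pi.single i0 1), ⟨by simp, ⟨fun i => ?_, fun i hi => ?_, by simp⟩, j, hj, by simp [hij.symm]⟩, ?_⟩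
    · by_cases hi : i = i0
      · subst hi; simp
      · simp [hi]
    · have : i ≠ i0 := fun hc => hi (hc ▸ hi0)
      simp [this]
    · ext i
      simp only [pj, bar]
      split_ifs with hi
      · have := hdiff i hi
        field_simp
        rw [show w i = w j by linarith]; linarith
      · simp [hw.2.1 i hi]

theorem pj_inj {S : Finset ι} {p q : ℝ × (ι → ℝ)} (hp : p ∈ Icc (0:ℝ) 1 ×ˢ Bd S) (hq : q ∈ Icc (0:ℝ) 1 ×ˢ Bd S)
    (h : pj S p = pj S q) : p.1 = q.1 ∧ (p.1 = 1 ∨ p.2 = q.2) := by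
  have key : ∀ {p q : ℝ × (ι → ℝ)}, p ∈ Icc (0:ℝ) 1 ×ˢ Bd S → q ∈ Icc (0:ℝ) 1 ×ˢ Bd S → pj S p = pj S q → p.1 ≤ q.1 := by
    intro p q hp hq h
    obtain ⟨j, hj, h0⟩ := hq.2.2
    have := congrFun h j
    have hc : (0:ℝ) < (S.card : ℝ)⁻¹ := by
      have : 0 < S.card := Finset.card_pos.2 ⟨j, hj⟩
      positivity
    simp only [pj, bar, hj, if_true, h0, mul_zero, zero_add] at this
    have h1 : 0 ≤ (1 - p.1) * p.2 j := mul_nonneg (by linarith [hp.1.2]) (hp.2.1.1 j)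
    by_contra! hcon
    nlinarith
  have e := le_antisymm (key hp hq h) (key hq hp h.symm)
  refine ⟨e, or_iff_not_imp_left.2 fun h1 => ?_⟩
  ext i
  have := congrFun h i
  simp only [pj, e, add_left_inj] at this
  exact mul_left_cancel₀ (sub_ne_zero.2 fun hc => h1 (e.trans hc.symm)) this

theorem pj_mem {S : Finset ι} {p : ℝ × (ι → ℝ)} (hp : p ∈ Icc (0:ℝ) 1 ×ˢ Bd S) : pj S p ∈ Dl S := by
  obtain ⟨j, hj, -⟩ := hp.2.2
  exact Dl_conv hp.2.1 (bar_mem ⟨j, hj⟩) hp.1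

def LLC (Y : Type*) [MetricSpace Y] (L r0 : ℝ) : Prop := ∀ (x : Y) (r : ℝ), 0 < r → r ≤ r0 → ∃ (H : ℝ → Y → Y) (q : Y),
  ContinuousOn (fun p : ℝ × Y => H p.1 p.2) (Icc 0 1 ×ˢ ball x r) ∧ (∀ y ∈ ball x r, H 0 y = y ∧ H 1 y = q) ∧
    ∀ t ∈ Icc (0:ℝ) 1, ∀ y ∈ ball x r, H t y ∈ ball x (L * r)

noncomputable def Bs (L : ℝ) : ℕ → ℝ
  | 0 => 0
  | n + 1 => 2 * L * (2 * Bs L n + 7) + 6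

theorem Bs_nonneg {L : ℝ} (hL : 1 ≤ L) (n : ℕ) : 0 ≤ Bs L n := by
  induction n with
  | zero => exact le_rfl
  | succ n ih => simp only [Bs]; positivity

theorem C2_main {Y : Type*} [MetricSpace Y] {L r0 : ℝ} (hL : 1 ≤ L) (hY : LLC Y L r0) (pos : ι → Y) (sc : ι → ℝ) (hsc : ∀ i, 0 < sc i)
    (adj : ι → ι → Prop) (hadj : ∀ i j, adj i j → dist (pos i) (pos j) ≤ 2 * (sc i + sc j) ∧ sc i ≤ 2 * sc j) [Nonempty Y] (n : ℕ)
    (hB : ∀ i, Bs L n * sc i ≤ r0) :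
    ∃ ρ : (ι → ℝ) → Y, ContinuousOn ρ (KK adj n) ∧ ∀ w ∈ KK adj n, ∀ i ∈ sp w, dist (ρ w) (pos i) ≤ Bs L n * sc i := by
  induction n with
  | zero =>
    have hk : ∀ w ∈ KK adj 0, ∀ i ∈ sp w, w = Pi.single i 1 := by
      intro w hw i hi
      have h1 : sp w = {i} := by
        have := hw.2.1
        exact Finset.eq_singleton_iff_unique_mem.2 ⟨hi, fun x hx => Finset.card_le_one.1 (by simpa using this) x hx i hi⟩
      have h2 := Dl_self hw.1
      rw [h1] at h2
      have h3 : w i = 1 := by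
        rw [← h2.2.2, Finset.sum_eq_single i (fun j _ hj => h2.2.1 j (by simpa using hj)) (by simp)]
      ext j
      by_cases hj : j = i
      · subst hj; simpa using h3
      · rw [h2.2.1 j (by simpa using hj)]; simp [hj]
    classical
    refine ⟨fun w => if h : ∃ i, w i = 1 then pos h.choose else Classical.arbitrary Y, ?_, ?_⟩
    · refine Set.Finite.continuousOn ((Set.finite_range fun i : ι => (Pi.single i 1 : ι → ℝ)).subset ?_) _
      intro w hw
      obtain ⟨i, hi⟩ := Dl_nonempty hw.1
      exact ⟨i, (hk w hw i hi).symm⟩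
    · intro w hw i hi
      have hwi := hk w hw i hi
      have hex : ∃ i, w i = 1 := ⟨i, by rw [hwi]; simp⟩
      have : hex.choose = i := by
        have h := hex.choose_spec
        by_contra hc
        have h2 := congrFun hwi hex.choose
        rw [Pi.single_eq_of_ne hc, h] at h2
        exact one_ne_zero h2
      simp only [dif_pos hex, this, Bs, dist_self, zero_mul, le_refl]
  | succ n ih =>
    have hB0 := Bs_nonneg hL n
    have hBle : 2 * Bs L n + 7 ≤ Bs L (n+1) := by simp only [Bs]; nlinarith
    obtain ⟨ρ, hρ, hρd⟩ := ih fun i => (mul_le_mul_of_nonneg_right (by linarith) (hsc i).le).trans (hB i)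
    have step : ∀ S : Finset ι, S.card = n + 2 → Good adj (n+1) S → ∃ σ : (ι → ℝ) → Y, ContinuousOn σ (Dl S) ∧
        (∀ w ∈ Bd S, σ w = ρ w) ∧ ∀ w ∈ Dl S, ∀ i ∈ S, dist (σ w) (pos i) ≤ Bs L (n+1) * sc i := by
      intro S hSc hS
      obtain ⟨j0, hj0⟩ : S.Nonempty := Finset.card_pos.1 (by omega)
      obtain ⟨H, q, hHc, hH01, hHb⟩ := hY (pos j0) ((2 * Bs L n + 7) * sc j0) (mul_pos (by linarith) (hsc _))
        ((mul_le_mul_of_nonneg_right hBle (hsc _).le).trans (hB j0))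
      have hBdK : Bd S ⊆ KK adj n := by
        rintro w ⟨hw, j, hj, h0⟩
        refine ⟨Dl_mono (Finset.subset_univ _) hw, ?_, (hS.mono (Dl_sp hw) le_rfl).2⟩
        have : sp w ⊆ S.erase j := fun i hi => Finset.mem_erase.2 ⟨fun hc => by
          subst hc; exact (mem_sp.1 hi).ne' h0, Dl_sp hw hi⟩
        have := Finset.card_le_card this
        rw [Finset.card_erase_of_mem hj] at this
        omega
      have hball : ∀ b ∈ Bd S, ρ b ∈ ball (pos j0) ((2 * Bs L n + 7) * sc j0) := by
        intro b hb
        obtain ⟨i, hi⟩ := Dl_nonempty hb.1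
        have h1 := hρd b (hBdK hb) i hi
        have h2 := hadj i j0 (hS.2 i (Dl_sp hb.1 hi) j0 hj0)
        have h3 := dist_triangle (ρ b) (pos i) (pos j0)
        rw [mem_ball]
        have := hsc j0
        nlinarith [mul_le_mul_of_nonneg_left h2.2 hB0]
      obtain ⟨σ, hσ, hσe⟩ := quot_fac (K := Icc (0:ℝ) 1 ×ˢ Bd S) (isCompact_Icc.prod (Bd_compact S)) (π := pj S)
        (g := fun p => H p.1 (ρ p.2)) (by unfold pj; fun_prop)
        (hHc.comp (continuousOn_fst.prodMk (hρ.comp continuousOn_snd fun p hp => hBdK hp.2)) fun p hp => ⟨hp.1, hball _ hp.2⟩)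
        (fun p hp q hq h => by
          obtain ⟨e1, e2⟩ := pj_inj hp hq h
          rcases e2 with e2 | e2
          · simp only [← e1, e2]
            rw [(hH01 _ (hball _ hp.2)).2, (hH01 _ (hball _ hq.2)).2]
          · simp only [e1, e2])
      have himg : Dl S ⊆ pj S '' (Icc (0:ℝ) 1 ×ˢ Bd S) := fun w hw => pj_surj (by omega) hw
      refine ⟨σ, hσ.mono himg, fun w hw => ?_, fun w hw i hi => ?_⟩
      · have := hσe (0, w) ⟨by simp, hw⟩
        have e : pj S (0, w) = w := by ext i; simp [pj]
        rw [e] at this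
        rw [this, (hH01 _ (hball _ hw)).1]
      · obtain ⟨p, hp, rfl⟩ := himg hw
        rw [hσe p hp]
        have h1 := hHb p.1 hp.1 _ (hball _ hp.2)
        rw [mem_ball] at h1
        have h2 := hadj j0 i (hS.2 j0 hj0 i hi)
        have h3 := dist_triangle (H p.1 (ρ p.2)) (pos j0) (pos i)
        simp only [Bs]
        have h4 : L * (2 * Bs L n + 7) * sc j0 ≤ L * (2 * Bs L n + 7) * (2 * sc i) := mul_le_mul_of_nonneg_left h2.2 (by positivity)
        have := hsc i
        nlinarith
    choose! σ hσ1 hσ2 hσ3 using step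
    classical
    set ρ' : (ι → ℝ) → Y := fun w => if (sp w).card ≤ n + 1 then ρ w else σ (sp w) w with hρ'
    have hcard : ∀ w ∈ KK adj (n+1), ¬ (sp w).card ≤ n + 1 → (sp w).card = n + 2 := fun w hw h => by
      have := hw.2.1; omega
    refine ⟨ρ', ?_, fun w hw i hi => ?_⟩
    · rw [KK_eq]
      refine (locallyFinite_of_finite _).continuousOn_iUnion (fun S => Dl_closed _) fun S => ?_
      by_cases hc : S.1.card ≤ n + 1
      · refine (hρ.mono ?_).congr fun w hw => ?_
        · rw [KK_eq]; exact subset_iUnion_of_subset ⟨S.1, hc, S.2.2⟩ subset_rfl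
        · simp only [hρ', (Finset.card_le_card (Dl_sp hw)).trans hc, if_true]
      · have hc2 : S.1.card = n + 2 := by have := S.2.1; omega
        refine (hσ1 S.1 hc2 S.2).congr fun w hw => ?_
        by_cases hs : sp w = S.1
        · simp only [hρ', hs, hc, if_false]
        · obtain ⟨j, hj, hjn⟩ := Finset.exists_of_ssubset ((Dl_sp hw).ssubset_of_ne hs)
          have hwB : w ∈ Bd S.1 := ⟨hw, j, hj, le_antisymm (not_lt.1 fun h => hjn (mem_sp.2 h)) (hw.1 j)⟩
          have := Finset.card_lt_card ((Dl_sp hw).ssubset_of_ne hs)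
          rw [hσ2 S.1 hc2 S.2 w hwB]
          simp only [hρ', if_pos (show (sp w).card ≤ n + 1 by omega)]
    · by_cases hc : (sp w).card ≤ n + 1
      · simp only [hρ', if_pos hc]
        exact (hρd w ⟨hw.1, hc, hw.2.2⟩ i hi).trans (mul_le_mul_of_nonneg_right (by linarith) (hsc i).le)
      · simp only [hρ', if_neg hc]
        exact hσ3 _ (hcard w hw hc) hw.2 w (Dl_self hw.1) i hi

end C2
end

section
open MeasureTheory Metric Set Filter Topology
set_option linter.unusedSectionVars false

section C3
variable {Y : Type*} [MetricSpace Y] [CompactSpace Y] {d : ℕ}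

theorem exists_G0 (hch : ∀ x : Y, ∃ e : OpenPartialHomeomorph Y (XX d), x ∈ e.source)
    (hFF : ∀ f : Y → XX d, Lip f → ∀ᵐ y, (f ⁻¹' {y}).Finite) (p : Y) {ε : ℝ} (hε : 0 < ε) :
    ∃ (f : Y → XX d) (l : Y → ℝ), Continuous f ∧ Continuous l ∧ (∀ x, f x ≠ 0 ∨ l x ≠ 0) ∧ OddG f l ∧ ∀ x, l x < 0 → dist x p < ε := by
  obtain ⟨e0, he0⟩ := hch p
  set e := e0.transHomeomorph (Homeomorph.addRight (-(e0 p))) with he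
  have hpe : p ∈ e.source := by simpa [he] using he0
  have hep : e p = 0 := by simp [he]
  obtain ⟨r1, hr1, hb⟩ := Metric.nhds_basis_closedBall.mem_iff.1 (e.open_source.mem_nhds hpe)
  set r := min r1 ε with hr
  have hr0 : 0 < r := lt_min hr1 hε
  have hbr : closedBall p r ⊆ e.source := (closedBall_subset_closedBall (min_le_left _ _)).trans hb
  obtain ⟨f, hf, hfe⟩ := tietze (K := closedBall p r) isClosed_closedBall (e.continuousOn.mono hbr)
  have hl : Continuous fun x => dist x p - r / 2 := by fun_prop
  have hz : ∀ x, f x = 0 → dist x p ≤ r → x = p := fun x h0 hx => by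
    rw [hfe x hx] at h0
    exact e.injOn (hbr hx) hpe (h0.trans hep.symm)
  have hn : ∀ x, f x ≠ 0 ∨ dist x p - r / 2 ≠ 0 := fun x => by
    by_contra! hc
    have := hz x hc.1 (by linarith)
    subst this
    have := hc.2
    rw [dist_self] at this
    linarith
  refine ⟨f, fun x => dist x p - r / 2, hf, hl, hn, ?_, fun x hx => by
    have : r ≤ ε := min_le_right _ _
    linarith⟩
  exact OddG.start hch hFF hf hl (p := p) hn (fun x h0 hx => hz x h0 (by linarith)) (by simpa using hr0) e hpe hep (closedBall_mem_nhds p hr0) hfe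

theorem G0_c {f : Y → XX d} {l : Y → ℝ} (hf : Continuous f) (hl : Continuous l) (hn : ∀ x, f x ≠ 0 ∨ l x ≠ 0) :
    ∃ c > 0, ∀ x, c ≤ ‖f x‖ ∨ c ≤ |l x| := by
  obtain ⟨c, hc, h⟩ := cpt_pos (isCompact_univ (X := Y)) (f := fun x => max ‖f x‖ |l x|) (by fun_prop) fun x _ => by
    rcases hn x with h | h
    · exact lt_max_of_lt_left (norm_pos_iff.2 h)
    · exact lt_max_of_lt_right (abs_pos.2 h)
  exact ⟨c, hc, fun x => le_max_iff.1 (h x (mem_univ x))⟩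

variable [MeasurableSpace Y] [BorelSpace Y] {ν : Measure Y} [IsFiniteMeasure ν] {C D L r0 : ℝ}

theorem levels (hR : AReg ν d C D) (hL : 1 ≤ L) (hY : LLC Y L r0)
    (hch : ∀ x : Y, ∃ e : OpenPartialHomeomorph Y (XX d), x ∈ e.source)
    (hFF : ∀ f : Y → XX d, Lip f → ∀ᵐ y, (f ⁻¹' {y}).Finite) :
    ∃ Λ > 0, ∀ s, 0 < s → s ≤ D → Bs L (2*d+1) * s ≤ r0 → ∀ (f : Y → XX d) (l : Y → ℝ), Continuous f → Continuous l →
      (∀ x, f x ≠ 0 ∨ l x ≠ 0) → OddG f l →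
      ∃ (ι : Type) (_ : Fintype ι) (_ : DecidableEq ι) (v : ι → Y) (φ : Y → ι → ℝ) (ρ : (ι → ℝ) → Y) (adj : ι → ι → Prop),
        (∀ y, φ y ∈ KK adj (2*d+1)) ∧ (∀ y, ∀ i ∈ sp (φ y), dist y (v i) < 2 * s) ∧ (∀ y, (sp (φ y)).card ≤ d + 1) ∧
        (∀ i y y', |φ y i - φ y' i| ≤ Λ / s * dist y y') ∧ ContinuousOn ρ (KK adj (2*d+1)) ∧
        (∀ w ∈ KK adj (2*d+1), ∀ i ∈ sp w, dist (ρ w) (v i) ≤ Bs L (2*d+1) * s) ∧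
        OddG (fun y => f (ρ (φ y))) (fun y => l (ρ (φ y))) := by
  obtain ⟨Λ, hΛ, hcov⟩ := C1_cover hR
  refine ⟨Λ, hΛ, fun s hs hsD hsr f l hf hl hn hodd => ?_⟩
  obtain ⟨y0, -⟩ : ∃ y0 : Y, f y0 = 0 ∧ l y0 < 0 := OddG.exists hch hFF hf hl hodd hn
  have : Nonempty Y := ⟨y0⟩
  obtain ⟨c, hc, hcn⟩ := G0_c hf hl hn
  obtain ⟨δ1, hδ1, hδf⟩ := Metric.uniformContinuous_iff.1 (CompactSpace.uniformContinuous_of_continuous hf) (c/64) (by positivity)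
  obtain ⟨δ2, hδ2, hδl⟩ := Metric.uniformContinuous_iff.1 (CompactSpace.uniformContinuous_of_continuous hl) (c/64) (by positivity)
  set B := Bs L (2*d+1) with hB
  have hB0 : 0 ≤ B := Bs_nonneg hL _
  set sk : ℕ → ℝ := fun k => s * (1/2)^k with hsk
  have hsk0 : ∀ k, 0 < sk k := fun k => by simp only [hsk]; positivity
  have hskle : ∀ k, sk k ≤ s := fun k => by
    have : (1/2:ℝ)^k ≤ 1 := pow_le_one₀ (by norm_num) (by norm_num)
    simp only [hsk]; nlinarith
  have hsksucc : ∀ k, sk k = 2 * sk (k+1) := fun k => by simp only [hsk, pow_succ]; ring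
  obtain ⟨K, hK⟩ : ∃ K, (B + 2) * sk K < min δ1 δ2 := by
    obtain ⟨K, hK⟩ := exists_pow_lt_of_lt_one (show 0 < min δ1 δ2 / ((B+2) * s) by have := lt_min hδ1 hδ2; positivity) (show (1/2:ℝ) < 1 by norm_num)
    rw [lt_div_iff₀ (by positivity)] at hK
    exact ⟨K, by simp only [hsk]; nlinarith⟩
  choose n v φ hφ0 hφ1 hφd hφc hφL using fun k => hcov (sk k) (hsk0 k) ((hskle k).trans hsD)
  set pos : (Σ k : Fin (K+1), Fin (n k)) → Y := fun i => v i.1 i.2 with hpos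
  set sc : (Σ k : Fin (K+1), Fin (n k)) → ℝ := fun i => sk i.1 with hsc
  set adj : (Σ k : Fin (K+1), Fin (n k)) → (Σ k : Fin (K+1), Fin (n k)) → Prop := fun i j => dist (pos i) (pos j) ≤ 2 * (sc i + sc j) ∧ sc i ≤ 2 * sc j with hadj
  set Φ : ℕ → Y → (Σ k : Fin (K+1), Fin (n k)) → ℝ := fun k y i => if (i.1 : ℕ) = k then φ i.1 i.2 y else 0 with hΦ
  have hΦ0 : ∀ k y i, 0 ≤ Φ k y i := fun k y i => by
    simp only [hΦ]; split_ifs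
    · exact hφ0 _ _ _
    · exact le_rfl
  have hΦsp : ∀ k y i, i ∈ sp (Φ k y) → (i.1:ℕ) = k ∧ 0 < φ i.1 i.2 y := fun k y i hi => by
    rw [mem_sp] at hi
    simp only [hΦ] at hi
    split_ifs at hi with h
    · exact ⟨h, hi⟩
    · exact absurd hi (lt_irrefl _)
  have hΦd : ∀ k ≤ K, ∀ y, Φ k y ∈ Dl (Finset.univ) := fun k hk y => by
    refine ⟨hΦ0 k y, fun i hi => absurd (Finset.mem_univ i) hi, ?_⟩
    rw [Fintype.sum_sigma, Finset.sum_eq_single (⟨k, by omega⟩ : Fin (K+1))]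
    · simpa [hΦ] using hφ1 k y
    · intro b _ hb
      have : (b:ℕ) ≠ k := fun h => hb (Fin.ext h)
      simp [hΦ, this]
    · simp
  have hΦc : ∀ k ≤ K, ∀ y, (sp (Φ k y)).card ≤ d + 1 := fun k hk y => by
    refine le_trans ?_ (hφc k y)
    have : sp (Φ k y) ⊆ (Finset.univ.filter fun i => 0 < φ k i y).image (fun i => (⟨⟨k, by omega⟩, i⟩ : Σ k : Fin (K+1), Fin (n k))) := by
      rintro ⟨⟨k', hk'⟩, i⟩ hi
      obtain ⟨h1, h2⟩ := hΦsp _ _ _ hi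
      dsimp at h1 h2
      subst h1
      exact Finset.mem_image.2 ⟨i, by simpa using h2, rfl⟩
    exact (Finset.card_le_card this).trans Finset.card_image_le
  have hnear : ∀ k y i, i ∈ sp (Φ k y) → dist y (pos i) < 2 * sc i := fun k y i hi => hφd _ _ _ (hΦsp _ _ _ hi).2
  have hmix : ∀ k, k + 1 ≤ K → ∀ y, ∀ t ∈ Icc (0:ℝ) 1, (fun i => (1 - t) * Φ (k+1) y i + t * Φ k y i) ∈ KK adj (2*d+1) := by
    intro k hk y t ht
    have hm := Dl_conv (hΦd (k+1) hk y) (hΦd k (by omega) y) ht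
    have hsub : sp (fun i => (1 - t) * Φ (k+1) y i + t * Φ k y i) ⊆ sp (Φ (k+1) y) ∪ sp (Φ k y) := fun i hi => by
      rw [mem_sp] at hi
      rw [Finset.mem_union, mem_sp, mem_sp]
      by_contra! hcon
      rw [le_antisymm hcon.1 (hΦ0 _ _ _), le_antisymm hcon.2 (hΦ0 _ _ _)] at hi
      simp at hi
    refine ⟨hm, ?_, fun i hi j hj => ?_⟩
    · have := (Finset.card_le_card hsub).trans (Finset.card_union_le _ _)
      have := hΦc (k+1) hk y
      have := hΦc k (by omega) y
      omega
    · have key : ∀ i ∈ sp (fun i => (1 - t) * Φ (k+1) y i + t * Φ k y i), dist y (pos i) < 2 * sc i ∧ sk (k+1) ≤ sc i ∧ sc i ≤ 2 * sk (k+1) := fun i hi => by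
        have h2 := hsksucc k
        have h3 := hsk0 (k+1)
        rcases Finset.mem_union.1 (hsub hi) with h | h
        · refine ⟨hnear _ _ _ h, ?_⟩
          simp only [hsc, (hΦsp _ _ _ h).1]
          constructor <;> linarith
        · refine ⟨hnear _ _ _ h, ?_⟩
          simp only [hsc, (hΦsp _ _ _ h).1]
          constructor <;> linarith
      obtain ⟨a1, a2, a3⟩ := key i hi
      obtain ⟨b1, b2, b3⟩ := key j hj
      exact ⟨by linarith [dist_triangle_left (pos i) (pos j) y], by linarith⟩
  have hKK : ∀ k ≤ K, ∀ y, Φ k y ∈ KK adj (2*d+1) := fun k hk y => by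
    refine ⟨hΦd k hk y, ?_, fun i hi j hj => ⟨by linarith [dist_triangle_left (pos i) (pos j) y, hnear _ _ _ hi, hnear _ _ _ hj], ?_⟩⟩
    · have := hΦc k hk y; omega
    · simp only [hsc, (hΦsp _ _ _ hi).1, (hΦsp _ _ _ hj).1]; linarith [hsk0 k]
  have hφcont : ∀ k i, Continuous (φ k i) := fun k i => by
    refine (LipschitzWith.of_dist_le_mul (K := ⟨Λ / sk k, (div_pos hΛ (hsk0 k)).le⟩) fun a b => ?_).continuous
    rw [Real.dist_eq]; exact hφL k i a b
  have hΦcont : ∀ k i, Continuous fun y => Φ k y i := fun k i => by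
    simp only [hΦ]; split_ifs
    · exact hφcont _ _
    · exact continuous_const
  obtain ⟨ρ, hρ, hρd⟩ := C2_main hL hY pos sc (fun i => hsk0 _) adj (fun i j h => h) (2*d+1) (fun i => (mul_le_mul_of_nonneg_left (hskle _) hB0).trans hsr)
  have hchain : ∀ m ≤ K, OddG (fun y => f (ρ (Φ (K - m) y))) (fun y => l (ρ (Φ (K - m) y))) := by
    intro m
    induction m with
    | zero =>
      intro _
      have hclose : ∀ y, dist y (ρ (Φ K y)) < min δ1 δ2 := fun y => by
        obtain ⟨i, hi⟩ := Dl_nonempty (hΦd K le_rfl y)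
        have h1 := hρd _ (hKK K le_rfl y) i hi
        have h2 := hnear _ _ _ hi
        simp only [hsc, (hΦsp _ _ _ hi).1] at h1 h2
        have := dist_triangle_right y (ρ (Φ K y)) (pos i)
        refine lt_of_le_of_lt ?_ hK
        linarith
      have hcl : Continuous fun y => ρ (Φ K y) := hρ.comp_continuous (continuous_pi fun i => hΦcont K i) (hKK K le_rfl)
      exact OddG.near hch hFF hf hl (hl.comp hcl) hc hcn (fun x => hδf ((hclose x).trans_le (min_le_left _ _)))
        (fun x => hδl ((hclose x).trans_le (min_le_right _ _))) hodd
    | succ m ih =>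
      intro hm
      have h := ih (by omega)
      have e : K - m = (K - (m+1)) + 1 := by omega
      rw [e] at h
      set k := K - (m+1) with hk
      have hcm : ContinuousOn (fun p : ℝ × Y => ρ (fun i => (1 - p.1) * Φ (k+1) p.2 i + p.1 * Φ k p.2 i)) (Icc 0 1 ×ˢ univ) := by
        refine hρ.comp (Continuous.continuousOn (continuous_pi fun i => ?_)) fun p hp => hmix k (by omega) p.2 p.1 hp.1
        have := (hΦcont (k+1) i).comp (continuous_snd (X := ℝ))
        have := (hΦcont k i).comp (continuous_snd (X := ℝ))
        simp only [Function.comp_def] at *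
        fun_prop
      have := OddG.hom hch hFF (F := fun t y => f (ρ (fun i => (1 - t) * Φ (k+1) y i + t * Φ k y i)))
        (l := fun t y => l (ρ (fun i => (1 - t) * Φ (k+1) y i + t * Φ k y i))) (hf.comp_continuousOn hcm) (hl.comp_continuousOn hcm)
        (fun t _ x => hn _) (by simpa using h)
      simpa using this
  refine ⟨_, inferInstance, inferInstance, pos, Φ 0, ρ, adj, hKK 0 (by omega), fun y i hi => ?_, hΦc 0 (by omega), fun i y y' => ?_, hρ, fun w hw i hi => ?_, ?_⟩
  · exact (hnear _ _ _ hi).trans_le (by linarith [hskle i.1])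
  · simp only [hΦ]
    split_ifs with h
    · have := hφL i.1 i.2 y y'
      rw [show sk i.1 = s by simp [hsk, h]] at this
      exact this
    · simp; positivity
  · exact (hρd w hw i hi).trans (mul_le_mul_of_nonneg_left (hskle _) hB0)
  · simpa using hchain K le_rfl

end C3
end

section
open MeasureTheory Metric Set Filter Topology
set_option linter.unusedSectionVars false

section C4
variable {d : ℕ}

noncomputable def rM (w : Fin (d+1) → ℝ) : ℝ := Finset.univ.sup' Finset.univ_nonempty fun k => 1 - (d+1) * w k
noncomputable def rr (w : Fin (d+1) → ℝ) : Fin (d+1) → ℝ := fun k => 1 / (d+1) + (w k - 1/(d+1)) / rM w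

theorem rM_cont : Continuous (rM (d := d)) := by
  unfold rM
  exact Continuous.finset_sup'_apply _ fun k _ => by fun_prop

theorem rM_ge (w : Fin (d+1) → ℝ) (k : Fin (d+1)) : 1 - (d+1) * w k ≤ rM w := Finset.le_sup' (fun k => 1 - (d+1) * w k) (Finset.mem_univ k)

theorem rM_att (w : Fin (d+1) → ℝ) : ∃ k, rM w = 1 - (d+1) * w k := by
  obtain ⟨k, -, h⟩ := Finset.exists_mem_eq_sup' (Finset.univ_nonempty (α := Fin (d+1))) fun k => 1 - ((d:ℝ)+1) * w k
  exact ⟨k, h⟩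

theorem rM_pos {w : Fin (d+1) → ℝ} (h1 : ∑ k, w k = 1) (hne : ∃ k, w k ≠ 1/(d+1)) : 0 < rM w := by
  by_contra! hc
  obtain ⟨k, hk⟩ := hne
  have hN : (0:ℝ) < d + 1 := by positivity
  have h0 : ∀ k, 0 ≤ w k - 1/(d+1) := fun k => by
    have := (rM_ge w k).trans hc
    have : 1 / ((d:ℝ)+1) ≤ w k := by rw [div_le_iff₀ hN]; linarith
    linarith
  have hs : ∑ k, (w k - 1/(d+1)) = 0 := by
    rw [Finset.sum_sub_distrib, h1]; simp; field_simp; simp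
  have := (Finset.sum_eq_zero_iff_of_nonneg fun k _ => h0 k).1 hs k (Finset.mem_univ k)
  exact hk (by linarith)

theorem rr_spec {w : Fin (d+1) → ℝ} (h1 : ∑ k, w k = 1) (hne : ∃ k, w k ≠ 1/(d+1)) :
    (∀ k, 0 ≤ rr w k) ∧ ∑ k, rr w k = 1 ∧ ∃ k, rr w k = 0 := by
  have hM := rM_pos h1 hne
  have hN : (0:ℝ) < d + 1 := by positivity
  have e : ∀ k, rr w k = (rM w - (1 - (d+1) * w k)) / ((d+1) * rM w) := fun k => by
    simp only [rr]; field_simp; ring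
  refine ⟨fun k => ?_, ?_, ?_⟩
  · rw [e]; exact div_nonneg (by linarith [rM_ge w k]) (by positivity)
  · simp only [rr]
    have e2 : ∑ k, (w k - 1 / ((d:ℝ)+1)) / rM w = 0 := by
      rw [← Finset.sum_div, Finset.sum_sub_distrib, h1]; simp; left; field_simp; simp
    rw [Finset.sum_add_distrib, e2]
    simp; field_simp
  · obtain ⟨k, hk⟩ := rM_att w
    exact ⟨k, by rw [e, ← hk]; simp⟩

theorem rr_id {w : Fin (d+1) → ℝ} (h0 : ∀ k, 0 ≤ w k) (hz : ∃ k, w k = 0) : rr w = w := by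
  have hM : rM w = 1 := by
    obtain ⟨k, hk⟩ := hz
    refine le_antisymm ?_ (by have := rM_ge w k; rw [hk] at this; linarith)
    obtain ⟨j, hj⟩ := rM_att w
    rw [hj]
    have : 0 ≤ ((d:ℝ)+1) * w j := mul_nonneg (by positivity) (h0 j)
    linarith
  ext k
  simp [rr, hM]

variable {ι : Type} [Fintype ι] [DecidableEq ι]

theorem dimH_Dl (T : Finset ι) : dimH (Dl T) ≤ ((T.card - 1 : ℕ) : ENNReal) := by
  rcases T.eq_empty_or_nonempty with rfl | ⟨t0, ht0⟩
  · have : Dl (∅ : Finset ι) = ∅ := by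
      ext w; simp only [mem_empty_iff_false, iff_false]
      intro h
      obtain ⟨i, hi⟩ := Dl_nonempty h
      simpa using Dl_sp h hi
    simp [this]
  set F : ({x // x ∈ T.erase t0} → ℝ) → ι → ℝ := fun u i => if h : i ∈ T.erase t0 then u ⟨i, h⟩ else if i = t0 then 1 - ∑ j, u j else 0 with hF
  have hFc : ContDiff ℝ 1 F := by
    refine contDiff_pi.2 fun i => ?_
    simp only [hF]
    split_ifs
    · fun_prop
    · fun_prop
    · fun_prop
  have hsub : Dl T ⊆ range F := by
    intro w hw
    refine ⟨fun j => w j.1, ?_⟩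
    ext i
    simp only [hF]
    split_ifs with h1 h2
    · rfl
    · subst h2
      rw [Finset.sum_coe_sort (T.erase i) w, ← hw.2.2, sub_eq_iff_eq_add, Finset.add_sum_erase T w ht0]
      exact (Finset.sum_subset (Finset.subset_univ _) fun i _ hi => hw.2.1 i hi).symm
    · exact (hw.2.1 i fun hc => h1 (Finset.mem_erase.2 ⟨h2, hc⟩)).symm
  refine (dimH_mono hsub).trans (hFc.dimH_range_le.trans ?_)
  rw [Module.finrank_fintype_fun_eq_card, Fintype.card_coe, Finset.card_erase_of_mem ht0]

theorem null_skel (hd : 1 ≤ d) {K : Set (ι → ℝ)} {P : K → XX d} (hP : Lip P) {T : Finset ι} (hT : T.card ≤ d) :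
    volume (P '' (Subtype.val ⁻¹' Dl T)) = 0 := by
  obtain ⟨c, hc⟩ := hP
  have h1 : dimH (P '' (Subtype.val ⁻¹' Dl T)) < (d : NNReal) := by
    refine (hc.dimH_image_le _).trans_lt ?_
    rw [← (isometry_subtype_coe (s := K)).dimH_image]
    refine (dimH_mono (image_preimage_subset _ _)).trans_lt ((dimH_Dl T).trans_lt ?_)
    have : T.card - 1 < d := by omega
    exact_mod_cast this
  have := hausdorffMeasure_of_dimH_lt h1
  have e : (Measure.hausdorffMeasure ((Fintype.card (Fin d) : ℝ)) : Measure (Fin d → ℝ)) = volume := hausdorffMeasure_pi_real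
  rw [← e]
  simpa using this

variable {Y : Type*} [MetricSpace Y]

def Ess (f : Y → XX d) (U : Set Y) (z : XX d) : Prop := ∀ g : Y → XX d, Continuous g → (∀ x, x ∉ U → g x = f x) → ∃ x ∈ U, g x = z

theorem piece (hd : 1 ≤ d) {φ : Y → ι → ℝ} {Λ : ℝ} (hΛ0 : 0 ≤ Λ) (hφ : Continuous φ) (hΛ : ∀ i y y', |φ y i - φ y' i| ≤ Λ * dist y y')
    (hD : ∀ y, φ y ∈ Dl (Finset.univ : Finset ι)) (hcard : ∀ y, (sp (φ y)).card ≤ d + 1) {S : Finset ι} (hS : S.card = d + 1)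
    {U : Set Y} (hU : U = {y | ∀ i ∈ S, 0 < φ y i}) :
    ∃ (f : Y → XX d) (z : XX d), (∀ y y', dist (f y) (f y') ≤ Λ * dist y y') ∧ (∀ y ∈ frontier U, 1 / (d * (d+1)) ≤ dist (f y) z) ∧
      (Ess f U z ∨ ∃ π : Y → ι → ℝ, ContinuousOn π (closure U) ∧ (∀ y ∈ closure U, π y ∈ Bd S) ∧ ∀ y ∈ closure U, y ∉ U → π y = φ y) := by
  have hd0 : (0:ℝ) < d := by exact_mod_cast hd
  set q := S.equivFinOfCardEq hS with hq
  set σ : Fin (d+1) → ι := fun k => (q.symm k : ι) with hσ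
  have hσS : ∀ k, σ k ∈ S := fun k => (q.symm k).2
  have hσsum : ∀ w : ι → ℝ, ∑ k, w (σ k) = ∑ i ∈ S, w i := fun w => by
    rw [← Finset.sum_coe_sort S w]
    exact Equiv.sum_comp q.symm fun i : S => w i
  have hUo : IsOpen U := by
    rw [hU]
    have : {y | ∀ i ∈ S, 0 < φ y i} = ⋂ i ∈ S, {y | 0 < φ y i} := by ext; simp
    rw [this]
    exact isOpen_biInter_finset fun i _ => isOpen_lt continuous_const ((continuous_apply i).comp hφ)
  have hUsp : ∀ y ∈ U, φ y ∈ Dl S := fun y hy => by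
    rw [hU] at hy
    have h1 : S ⊆ sp (φ y) := fun i hi => mem_sp.2 (hy i hi)
    have := Finset.eq_of_subset_of_card_le h1 (by rw [hS]; exact hcard y)
    rw [this]; exact Dl_self (hD y)
  have hcl : ∀ y ∈ closure U, φ y ∈ Dl S := fun y hy =>
    closure_minimal (s := U) (t := φ ⁻¹' Dl S) hUsp ((Dl_closed S).preimage hφ) hy
  have hsum1 : ∀ y ∈ closure U, ∑ k, φ y (σ k) = 1 := fun y hy => by
    rw [hσsum, ← (hcl y hy).2.2]
    exact Finset.sum_subset (Finset.subset_univ _) fun i _ hi => (hcl y hy).2.1 i hi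
  have hz0 : ∀ y ∈ closure U, y ∉ U → ∃ k, φ y (σ k) = 0 := fun y hy hn => by
    rw [hU] at hn
    simp only [mem_ofPred_eq] at hn
    push Not at hn
    obtain ⟨i, hi, h0⟩ := hn
    exact ⟨q ⟨i, hi⟩, by simpa [hσ] using le_antisymm h0 ((hD y).1 i)⟩
  set f : Y → XX d := fun y k => φ y (σ k.succ) with hf
  set z : XX d := fun _ => 1 / (d+1) with hz
  set hat : XX d → Fin (d+1) → ℝ := fun u => Fin.cons (1 - ∑ k, u k) u with hhat
  have hhatc : Continuous hat := by
    refine continuous_pi fun k => ?_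
    refine Fin.cases ?_ (fun k => ?_) k
    · simp only [hhat, Fin.cons_zero]; fun_prop
    · simp only [hhat, Fin.cons_succ]; fun_prop
  have hhatsum : ∀ u, ∑ k, hat u k = 1 := fun u => by simp [hhat, Fin.sum_univ_succ]
  have hhatne : ∀ u, u ≠ z → ∃ k, hat u k ≠ 1/(d+1) := fun u hu => by
    by_contra! hc
    exact hu (funext fun k => by simpa [hhat, hz] using hc k.succ)
  have hhatf : ∀ y ∈ closure U, hat (f y) = fun k => φ y (σ k) := fun y hy => by
    have := hsum1 y hy
    rw [Fin.sum_univ_succ] at this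
    ext k
    refine Fin.cases ?_ (fun k => ?_) k
    · simp only [hhat, hf, Fin.cons_zero]; linarith
    · simp only [hhat, hf, Fin.cons_succ]
  have hfr : ∀ y ∈ frontier U, 1 / ((d:ℝ) * (d+1)) ≤ dist (f y) z := by
    intro y hy
    have hyU : y ∉ U := by rw [hUo.frontier_eq] at hy; exact hy.2
    have hyc : y ∈ closure U := frontier_subset_closure hy
    obtain ⟨k, hk⟩ := hz0 y hyc hyU
    have hdk : ∀ k, |φ y (σ (Fin.succ k)) - 1/(d+1)| ≤ dist (f y) z := fun k => by
      have := dist_le_pi_dist (f y) z k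
      rwa [Real.dist_eq] at this
    rcases Fin.eq_zero_or_eq_succ k with rfl | ⟨k, rfl⟩
    · have := hsum1 y hyc
      rw [Fin.sum_univ_succ, hk, zero_add] at this
      have h2 : ∑ k : Fin d, φ y (σ k.succ) ≤ ∑ k : Fin d, (1/((d:ℝ)+1) + dist (f y) z) := Finset.sum_le_sum fun k _ => by
        linarith [le_abs_self (φ y (σ (Fin.succ k)) - 1/((d:ℝ)+1)), hdk k]
      rw [this] at h2
      simp only [Finset.sum_const, Finset.card_univ, Fintype.card_fin, nsmul_eq_mul] at h2
      rw [div_le_iff₀ (by positivity)]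
      have h3 : (d:ℝ) * (1 / (d+1)) * (d+1) = d := by field_simp
      nlinarith
    · have := hdk k
      rw [hk, zero_sub, abs_neg, abs_of_pos (by positivity)] at this
      refine le_trans ?_ this
      have : (1:ℝ) ≤ d := by exact_mod_cast hd
      exact one_div_le_one_div_of_le (by positivity) (by nlinarith)
  refine ⟨f, z, fun y y' => ?_, hfr, ?_⟩
  · refine (dist_pi_le_iff (by positivity)).2 fun k => ?_
    rw [Real.dist_eq]; exact hΛ _ _ _
  by_cases hE : Ess f U z
  · exact Or.inl hE
  right
  unfold Ess at hE
  push Not at hE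
  obtain ⟨g, hg, hgf, hgz⟩ := hE
  have hgz' : ∀ y ∈ closure U, g y ≠ z := fun y hy hc => by
    by_cases hyU : y ∈ U
    · exact hgz y hyU hc
    · have := hfr y (by rw [hUo.frontier_eq]; exact ⟨hy, hyU⟩)
      rw [← hgf y hyU, hc, dist_self] at this
      have : 0 < 1 / ((d:ℝ) * (d+1)) := by positivity
      linarith
  refine ⟨fun y i => if h : i ∈ S then rr (hat (g y)) (q ⟨i, h⟩) else 0, ?_, fun y hy => ?_, fun y hy hyU => ?_⟩
  · refine continuousOn_pi.2 fun i => ?_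
    by_cases h : i ∈ S
    · simp only [h, dif_pos]
      unfold rr
      have hw : Continuous fun y => hat (g y) := hhatc.comp hg
      have hM : Continuous fun y => rM (hat (g y)) := rM_cont.comp hw
      have hwk : Continuous fun y => hat (g y) (q ⟨i, h⟩) := (continuous_apply _).comp hw
      exact continuousOn_const.add ((hwk.sub continuous_const).continuousOn.div hM.continuousOn fun y hy => (rM_pos (hhatsum _) (hhatne _ (hgz' y hy))).ne')
    · simp only [h, dif_neg, not_false_eq_true]
      exact continuousOn_const
  · obtain ⟨h1, h2, k, hk⟩ := rr_spec (hhatsum (g y)) (hhatne _ (hgz' y hy))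
    refine ⟨⟨fun i => ?_, fun i hi => by simp [hi], ?_⟩, σ k, hσS k, ?_⟩
    · dsimp only; split_ifs
      · exact h1 _
      · exact le_rfl
    · rw [← h2, ← Finset.sum_subset (Finset.subset_univ S) (fun i _ hi => by simp [hi]), ← hσsum]
      exact Finset.sum_congr rfl fun k _ => by simp [hσ]
    · simpa [hσ] using hk
  · have e : rr (hat (g y)) = fun k => φ y (σ k) := by
      rw [hgf y hyU, hhatf y hy]
      exact rr_id (fun k => (hD y).1 _) (hz0 y hy hyU)
    ext i
    dsimp only
    split_ifs with h
    · rw [e]; simp [hσ]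
    · exact ((hcl y hy).2.1 i h).symm

end C4
end

section
open MeasureTheory Metric Set Filter Topology
set_option linter.unusedSectionVars false

theorem C_ess {Y : Type*} [MetricSpace Y] [CompactSpace Y] {d : ℕ} (hd : 1 ≤ d)
    [MeasurableSpace Y] [BorelSpace Y] {ν : Measure Y} [IsFiniteMeasure ν] {C D L r0 : ℝ} (hR : AReg ν d C D) (hL : 1 ≤ L) (hr0 : 0 < r0) (hY : LLC Y L r0)
    (hch : ∀ x : Y, ∃ e : OpenPartialHomeomorph Y (XX d), x ∈ e.source)
    (hFF : ∀ f : Y → XX d, Lip f → ∀ᵐ y, (f ⁻¹' {y}).Finite) :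
    ∃ Λ > 0, ∃ c > 0, ∃ R0 > 0, ∀ (x0 : Y) (R : ℝ), 0 < R → R ≤ R0 → ∃ (f : Y → XX d) (U : Set Y) (z : XX d),
      (∀ x y, dist (f x) (f y) ≤ Λ / R * dist x y) ∧ IsOpen U ∧ U ⊆ ball x0 R ∧ (∀ x ∈ frontier U, c ≤ dist (f x) z) ∧ Ess f U z := by
  obtain ⟨Λ, hΛ, hlev⟩ := levels hR hL hY hch hFF
  set B := Bs L (2*d+1) with hB
  have hB0 : 0 ≤ B := Bs_nonneg hL _
  have hd0 : (0:ℝ) < d := by exact_mod_cast hd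
  refine ⟨Λ * (B + 5), by positivity, 1 / (d * (d+1)), by positivity, min D r0, lt_min hR.Dpos hr0, fun x0 R hR0 hRle => ?_⟩
  set s := R / (B + 5) with hs
  have hs0 : 0 < s := by positivity
  have hsR : (B + 5) * s = R := by rw [hs]; field_simp
  have hRD := hRle.trans (min_le_left _ _)
  have hRr := hRle.trans (min_le_right _ _)
  obtain ⟨f, l, hf, hl, hn, hodd, hlx⟩ := exists_G0 hch hFF x0 hs0
  obtain ⟨ι, _, _, v, φ, ρ, adj, hφK, hφv, hφc, hφL, hρ, hρd, hoddρ⟩ := hlev s hs0 (by nlinarith) (by nlinarith) f l hf hl hn hodd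
  have hΛs : Λ * (B + 5) / R = Λ / s := by rw [hs]; field_simp
  have hφcont : Continuous φ := continuous_pi fun i => by
    refine (LipschitzWith.of_dist_le_mul (K := ⟨Λ / s, by positivity⟩) fun a b => ?_).continuous
    rw [Real.dist_eq]; exact hφL i a b
  set U : Finset ι → Set Y := fun S => {y | ∀ i ∈ S, 0 < φ y i} with hU
  have hUo : ∀ S, IsOpen (U S) := fun S => by
    have : U S = ⋂ i ∈ S, {y | 0 < φ y i} := by ext; simp [hU]
    rw [this]
    exact isOpen_biInter_finset fun i _ => isOpen_lt continuous_const ((continuous_apply i).comp hφcont)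
  have hUS : ∀ S : Finset ι, S.card = d + 1 → ∀ y ∈ U S, sp (φ y) = S := fun S hS y hy =>
    (Finset.eq_of_subset_of_card_le (fun i hi => mem_sp.2 (hy i hi)) (by rw [hS]; exact hφc y)).symm
  have hself : ∀ y, y ∈ U (sp (φ y)) := fun y i hi => mem_sp.1 hi
  by_contra hcon
  have hpc : ∀ S : Finset ι, S.card = d + 1 → U S ⊆ ball x0 R → ∃ π : Y → ι → ℝ, ContinuousOn π (closure (U S)) ∧
      (∀ y ∈ closure (U S), π y ∈ Bd S) ∧ ∀ y ∈ closure (U S), y ∉ U S → π y = φ y := by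
    intro S hS hSb
    obtain ⟨g, z, h1, h2, h3 | h3⟩ := piece hd (Λ := Λ / s) (by positivity) hφcont hφL (fun y => (hφK y).1) hφc hS (U := U S) rfl
    · exact absurd ⟨g, U S, z, by rwa [hΛs], hUo S, hSb, h2, h3⟩ hcon
    · exact h3
  choose! π hπ1 hπ2 hπ3 using hpc
  classical
  set J : Finset ι → Prop := fun S => S.card = d + 1 ∧ U S ⊆ ball x0 R with hJ
  set π1 : Y → ι → ℝ := fun y => if J (sp (φ y)) then π (sp (φ y)) y else φ y with hπ
  have hπD : ∀ y, π1 y ∈ Dl (sp (φ y)) := fun y => by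
    simp only [hπ]; split_ifs with h
    · exact (hπ2 _ h.1 h.2 y (subset_closure (hself y))).1
    · exact Dl_self (hφK y).1
  have hπc : Continuous π1 := by
    have hcov : (⋃ o : Option {S // J S}, (o.elim {y | ¬ J (sp (φ y))} fun S => closure (U S.1))) = univ := by
      rw [eq_univ_iff_forall]
      intro y
      by_cases h : J (sp (φ y))
      · exact mem_iUnion.2 ⟨some ⟨_, h⟩, subset_closure (hself y)⟩
      · exact mem_iUnion.2 ⟨none, h⟩
    rw [← continuousOn_univ, ← hcov]
    refine (locallyFinite_of_finite _).continuousOn_iUnion (fun o => ?_) fun o => ?_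
    · rcases o with _ | S
      · have : {y | ¬ J (sp (φ y))} = (⋃ S : {S // J S}, U S.1)ᶜ := by
          ext y
          simp only [mem_ofPred_eq, mem_compl_iff, mem_iUnion, not_iff_not]
          exact ⟨fun h => ⟨⟨_, h⟩, hself y⟩, fun ⟨S, h⟩ => by rw [hUS S.1 S.2.1 y h]; exact S.2⟩
        simp only [Option.elim]
        rw [this]
        exact (isOpen_iUnion fun S => hUo _).isClosed_compl
      · exact isClosed_closure
    · rcases o with _ | S
      · exact hφcont.continuousOn.congr fun y hy => if_neg hy
      · refine (hπ1 S.1 S.2.1 S.2.2).congr fun y hy => ?_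
        by_cases hyU : y ∈ U S.1
        · simp only [hπ, hUS S.1 S.2.1 y hyU, if_pos S.2]
        · rw [hπ3 S.1 S.2.1 S.2.2 y hy hyU]
          have : ¬ J (sp (φ y)) := fun h => by
            obtain ⟨x, hx1, hx2⟩ := mem_closure_iff.1 hy _ (hUo _) (hself y)
            have e := (hUS _ h.1 x hx1).symm.trans (hUS _ S.2.1 x hx2)
            exact hyU (e ▸ hself y)
          simp only [hπ, if_neg this]
  have hmem : ∀ y, ∀ t ∈ Icc (0:ℝ) 1, (fun i => (1 - t) * φ y i + t * π1 y i) ∈ KK adj (2*d+1) := fun y t ht => by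
    have h := Dl_conv (Dl_self (hφK y).1) (hπD y) ht
    exact ⟨Dl_mono (Finset.subset_univ _) h, (hφK y).2.mono (Dl_sp h) le_rfl⟩
  have hπK : ∀ y, π1 y ∈ KK adj (2*d+1) := fun y => by simpa using hmem y 1 (by simp)
  have hodd1 : OddG (fun y => f (ρ (π1 y))) (fun y => l (ρ (π1 y))) := by
    have hcm : ContinuousOn (fun p : ℝ × Y => ρ (fun i => (1 - p.1) * φ p.2 i + p.1 * π1 p.2 i)) (Icc 0 1 ×ˢ univ) := by
      refine hρ.comp (Continuous.continuousOn (continuous_pi fun i => ?_)) fun p hp => hmem p.2 p.1 hp.1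
      fun_prop
    have := OddG.hom hch hFF (F := fun t y => f (ρ (fun i => (1 - t) * φ y i + t * π1 y i)))
      (l := fun t y => l (ρ (fun i => (1 - t) * φ y i + t * π1 y i))) (hf.comp_continuousOn hcm) (hl.comp_continuousOn hcm)
      (fun t _ x => hn _) (by simpa using hoddρ)
    simpa using this
  have : CompactSpace (KK adj (2*d+1)) := isCompact_iff_compactSpace.1 (KK_compact _ _)
  have hρπ : Continuous fun y => ρ (π1 y) := hρ.comp_continuous hπc hπK
  obtain ⟨c, hc, hcn⟩ := G0_c hf hl hn
  obtain ⟨P, hP, hPd⟩ := lip_approx (f := fun w : KK adj (2*d+1) => f (ρ w.1)) (hf.comp (continuousOn_iff_continuous_domRestrict.1 hρ)) (ε := c/128) (by positivity)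
  obtain ⟨y0, hy0, hy0n⟩ : ∃ y0 ∈ ball (0 : XX d) (c/128), y0 ∉ ⋃ T : {T : Finset ι // T.card ≤ d}, P '' (Subtype.val ⁻¹' Dl T.1) := by
    by_contra! hcc
    have h0 : volume (⋃ T : {T : Finset ι // T.card ≤ d}, P '' (Subtype.val ⁻¹' Dl T.1)) = 0 :=
      measure_iUnion_null fun T => null_skel hd hP T.2
    exact (measure_ball_pos volume (0 : XX d) (show 0 < c/128 by positivity)).ne' (measure_mono_null hcc h0)
  set F2 : Y → XX d := fun y => P ⟨π1 y, hπK y⟩ - y0 with hF2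
  have hF2c : Continuous F2 := ((hP.cont).comp (hπc.subtype_mk hπK)).sub continuous_const
  have hclose : ∀ y, dist (f (ρ (π1 y))) (F2 y) < c / 64 := fun y => by
    have h1 := hPd ⟨π1 y, hπK y⟩
    have h2 : dist (P ⟨π1 y, hπK y⟩) (F2 y) < c/128 := by
      rw [hF2, dist_eq_norm, sub_sub_cancel]; simpa using hy0
    have := dist_triangle_left (f (ρ (π1 y))) (F2 y) (P ⟨π1 y, hπK y⟩)
    dsimp only at h1
    linarith
  have hodd2 : OddG F2 (fun y => l (ρ (π1 y))) := OddG.near hch hFF (hf.comp hρπ) (hl.comp hρπ) (hl.comp hρπ) hc (fun x => hcn _) hclose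
    (fun x => by simpa using hc) hodd1
  obtain ⟨y, hy1, hy2⟩ := OddG.exists hch hFF hF2c (hl.comp hρπ) hodd2 fun x => by
    rcases hcn (ρ (π1 x)) with h | h
    · left
      intro h0
      have := hclose x
      rw [h0, dist_zero_right] at this
      linarith
    · right
      intro h0
      simp only [Function.comp] at h0
      rw [h0, abs_zero] at h
      linarith
  have hyx := hlx _ hy2
  have hnear : ∀ i ∈ sp (φ y), U (sp (φ y)) ⊆ ball x0 R := by
    intro i hi y' hy'
    obtain ⟨j, hj⟩ := Dl_nonempty (hπD y)
    have h1 := hρd _ (hπK y) j hj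
    have hj' := Dl_sp (hπD y) hj
    have h2 := hφv y' j (mem_sp.2 (hy' j hj'))
    have h3 := dist_triangle y' (v j) x0
    have h4 := dist_triangle_left (v j) x0 (ρ (π1 y))
    rw [mem_ball]
    simp only at hyx
    nlinarith
  apply hy0n
  have hPy : P ⟨π1 y, hπK y⟩ = y0 := sub_eq_zero.1 hy1
  have hsk : (sp (π1 y)).card ≤ d := by
    by_cases hc1 : (sp (φ y)).card ≤ d
    · exact (Finset.card_le_card (Dl_sp (hπD y))).trans hc1
    · obtain ⟨i, hi⟩ := Dl_nonempty (hφK y).1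
      have hJy : J (sp (φ y)) := ⟨by have := hφc y; omega, hnear i hi⟩
      obtain ⟨hb, j, hj, hj0⟩ := hπ2 _ hJy.1 hJy.2 y (subset_closure (hself y))
      have e : π1 y = π (sp (φ y)) y := by simp only [hπ, if_pos hJy]
      rw [← e] at hb hj0
      have : sp (π1 y) ⊂ sp (φ y) := (Finset.ssubset_iff_of_subset (Dl_sp hb)).2 ⟨j, hj, fun h => (mem_sp.1 h).ne' hj0⟩
      have := Finset.card_lt_card this
      have := hJy.1
      omega
  exact mem_iUnion.2 ⟨⟨sp (π1 y), hsk⟩, ⟨π1 y, hπK y⟩, Dl_self (hπK y).1, hPy⟩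
end

section
open MeasureTheory Metric Set Filter Topology
set_option linter.unusedSectionVars false

section B1
variable {Y : Type*} [MetricSpace Y] [CompactSpace Y] {d : ℕ} {f : Y → XX d} {U : Set Y} {z : XX d}

theorem Ess.pert {f' : Y → XX d} (hU : IsOpen U) (hf : Continuous f) (hf' : Continuous f')
    (h : ∀ x ∈ frontier U, dist (f' x) (f x) < dist (f x) z) (hE : Ess f U z) : Ess f' U z := by
  intro g hg hgf
  by_contra! hc
  set N : Set Y := Prod.snd '' ((Icc (0:ℝ) 1 ×ˢ closure U) ∩ {p : ℝ × Y | g p.2 + p.1 • (f p.2 - f' p.2) = z}) with hN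
  have hNc : IsClosed N := by
    refine (((isCompact_Icc.prod isClosed_closure.isCompact).inter_right ?_).image continuous_snd).isClosed
    exact isClosed_eq (by fun_prop) continuous_const
  have hdis : Disjoint N Uᶜ := by
    rw [disjoint_left]
    rintro _ ⟨⟨s, x⟩, ⟨⟨hs, hx⟩, he⟩, rfl⟩ hxU
    simp only [mem_ofPred_eq] at hs hx he hxU
    have h1 := h x (by rw [hU.frontier_eq]; exact ⟨hx, hxU⟩)
    rw [← he, hgf x hxU, dist_eq_norm (f x), show f x - (f' x + s • (f x - f' x)) = (1 - s) • (f x - f' x) by module, norm_smul, dist_comm, dist_eq_norm,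
      Real.norm_of_nonneg (by linarith [hs.2])] at h1
    nlinarith [hs.1, norm_nonneg (f x - f' x)]
  obtain ⟨χ, h0, h1, h01⟩ := exists_continuous_zero_one_of_isClosed hNc hU.isClosed_compl hdis
  obtain ⟨x, hx, he⟩ := hE (fun x => g x + χ x • (f x - f' x)) (by have := χ.continuous; fun_prop) fun x hx => by
    rw [hgf x hx, show χ x = 1 from h1 hx]; simp
  have hxN : x ∈ N := ⟨(χ x, x), ⟨⟨h01 x, subset_closure hx⟩, he⟩, rfl⟩
  rw [show χ x = 0 from h0 hxN] at he
  exact hc x hx (by simpa using he)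

theorem Ess.move {m : ℝ} {z' : XX d} (hU : IsOpen U) (hf : Continuous f) (h : ∀ x ∈ frontier U, m ≤ dist (f x) z) (hm : dist z z' < m)
    (hE : Ess f U z) : Ess f U z' := by
  intro g hg hgf
  obtain ⟨x, hx, he⟩ := hE.pert (f' := fun x => f x + (z - z')) hU hf (by fun_prop) (fun x hx => by
    rw [dist_eq_norm, add_sub_cancel_left, ← dist_eq_norm]; exact hm.trans_le (h x hx)) (fun x => g x + (z - z')) (by fun_prop)
    (fun x hx => by rw [hgf x hx])
  refine ⟨x, hx, ?_⟩
  have : g x - z' = 0 := by rw [← sub_eq_zero] at he; rw [← he]; abel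
  exact sub_eq_zero.1 this

theorem Ess.split (hf : Continuous f) {I : Finset (Set Y)} (hI : ∀ V ∈ I, ∀ W ∈ I, V ≠ W → Disjoint V W) (hc : ∀ x ∈ U, f x = z → ∃ W ∈ I, x ∈ W)
    (hIU : ∀ W ∈ I, W ⊆ U) (hE : Ess f U z) : ∃ W ∈ I, Ess f W z := by
  by_contra! hcon
  unfold Ess at hcon
  push Not at hcon
  choose! g hg hgf hgz using hcon
  have hval : ∀ W ∈ I, ∀ x ∈ W, f x + ∑ V ∈ I, (g V x - f x) = g W x := fun W hW x hx => by
    rw [Finset.sum_eq_single W (fun V hV hne => by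
      rw [hgf V hV x (fun h => disjoint_left.1 (hI V hV W hW hne) h hx), sub_self]) (fun h => absurd hW h)]
    simp
  have hval' : ∀ x, (∀ W ∈ I, x ∉ W) → f x + ∑ V ∈ I, (g V x - f x) = f x := fun x hx => by
    rw [Finset.sum_eq_zero fun V hV => by rw [hgf V hV x (hx V hV), sub_self], add_zero]
  obtain ⟨x, hx, he⟩ := hE (fun x => f x + ∑ V ∈ I, (g V x - f x)) (hf.add (continuous_finsetSum _ fun V hV => (hg V hV).sub hf))
    fun x hx => hval' x fun W hW h => hx (hIU W hW h)
  by_cases h : ∃ W ∈ I, x ∈ W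
  · obtain ⟨W, hW, hxW⟩ := h
    rw [hval W hW x hxW] at he
    exact hgz W hW x hxW he
  · push Not at h
    rw [hval' x h] at he
    obtain ⟨W, hW, hxW⟩ := hc x hx he
    exact h W hW hxW

theorem loc_conn (hch : ∀ x : Y, ∃ e : OpenPartialHomeomorph Y (XX d), x ∈ e.source) : LocallyConnectedSpace Y := by
  choose e he using hch
  let _ : ChartedSpace (XX d) Y := { atlas := univ, chartAt := e, mem_chart_source := he, chart_mem_atlas := fun _ => mem_univ _ }
  exact ChartedSpace.locallyConnectedSpace (XX d) Y

theorem comp_step [LocallyConnectedSpace Y] {s s0 : ℝ} (hs : 0 < s) (hss : s ≤ s0) (hU : IsOpen U) (hf : Continuous f) (hfr : ∀ x ∈ frontier U, s0 ≤ dist (f x) z)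
    (hE : Ess f U z) : ∃ W ⊆ U, IsOpen W ∧ Ess f W z ∧ IsPreconnected W ∧ (∀ x ∈ W, dist (f x) z < s) ∧ ∀ x ∈ frontier W, s ≤ dist (f x) z := by
  classical
  set O := U ∩ f ⁻¹' ball z s with hO
  have hOo : IsOpen O := hU.inter (isOpen_ball.preimage hf)
  have hK : IsCompact (closure U ∩ f ⁻¹' {z}) := (isClosed_closure.inter (isClosed_singleton.preimage hf)).isCompact
  have hKO : closure U ∩ f ⁻¹' {z} ⊆ O := by
    rintro x ⟨hx, hz⟩
    have hz : f x = z := hz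
    refine ⟨?_, by simpa [hz] using hs⟩
    by_contra hn
    have := hfr x (by rw [hU.frontier_eq]; exact ⟨hx, hn⟩)
    rw [hz, dist_self] at this
    linarith
  obtain ⟨t, ht, htc⟩ := hK.elim_nhds_subcover (fun x => connectedComponentIn O x) fun x hx =>
    (hOo.connectedComponentIn).mem_nhds (mem_connectedComponentIn (hKO hx))
  have hdisj : ∀ x y, (connectedComponentIn O x ∩ connectedComponentIn O y).Nonempty → connectedComponentIn O x = connectedComponentIn O y := by
    rintro x y ⟨w, h1, h2⟩
    rw [connectedComponentIn_eq h1, connectedComponentIn_eq h2]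
  have hsub : ∀ x, connectedComponentIn O x ⊆ O := fun x => connectedComponentIn_subset O x
  obtain ⟨W, hW, hWE⟩ := hE.split hf (I := t.image fun x => connectedComponentIn O x) (fun V hV W hW hne => by
    obtain ⟨x, -, rfl⟩ := Finset.mem_image.1 hV
    obtain ⟨y, -, rfl⟩ := Finset.mem_image.1 hW
    rw [disjoint_iff_inter_eq_empty]
    by_contra hc
    exact hne (hdisj x y (nonempty_iff_ne_empty.2 hc))) (fun x hx hxz => by
    obtain ⟨y, hy, hxy⟩ := mem_iUnion₂.1 (htc ⟨subset_closure hx, hxz⟩)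
    exact ⟨_, Finset.mem_image_of_mem _ hy, hxy⟩) (fun W hW => by
    obtain ⟨x, -, rfl⟩ := Finset.mem_image.1 hW
    exact (hsub x).trans inter_subset_left)
  obtain ⟨x, -, rfl⟩ := Finset.mem_image.1 hW
  refine ⟨_, (hsub x).trans inter_subset_left, hOo.connectedComponentIn, hWE, isPreconnected_connectedComponentIn, fun y hy => (hsub x hy).2, fun y hy => ?_⟩
  rw [(hOo.connectedComponentIn).frontier_eq] at hy
  by_contra! hlt
  have hyU : y ∈ U := by
    by_contra hn
    have := hfr y (by rw [hU.frontier_eq]; exact ⟨closure_mono ((hsub x).trans inter_subset_left) hy.1, hn⟩)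
    linarith
  have hyO : y ∈ O := ⟨hyU, hlt⟩
  obtain ⟨w, h1, h2⟩ := mem_closure_iff.1 hy.1 _ hOo.connectedComponentIn (mem_connectedComponentIn hyO)
  exact hy.2 (hdisj y x ⟨w, h1, h2⟩ ▸ mem_connectedComponentIn hyO)

variable [MeasurableSpace Y] [BorelSpace Y] {ν : Measure Y} [IsFiniteMeasure ν] {C D : ℝ}

theorem diam_step (hR : AReg ν d C D) (hf : LipschitzWith 1 f) {W O : Set Y} {s M : ℝ} (hs : 0 < s) (hsD : s ≤ D) (hWc : IsPreconnected W)
    (hW : ∀ x ∈ W, dist (f x) z < s) (hWO : ∀ x ∈ W, ball x s ⊆ O) (hM : ν.real (f ⁻¹' ball z (2 * s) ∩ O) ≤ M * (2 * s) ^ d) {x y : Y} (hx : x ∈ W) (hy : y ∈ W) :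
    dist x y ≤ 2 * s * (C * M * 2 ^ d) := by
  classical
  set J := ⌊dist x y / (2 * s)⌋₊ with hJ
  have hJle : (J : ℝ) * (2 * s) ≤ dist x y := by
    rw [← le_div_iff₀ (by positivity)]; exact Nat.floor_le (by positivity)
  have hex : ∀ j : Fin (J+1), ∃ w ∈ W, dist x w = 2 * s * j := fun j => by
    have : (2 * s * j) ∈ (fun w => dist x w) '' W := hWc.intermediate_value hx hy (by fun_prop) ⟨by simp; positivity, by
      have : (j:ℝ) ≤ J := by exact_mod_cast Nat.lt_succ_iff.1 j.2
      nlinarith⟩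
    exact this
  choose w hw hwd using hex
  have hsep : ∀ i j, i ≠ j → 2 * s ≤ dist (w i) (w j) := fun i j hij => by
    have h1 := abs_dist_sub_le (w i) (w j) x
    rw [dist_comm _ x, dist_comm _ x, hwd, hwd, ← mul_sub, abs_mul, abs_of_pos (by positivity : 0 < 2 * s)] at h1
    have : (1:ℝ) ≤ |(i:ℝ) - j| := by
      have : (i:ℤ) - j ≠ 0 := fun h => hij (Fin.ext (by omega))
      exact_mod_cast Int.one_le_abs this
    nlinarith
  have hinj : Function.Injective w := fun i j h => by
    by_contra hne
    have := hsep i j hne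
    rw [h, dist_self] at this
    linarith
  have hc := hR.card_sep (O := f ⁻¹' ball z (2 * s) ∩ O) hs hsD (Finset.univ.image w) (fun a ha b hb hab => by
    obtain ⟨i, -, rfl⟩ := Finset.mem_image.1 ha
    obtain ⟨j, -, rfl⟩ := Finset.mem_image.1 hb
    exact hsep i j fun h => hab (h ▸ rfl)) (fun a ha p hp => by
    obtain ⟨i, -, rfl⟩ := Finset.mem_image.1 ha
    refine ⟨?_, hWO _ (hw i) hp⟩
    have h1 := hf.dist_le_mul p (w i)
    have h2 := hW _ (hw i)
    have h3 := dist_triangle (f p) (f (w i)) z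
    simp only [mem_ball, mem_preimage, NNReal.coe_one, one_mul] at *
    linarith)
  rw [Finset.card_image_of_injective _ hinj, Finset.card_univ, Fintype.card_fin] at hc
  have h2 := hc.trans hM
  have hC := hR.Cpos
  rw [mul_pow] at h2
  have h3 : ((J + 1 : ℕ) : ℝ) ≤ C * M * 2 ^ d := by
    have hsd : 0 < s ^ d := by positivity
    have : ((J + 1 : ℕ) : ℝ) * (C⁻¹ * s ^ d) = ((J + 1 : ℕ) : ℝ) / C * s ^ d := by ring
    rw [this, ← mul_assoc] at h2
    have := le_of_mul_le_mul_right h2 hsd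
    rw [div_le_iff₀ hC] at this
    linarith
  have h4 := Nat.lt_floor_add_one (dist x y / (2 * s))
  rw [← hJ, div_lt_iff₀ (by positivity)] at h4
  push_cast at h3
  nlinarith

theorem nested [LocallyConnectedSpace Y] (hR : AReg ν d C D) (hf : LipschitzWith 1 f) (hU : IsOpen U) {O : Set Y} {R δ M : ℝ} (hR0 : 0 < R) (hδ : 0 < δ) (hδD : δ * R ≤ D)
    (hUO : ∀ x ∈ U, ball x (δ * R) ⊆ O) (hfr : ∀ x ∈ frontier U, δ * R ≤ dist (f x) z) (hE : Ess f U z) (hδM : 2 * δ * (C * M * 2 ^ d) ≤ 1)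
    (hM : ∀ k : ℕ, ν.real (f ⁻¹' ball z (2 * (δ * (R * (1/2)^k))) ∩ O) ≤ M * (2 * (δ * (R * (1/2)^k))) ^ d) :
    ∃ x ∈ closure U, f x = z ∧ ∀ k : ℕ, ball z (δ * (R * (1/2)^k)) ⊆ f '' closedBall x (R * (1/2)^k) := by
  set t : ℕ → ℝ := fun k => R * (1/2)^k with ht
  have ht0 : ∀ k, 0 < t k := fun k => by simp only [ht]; positivity
  have htle : ∀ k, t k ≤ R := fun k => by
    have : (1/2:ℝ)^k ≤ 1 := pow_le_one₀ (by norm_num) (by norm_num)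
    simp only [ht]; nlinarith
  have hts : ∀ k, t (k+1) ≤ t k := fun k => by simp only [ht, pow_succ]; nlinarith [ht0 k]
  let P : ℕ → Set Y → Prop := fun k W => W ⊆ U ∧ IsOpen W ∧ Ess f W z ∧ (∀ x ∈ W, dist (f x) z < δ * t k) ∧ (∀ x ∈ frontier W, δ * t k ≤ dist (f x) z) ∧
    ∀ x ∈ W, ∀ y ∈ W, dist x y ≤ t k
  have step : ∀ k s0 V, δ * t k ≤ s0 → V ⊆ U → IsOpen V → (∀ x ∈ frontier V, s0 ≤ dist (f x) z) → Ess f V z → ∃ W ⊆ V, P k W := by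
    intro k s0 V hs hVU hV hVf hVE
    obtain ⟨W, hWV, hWo, hWE, hWc, hW1, hW2⟩ := comp_step (mul_pos hδ (ht0 k)) hs hV hf.continuous hVf hVE
    have hδt : δ * t k ≤ δ * R := mul_le_mul_of_nonneg_left (htle k) hδ.le
    refine ⟨W, hWV, hWV.trans hVU, hWo, hWE, hW1, hW2, fun x hx y hy => ?_⟩
    have := diam_step hR hf (mul_pos hδ (ht0 k)) (hδt.trans hδD) hWc hW1 (fun x hx => (ball_subset_ball hδt).trans (hUO x (hVU (hWV hx)))) (hM k) hx hy
    refine this.trans ?_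
    have := ht0 k
    nlinarith
  obtain ⟨V0, -, hV0⟩ := step 0 (δ * R) U (by simp [ht]) subset_rfl hU hfr hE
  have step' : ∀ k V, P k V → ∃ W ⊆ V, P (k+1) W := fun k V hV =>
    step (k+1) (δ * t k) V (mul_le_mul_of_nonneg_left (hts k) hδ.le) hV.1 hV.2.1 hV.2.2.2.2.1 hV.2.2.1
  choose! nx hnx1 hnx2 using step'
  let V : ℕ → Set Y := fun k => Nat.rec V0 (fun k W => nx k W) k
  have hV : ∀ k, P k (V k) := fun k => by
    induction k with
    | zero => exact hV0
    | succ k ih => exact hnx2 k _ ih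
  have hne : ∀ k, (V k).Nonempty := fun k => by
    obtain ⟨x, hx, -⟩ := (hV k).2.2.1 f hf.continuous fun _ _ => rfl
    exact ⟨x, hx⟩
  obtain ⟨x, hx⟩ := IsCompact.nonempty_iInter_of_sequence_nonempty_isCompact_isClosed (fun k => closure (V k)) (fun k => closure_mono (hnx1 k _ (hV k)))
    (fun k => (hne k).closure) isClosed_closure.isCompact fun k => isClosed_closure
  rw [mem_iInter] at hx
  have hxd : ∀ k, ∀ y ∈ V k, dist y x ≤ t k := fun k y hy =>
    closure_minimal (s := V k) (t := {x | dist y x ≤ t k}) (fun w hw => (hV k).2.2.2.2.2 y hy w hw) (isClosed_le (by fun_prop) continuous_const) (hx k)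
  refine ⟨x, closure_mono (hV 0).1 (hx 0), ?_, fun k w hw => ?_⟩
  · have h1 : ∀ k, dist (f x) z ≤ δ * t k := fun k =>
      closure_minimal (s := V k) (t := {x | dist (f x) z ≤ δ * t k}) (fun w hw => ((hV k).2.2.2.1 w hw).le)
        (isClosed_le (by have := hf.continuous; fun_prop) continuous_const) (hx k)
    have h2 : Tendsto (fun k => δ * t k) atTop (𝓝 (δ * (R * 0))) :=
      ((tendsto_pow_atTop_nhds_zero_of_lt_one (by norm_num) (by norm_num : (1/2:ℝ) < 1)).const_mul R).const_mul δ
    have := ge_of_tendsto' h2 h1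
    simp only [mul_zero] at this
    exact dist_le_zero.1 this
  · obtain ⟨p, hp, hpe⟩ := (hV k).2.2.1.move (hV k).2.1 hf.continuous (hV k).2.2.2.2.1 (by rw [dist_comm]; exact hw) f hf.continuous fun _ _ => rfl
    exact ⟨p, hxd k p hp, hpe⟩

end B1
end

section
open MeasureTheory Metric Set Filter Topology
set_option linter.unusedSectionVars false

theorem sel_lem {Y : Type*} [MeasurableSpace Y] {ν : Measure Y} [IsFiniteMeasure ν] {G : Set Y} (hG : MeasurableSet G) {Bad : ℕ → Set Y}
    (hB : ∀ k, MeasurableSet (Bad k)) {P m : ℕ} (hP : 0 < P) {Q : ℕ → Fin P → Set Y} (hQ : ∀ k i, MeasurableSet (Q k i)) (hQc : ∀ k x, ∃ i, x ∈ Q k i)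
    (hm : ∀ x ∈ G, ∀ s : Finset ℕ, (∀ k ∈ s, x ∈ Bad k) → s.card ≤ m) :
    ∃ χ : ℕ → Fin P, ν G ≤ P ^ m * ν {x | x ∈ G ∧ ∀ k, x ∈ Bad k → x ∈ Q k (χ k)} := by
  classical
  let st : (Y → ENNReal) → ℕ → Fin P → Y → ENNReal := fun w k i x => w x * (if x ∈ Bad k then (if x ∈ Q k i then (P : ENNReal) else 0) else 1)
  have hstm : ∀ w, Measurable w → ∀ k i, Measurable (st w k i) := fun w hw k i =>
    hw.mul (Measurable.ite (hB k) (Measurable.ite (hQ k i) measurable_const measurable_const) measurable_const)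
  have : Nonempty (Fin P) := ⟨⟨0, hP⟩⟩
  have hex : ∀ w : Y → ENNReal, Measurable w → ∀ k, ∃ i, ∫⁻ x, w x ∂ν ≤ ∫⁻ x, st w k i x ∂ν := by
    intro w hw k
    by_contra! hc
    have h1 := ENNReal.sum_lt_sum_of_nonempty (Finset.univ_nonempty (α := Fin P)) (fun i _ => hc i)
    rw [← lintegral_finsetSum _ (fun i _ => hstm w hw k i), Finset.sum_const, Finset.card_univ, Fintype.card_fin, nsmul_eq_mul,
      ← lintegral_const_mul _ hw] at h1
    refine absurd (lintegral_mono (μ := ν) (fun x => ?_)) (not_le.2 h1)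
    by_cases hx : x ∈ Bad k
    · obtain ⟨i, hi⟩ := hQc k x
      refine le_trans ?_ (Finset.single_le_sum (fun _ _ => zero_le) (Finset.mem_univ i))
      simp [st, hx, hi, mul_comm]
    · simp [st, hx]
  choose! pk hpk using hex
  let W : ℕ → Y → ENNReal := fun n => Nat.rec (G.indicator 1) (fun k w => st w k (pk w k)) n
  have hWs : ∀ k, W (k+1) = st (W k) k (pk (W k) k) := fun k => rfl
  have hWm : ∀ k, Measurable (W k) := fun k => by
    induction k with
    | zero => exact measurable_one.indicator hG
    | succ k ih => rw [hWs]; exact hstm _ ih _ _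
  let χ : ℕ → Fin P := fun k => pk (W k) k
  let A : ℕ → Set Y := fun K => {x | x ∈ G ∧ ∀ k < K, x ∈ Bad k → x ∈ Q k (χ k)}
  have hAm : ∀ K, MeasurableSet (A K) := fun K => by
    have : A K = G ∩ ⋂ k, ⋂ (_ : k < K), ((Bad k)ᶜ ∪ Q k (χ k)) := by
      ext x; simp [A, imp_iff_not_or]
    rw [this]
    exact hG.inter (MeasurableSet.iInter fun k => MeasurableSet.iInter fun _ => (hB k).compl.union (hQ k _))
  have hWA : ∀ K x, W K x ≤ (A K).indicator (fun x => (P:ENNReal) ^ ((Finset.range K).filter (x ∈ Bad ·)).card) x := by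
    intro K
    induction K with
    | zero => intro x; by_cases hx : x ∈ G <;> simp [W, A, hx]
    | succ K ih =>
      intro x
      rw [hWs]
      by_cases hx : x ∈ A K
      · have h1 := ih x
        rw [indicator_of_mem hx] at h1
        by_cases hb : x ∈ Bad K
        · by_cases hq : x ∈ Q K (χ K)
          · rw [indicator_of_mem (show x ∈ A (K+1) from ⟨hx.1, fun k hk h => (Nat.lt_succ_iff_lt_or_eq.1 hk).elim (fun h' => hx.2 k h' h) (fun h' => h' ▸ hq)⟩),
              Finset.range_add_one, Finset.filter_insert, if_pos hb, Finset.card_insert_of_notMem (by simp), pow_succ]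
            simp only [st, if_pos hb]
            rw [if_pos hq]
            gcongr
          · simp only [st, if_pos hb]
            rw [if_neg hq, mul_zero]; exact zero_le
        · rw [indicator_of_mem (show x ∈ A (K+1) from ⟨hx.1, fun k hk h => (Nat.lt_succ_iff_lt_or_eq.1 hk).elim (fun h' => hx.2 k h' h) (fun h' => absurd (h' ▸ h) hb)⟩),
              Finset.range_add_one, Finset.filter_insert, if_neg hb]
          simp only [st, if_neg hb, mul_one]
          exact h1
      · have h1 := ih x
        rw [indicator_of_notMem hx] at h1
        simp only [st, nonpos_iff_eq_zero.1 h1, zero_mul]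
        exact zero_le
  have hmain : ∀ K, ν G ≤ P ^ m * ν (A K) := by
    intro K
    have h1 : ν G ≤ ∫⁻ x, W K x ∂ν := by
      induction K with
      | zero => simp [W, lintegral_indicator_one hG]
      | succ K ih => exact ih.trans (hpk _ (hWm K) K)
    refine h1.trans ?_
    rw [← lintegral_indicator_const (hAm K)]
    refine lintegral_mono fun x => (hWA K x).trans ?_
    by_cases hx : x ∈ A K
    · rw [indicator_of_mem hx, indicator_of_mem hx]
      exact pow_le_pow_right₀ (by exact_mod_cast hP) (hm x hx.1 _ (fun k hk => (Finset.mem_filter.1 hk).2))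
    · rw [indicator_of_notMem hx, indicator_of_notMem hx]
  refine ⟨χ, ?_⟩
  have he : {x | x ∈ G ∧ ∀ k, x ∈ Bad k → x ∈ Q k (χ k)} = ⋂ K, A K := by
    ext x
    simp only [mem_ofPred_eq, mem_iInter, A]
    exact ⟨fun h K => ⟨h.1, fun k _ => h.2 k⟩, fun h => ⟨(h 0).1, fun k => (h (k+1)).2 k k.lt_succ_self⟩⟩
  rw [he]
  have hanti : Antitone A := fun a b hab x hx => ⟨hx.1, fun k hk => hx.2 k (hk.trans_le hab)⟩
  have ht := tendsto_measure_iInter_atTop (μ := ν) (fun K => (hAm K).nullMeasurableSet) hanti ⟨0, measure_ne_top _ _⟩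
  exact ge_of_tendsto' (ENNReal.Tendsto.const_mul ht (Or.inr (by finiteness))) hmain

theorem greedy {Y : Type*} [PseudoMetricSpace Y] {a : ℝ} (N : ℕ) (s : Finset Y)
    (h : ∀ p ∈ s, ∀ s' ⊆ s, (∀ q ∈ s', dist q p < a) → s'.card ≤ N) :
    ∃ c : Y → Fin (N+1), ∀ p ∈ s, ∀ q ∈ s, p ≠ q → c p = c q → a ≤ dist p q := by
  classical
  induction s using Finset.induction_on with
  | empty => exact ⟨fun _ => 0, by simp⟩
  | insert p s hp ih =>
    obtain ⟨c, hc⟩ := ih fun q hq s' hs' => h q (Finset.mem_insert_of_mem hq) s' (hs'.trans (Finset.subset_insert _ _))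
    obtain ⟨i, -, hi⟩ := Finset.exists_mem_notMem_of_card_lt_card (s := (s.filter (dist · p < a)).image c) (t := Finset.univ) (by
      refine Finset.card_image_le.trans_lt ?_
      rw [Finset.card_univ, Fintype.card_fin, Nat.lt_succ_iff]
      exact h p (Finset.mem_insert_self _ _) _ ((Finset.filter_subset _ _).trans (Finset.subset_insert _ _)) (by simp))
    have key : ∀ q ∈ s, c q = i → a ≤ dist q p := fun q hq he => by
      by_contra hlt
      exact hi (Finset.mem_image.2 ⟨q, Finset.mem_filter.2 ⟨hq, not_le.1 hlt⟩, he⟩)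
    have hne : ∀ q ∈ s, q ≠ p := fun q hq h => hp (h ▸ hq)
    refine ⟨Function.update c p i, fun x hx y hy hxy he => ?_⟩
    rcases Finset.mem_insert.1 hx with rfl | hx' <;> rcases Finset.mem_insert.1 hy with rfl | hy'
    · exact absurd rfl hxy
    · rw [Function.update_self, Function.update_of_ne (hne y hy')] at he
      rw [dist_comm]; exact key y hy' he.symm
    · rw [Function.update_self, Function.update_of_ne (hne x hx')] at he
      exact key x hx' he
    · rw [Function.update_of_ne (hne y hy'), Function.update_of_ne (hne x hx')] at he
      exact hc x hx' y hy' hxy he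

section
variable {Y : Type*} [MetricSpace Y] [CompactSpace Y] [MeasurableSpace Y] [BorelSpace Y] {ν : Measure Y} [IsFiniteMeasure ν] {d : ℕ} {C D : ℝ}

theorem colors (hR : AReg ν d C D) : ∃ P : ℕ, 0 < P ∧ ∀ t, 0 < t → t ≤ D → ∃ Q : Fin P → Set Y, (∀ i, IsOpen (Q i)) ∧ (∀ x, ∃ i, x ∈ Q i) ∧
    ∀ i, ∀ x ∈ Q i, ∀ y ∈ Q i, dist x y < t ∨ 2 * t < dist x y := by
  have hC := hR.Cpos
  refine ⟨⌊C * C * (32:ℝ)^d⌋₊ + 1, Nat.succ_pos _, fun t ht htD => ?_⟩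
  obtain ⟨s, -, hs, hsc⟩ := exists_net (univ : Set Y) (show 0 < t/4 by linarith)
  obtain ⟨c, hc⟩ := greedy (a := 3 * t) ⌊C * C * (32:ℝ)^d⌋₊ s (fun p hp s' hs' hq => by
    refine Nat.le_floor ?_
    have h1 := hR.card_sep (δ := t/8) (O := ball p (4*t)) (by linarith) (by linarith) s' (fun x hx y hy hxy => by linarith [hs x (hs' hx) y (hs' hy) hxy])
      (fun x hx y hy => by
        have h1 := hq x hx
        rw [mem_ball] at hy ⊢
        linarith [dist_triangle y x p])
    have h2 := hR.upper p (4*t) (by linarith)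
    have h3 : C * (4*t)^d = C * C * 32^d * (C⁻¹ * (t/8)^d) := by
      rw [show 4 * t = 32 * (t/8) by ring, mul_pow]; field_simp
    rw [h3] at h2
    exact le_of_mul_le_mul_right (h1.trans h2) (by positivity))
  refine ⟨fun i => ⋃ p ∈ {p | p ∈ s ∧ c p = i}, ball p (t/4), fun i => isOpen_biUnion fun _ _ => isOpen_ball, fun x => ?_, fun i x hx y hy => ?_⟩
  · obtain ⟨p, hp, hxp⟩ := hsc x (mem_univ x)
    exact ⟨c p, mem_iUnion₂.2 ⟨p, ⟨hp, rfl⟩, hxp⟩⟩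
  · obtain ⟨p, ⟨hp, hpi⟩, hxp⟩ := mem_iUnion₂.1 hx
    obtain ⟨q, ⟨hq, hqi⟩, hyq⟩ := mem_iUnion₂.1 hy
    rw [mem_ball] at hxp hyq
    by_cases hpq : p = q
    · subst hpq
      left; linarith [dist_triangle_right x y p]
    · right
      linarith [hc p hp q hq hpq (hpi.trans hqi.symm), dist_triangle4 p x y q, dist_comm p x]
end
end

section
open MeasureTheory Metric Set Filter Topology
set_option linter.unusedSectionVars false

section
variable {Y : Type*} [MetricSpace Y] [CompactSpace Y] [MeasurableSpace Y] [BorelSpace Y] {ν : Measure Y} [IsFiniteMeasure ν] {d : ℕ} {C D : ℝ} {f : Y → XX d}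

theorem max_bound (hf : Continuous f) {O : Set Y} (hO : IsOpen O) {M B : ℝ} (hM : 0 < M) :
    volume {z | ∃ ρ, 0 < ρ ∧ ρ ≤ B ∧ M * ρ ^ d < ν.real (f ⁻¹' ball z ρ ∩ O)} ≤ ENNReal.ofReal (10 ^ d / M * ν.real O) := by
  set Z := {z | ∃ ρ, 0 < ρ ∧ ρ ≤ B ∧ M * ρ ^ d < ν.real (f ⁻¹' ball z ρ ∩ O)}
  have hex : ∀ z : XX d, ∃ ρ, z ∈ Z → 0 < ρ ∧ ρ ≤ B ∧ M * ρ ^ d < ν.real (f ⁻¹' ball z ρ ∩ O) := fun z => by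
    by_cases h : z ∈ Z
    · obtain ⟨ρ, h⟩ := h; exact ⟨ρ, fun _ => h⟩
    · exact ⟨0, fun h' => absurd h' h⟩
  choose ρ hρ using hex
  obtain ⟨u, huZ, hud, huc⟩ := Vitali.exists_disjoint_subfamily_covering_enlargement_closedBall Z id ρ B (fun a ha => (hρ a ha).2.1) 5 (by norm_num)
  have hcount : u.Countable := hud.countable_of_nonempty_interior fun i hi => by
    have := (hρ i (huZ hi)).1
    rw [interior_closedBall _ this.ne']
    exact ⟨i, mem_ball_self this⟩
  have hm : ∀ b ∈ u, MeasurableSet (f ⁻¹' ball b (ρ b) ∩ O) := fun b _ => (measurableSet_ball.preimage hf.measurable).inter hO.measurableSet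
  calc volume Z ≤ volume (⋃ b ∈ u, closedBall b (5 * ρ b)) := by
        refine measure_mono fun z hz => ?_
        obtain ⟨b, hb, h⟩ := huc z hz
        exact mem_iUnion₂.2 ⟨b, hb, h (mem_closedBall_self (hρ z hz).1.le)⟩
    _ ≤ ∑' b : u, volume (closedBall (b : XX d) (5 * ρ b)) := measure_biUnion_le _ hcount _
    _ ≤ ∑' b : u, ENNReal.ofReal (10 ^ d / M) * ν (f ⁻¹' ball (b : XX d) (ρ b) ∩ O) := by
        refine ENNReal.tsum_le_tsum fun b => ?_
        obtain ⟨h1, h2, h3⟩ := hρ b (huZ b.2)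
        rw [Real.volume_pi_closedBall _ (by positivity), Fintype.card_fin, ← ofReal_measureReal, ← ENNReal.ofReal_mul (by positivity)]
        refine ENNReal.ofReal_le_ofReal ?_
        rw [show 2 * (5 * ρ b) = 10 * ρ b by ring, mul_pow, div_mul_eq_mul_div, le_div_iff₀ hM]
        calc _ = 10 ^ d * (M * ρ b ^ d) := by ring
          _ ≤ _ := by gcongr
    _ = ENNReal.ofReal (10 ^ d / M) * ν (⋃ b ∈ u, (f ⁻¹' ball (b : XX d) (ρ b) ∩ O)) := by
        rw [ENNReal.tsum_mul_left, measure_biUnion hcount _ hm]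
        exact fun a ha b hb hab => (((hud ha hb hab).mono ball_subset_closedBall ball_subset_closedBall).preimage f).mono inter_subset_left inter_subset_left
    _ ≤ ENNReal.ofReal (10 ^ d / M) * ν O := by
        gcongr
        exact iUnion₂_subset fun b _ => inter_subset_right
    _ = _ := by rw [ENNReal.ofReal_mul (by positivity), ofReal_measureReal]

theorem surj_closed (hf : Continuous f) (a b : ℝ) : IsClosed {x | ball (f x) a ⊆ f '' closedBall x b} := by
  have : {x | ball (f x) a ⊆ f '' closedBall x b} = ⋂ v, ({x | a ≤ dist v (f x)} ∪ Prod.fst '' {p : Y × Y | dist p.2 p.1 ≤ b ∧ f p.2 = v}) := by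
    ext x
    simp only [mem_ofPred_eq, mem_iInter, mem_union, mem_image, Prod.exists, exists_and_right, exists_eq_right]
    constructor
    · intro h v
      rcases le_or_gt a (dist v (f x)) with h1 | h1
      · exact Or.inl h1
      · obtain ⟨w, hw, hv⟩ := h h1
        exact Or.inr ⟨w, hw, hv⟩
    · intro h v hv
      rcases h v with h1 | ⟨w, hw, hv⟩
      · exact absurd h1 (not_le.2 hv)
      · exact ⟨w, hw, hv⟩
  rw [this]
  refine isClosed_iInter fun v => (isClosed_le continuous_const (by fun_prop)).union (IsCompact.isClosed (IsCompact.image ?_ continuous_fst))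
  refine IsClosed.isCompact (IsClosed.and (isClosed_le ?_ ?_) (isClosed_eq ?_ ?_)) <;> fun_prop

theorem bad_closed (hf : Continuous f) {G : Set Y} (hG : IsClosed G) (t η : ℝ) :
    IsClosed {x | x ∈ G ∧ ∃ y ∈ G, t ≤ dist x y ∧ dist x y ≤ 2 * t ∧ dist (f x) (f y) ≤ η * t} := by
  have : {x | x ∈ G ∧ ∃ y ∈ G, t ≤ dist x y ∧ dist x y ≤ 2 * t ∧ dist (f x) (f y) ≤ η * t} =
    Prod.fst '' ((G ×ˢ G) ∩ {p : Y × Y | t ≤ dist p.1 p.2 ∧ dist p.1 p.2 ≤ 2 * t ∧ dist (f p.1) (f p.2) ≤ η * t}) := by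
    ext x; simp [and_assoc]
  rw [this]
  refine (IsCompact.image (IsClosed.isCompact ?_) continuous_fst).isClosed
  refine (hG.prod hG).inter (IsClosed.and (isClosed_le ?_ ?_) (IsClosed.and (isClosed_le ?_ ?_) (isClosed_le ?_ ?_))) <;> fun_prop

theorem bad_count {G T : Set Y} {R δ : ℝ} (hR : 0 < R) (hδ : 0 < δ) {N : ℕ} {x : Y}
    (hs : ∀ y ∈ G, ∀ k : ℕ, ball (f y) (δ * (R * (1/2)^k)) ⊆ f '' closedBall y (R * (1/2)^k))
    (hT : ∀ y ∈ G, closedBall y (R/4) ⊆ T) (hN : ∀ s : Finset Y, ↑s ⊆ T → (∀ w ∈ s, f w = f x) → s.card ≤ N) (s : Finset ℕ)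
    (hb : ∀ k ∈ s, ∃ y ∈ G, R * (1/2)^k ≤ dist x y ∧ dist x y ≤ 2 * (R * (1/2)^k) ∧ dist (f x) (f y) ≤ δ/8 * (R * (1/2)^k)) : s.card ≤ 2 * N := by
  classical
  have h1 : ∀ k ∈ s, ∃ w ∈ T, f w = f x ∧ 3/4 * (R * (1/2)^k) ≤ dist w x ∧ dist w x ≤ 9/4 * (R * (1/2)^k) := by
    intro k hk
    obtain ⟨y, hy, h1, h2, h3⟩ := hb k hk
    have ht : 0 < R * (1/2:ℝ)^k := by positivity
    have he : R * (1/2:ℝ)^(k+2) = R * (1/2)^k / 4 := by rw [pow_add]; ring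
    have hle : R * (1/2:ℝ)^k ≤ R := mul_le_of_le_one_right hR.le (pow_le_one₀ (by norm_num) (by norm_num))
    obtain ⟨w, hw, hwx⟩ := hs y hy (k+2) (show f x ∈ _ by rw [mem_ball, he]; nlinarith)
    rw [he, mem_closedBall] at hw
    exact ⟨w, hT y hy (mem_closedBall.2 (by linarith)), hwx, by linarith [dist_triangle_left x y w, dist_comm w x], by linarith [dist_triangle w y x, dist_comm x y]⟩
  have : Nonempty Y := ⟨x⟩
  choose! w hwT hwx hw1 hw2 using h1
  have hinj : ∀ j ∈ s, ∀ k ∈ s, j + 2 ≤ k → w j ≠ w k := fun j hj k hk hjk he => by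
    have h1 := hw1 j hj
    have h2 := hw2 k hk
    rw [← he] at h2
    have h3 : R * (1/2:ℝ)^k ≤ R * (1/2)^(j+2) := mul_le_mul_of_nonneg_left (pow_le_pow_of_le_one (by norm_num) (by norm_num) hjk) hR.le
    have he : R * (1/2:ℝ)^(j+2) = R * (1/2)^j / 4 := by rw [pow_add]; ring
    have : 0 < R * (1/2:ℝ)^j := by positivity
    linarith
  have h2 : (s.image w).card ≤ N := hN _ (fun y hy => by
    obtain ⟨k, hk, rfl⟩ := Finset.mem_image.1 (Finset.mem_coe.1 hy); exact hwT k hk) (fun y hy => by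
    obtain ⟨k, hk, rfl⟩ := Finset.mem_image.1 hy; exact hwx k hk)
  have h3 : s.card ≤ (Finset.range 2 ×ˢ s.image w).card := by
    refine Finset.card_le_card_of_injOn (fun k => (k % 2, w k)) (fun k hk => ?_) (fun j hj k hk he => ?_)
    · exact Finset.mem_coe.2 (Finset.mem_product.2 ⟨Finset.mem_range.2 (Nat.mod_lt _ two_pos), Finset.mem_image_of_mem _ hk⟩)
    · simp only [Prod.mk.injEq] at he
      by_contra hne
      rcases Nat.lt_or_gt_of_ne hne with h | h
      · exact hinj j hj k hk (by omega) he.2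
      · exact hinj k hk j hj (by omega) he.2.symm
  rw [Finset.card_product, Finset.card_range] at h3
  omega
end
end

section
open MeasureTheory Metric Set Filter Topology
set_option linter.unusedSectionVars false

section
variable {Y : Type*} [MetricSpace Y] [CompactSpace Y] [MeasurableSpace Y] [BorelSpace Y] {ν : Measure Y} [IsFiniteMeasure ν] {d : ℕ} {C D : ℝ} {f : Y → XX d}

theorem good_vals (hR : AReg ν d C D) (hf : LipschitzWith 1 f) {c M R : ℝ} {N : ℕ} (hc : 0 < c) (hM : M = 4 * C * 20 ^ d / c ^ d)
    (hN : 4 * C ^ 2 * 8 ^ d / c ^ d ≤ N) (hR0 : 0 < R) (x0 : Y) (z : XX d) : ∃ S ⊆ ball z (c * R / 2), IsCompact S ∧ ENNReal.ofReal ((c * R) ^ d / 4) ≤ volume S ∧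
    (∀ z ∈ S, ∀ ρ, 0 < ρ → ρ ≤ 2 * R → ν.real (f ⁻¹' ball z ρ ∩ ball x0 (2 * R)) ≤ M * ρ ^ d) ∧
    ∀ z ∈ S, ∀ s : Finset Y, ↑s ⊆ closedBall x0 (3 / 2 * R) → (∀ x ∈ s, f x = z) → s.card ≤ N := by
  have hC := hR.Cpos
  have hM0 : 0 < M := by rw [hM]; positivity
  have hup := hR.upper x0 (2 * R) (by linarith)
  have hcR : 0 < (c * R) ^ d := by positivity
  set Z1 := {z | ∃ ρ, 0 < ρ ∧ ρ ≤ 2 * R ∧ M * ρ ^ d < ν.real (f ⁻¹' ball z ρ ∩ ball x0 (2 * R))} with hZ1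
  set Z2 := {z | ∃ s : Finset Y, ↑s ⊆ closedBall x0 (3 / 2 * R) ∧ N ≤ s.card ∧ ∀ x ∈ s, f x = z} with hZ2
  have h1 : volume Z1 ≤ ENNReal.ofReal ((c * R) ^ d / 4) := by
    refine (max_bound (ν := ν) hf.continuous isOpen_ball hM0).trans (ENNReal.ofReal_le_ofReal ?_)
    calc 10 ^ d / M * ν.real (ball x0 (2 * R)) ≤ 10 ^ d / M * (C * (2 * R) ^ d) := by gcongr
      _ = _ := by
        rw [hM, mul_pow, mul_pow, show (20:ℝ) = 10 * 2 by norm_num, mul_pow]; field_simp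
  have hN0 : 0 < (N:ℝ) := lt_of_lt_of_le (by positivity) hN
  have h2 : volume Z2 ≤ ENNReal.ofReal ((c * R) ^ d / 4) := by
    have h := mult_bound hR hf (T := closedBall x0 (3/2 * R)) (O := ball x0 (2 * R)) (half_pos hR0) (fun x hx => ball_subset_ball' (by
      rw [mem_closedBall] at hx; linarith)) N
    rw [mul_comm, ← ENNReal.le_div_iff_mul_le (Or.inl (by exact_mod_cast hN0.ne')) (Or.inl (ENNReal.natCast_ne_top N)), ← ENNReal.ofReal_natCast N,
      ← ENNReal.ofReal_div_of_pos hN0] at h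
    refine h.trans (ENNReal.ofReal_le_ofReal ?_)
    rw [div_le_iff₀ hN0]
    calc C * (4 * (1:NNReal)) ^ d * ν.real (ball x0 (2 * R)) ≤ C * (4 * (1:NNReal)) ^ d * (C * (2 * R) ^ d) := by gcongr
      _ = (c * R) ^ d / 4 * (4 * C ^ 2 * 8 ^ d / c ^ d) := by
        rw [mul_pow, mul_pow, mul_pow, show (8:ℝ) = 4 * 2 by norm_num, mul_pow]; simp only [NNReal.coe_one, one_pow, mul_one]; field_simp
      _ ≤ _ := by gcongr
  set V := ball z (c * R / 2) \ (toMeasurable volume Z1 ∪ toMeasurable volume Z2) with hV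
  have hVm : MeasurableSet V := measurableSet_ball.diff ((measurableSet_toMeasurable _ _).union (measurableSet_toMeasurable _ _))
  have h3 : ENNReal.ofReal ((c * R) ^ d / 2) ≤ volume V := by
    have : volume (ball z (c * R / 2)) ≤ volume V + (volume Z1 + volume Z2) := by
      rw [← measure_toMeasurable Z1, ← measure_toMeasurable Z2]
      refine le_trans (measure_mono ?_) ((measure_union_le _ _).trans (add_le_add le_rfl (measure_union_le _ _)))
      rw [hV, sdiff_union_self]; exact subset_union_left
    rw [Real.volume_pi_ball _ (by positivity), Fintype.card_fin, mul_div_cancel₀ _ two_ne_zero] at this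
    have h4 := this.trans (add_le_add le_rfl (add_le_add h1 h2))
    rw [← ENNReal.ofReal_add (by positivity) (by positivity)] at h4
    rw [show (c * R) ^ d / 2 = (c * R) ^ d - ((c * R) ^ d / 4 + (c * R) ^ d / 4) by ring, ENNReal.ofReal_sub _ (by positivity)]
    exact tsub_le_iff_right.2 h4
  obtain ⟨S, hSV, hS, hSv⟩ := hVm.exists_lt_isCompact (lt_of_lt_of_le ((ENNReal.ofReal_lt_ofReal_iff (by positivity)).2 (by linarith :
    (c * R) ^ d / 4 < (c * R) ^ d / 2)) h3)
  refine ⟨S, hSV.trans sdiff_subset, hS, hSv.le, fun z hz ρ h1 h2 => ?_, fun z hz s hs hsz => ?_⟩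
  · by_contra! hlt
    exact (hSV hz).2 (Or.inl (subset_toMeasurable _ _ ⟨ρ, h1, h2, hlt⟩))
  · by_contra! hlt
    exact (hSV hz).2 (Or.inr (subset_toMeasurable _ _ ⟨s, hs, hlt.le, hsz⟩))

theorem image_bound (hR : AReg ν d C D) (hf : LipschitzWith 1 f) {G : Set Y} (hG : IsClosed G) : volume (f '' G) ≤ ENNReal.ofReal (C * 4 ^ d * ν.real G) := by
  have hC := hR.Cpos
  have h : ∀ O, IsOpen O → G ⊆ O → volume (f '' G) ≤ ENNReal.ofReal (C * 4 ^ d) * ν O := fun O hO hGO => by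
    obtain ⟨δ, hδ, hth⟩ := hG.isCompact.exists_thickening_subset_open hO hGO
    have := mult_bound hR hf hδ (fun x hx => (ball_subset_thickening hx δ).trans hth) 1
    simp only [Nat.cast_one, one_mul, NNReal.coe_one, mul_one] at this
    rw [ENNReal.ofReal_mul (by positivity), ofReal_measureReal] at this
    refine le_trans (measure_mono ?_) this
    rintro y ⟨x, hx, rfl⟩
    exact ⟨{x}, by simpa using hx, by simp, by simp⟩
  rw [ENNReal.ofReal_mul (by positivity), ofReal_measureReal, Set.measure_eq_iInf_isOpen G, ENNReal.mul_iInf_of_ne (by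
    simpa using by positivity) (by finiteness)]
  refine le_iInf fun O => ?_
  by_cases h1 : G ⊆ O
  · by_cases h2 : IsOpen O
    · simp only [h1, h2, iInf_pos]; exact h O h2 h1
    · simp [h2, ENNReal.mul_top, hC]
  · simp [h1, ENNReal.mul_top, hC]

theorem BP0 [LocallyConnectedSpace Y] (hR : AReg ν d C D) {c : ℝ} (hc : 0 < c) : ∃ θ > 0, ∃ k0 > 0, ∀ x0 R, 0 < R → R ≤ D → ∀ (f : Y → XX d) (U : Set Y) (z : XX d),
    LipschitzWith 1 f → IsOpen U → U ⊆ ball x0 R → (∀ x ∈ frontier U, c * R ≤ dist (f x) z) → Ess f U z →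
    ∃ A ⊆ closedBall x0 R, IsClosed A ∧ θ * R ^ d ≤ ν.real A ∧ ∀ x ∈ A, ∀ y ∈ A, dist x y ≤ k0 * dist (f x) (f y) := by
  have hC := hR.Cpos
  obtain ⟨P, hP, hcol⟩ := colors hR
  set M := 4 * C * 20 ^ d / c ^ d with hM
  set N := ⌈4 * C ^ 2 * 8 ^ d / c ^ d⌉₊ with hN
  set δ := min (min (c / 2) 1) (1 / (2 * (C * M * 2 ^ d))) with hδ
  have hM0 : 0 < M := by positivity
  have hδ0 : 0 < δ := by positivity
  have hδ1 : δ ≤ c / 2 := (min_le_left _ _).trans (min_le_left _ _)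
  have hδ2 : δ ≤ 1 := (min_le_left _ _).trans (min_le_right _ _)
  have hδ3 : δ ≤ 1 / (2 * (C * M * 2 ^ d)) := min_le_right _ _
  rw [le_div_iff₀ (by positivity)] at hδ3
  have hPR : 0 < (P:ℝ) := by exact_mod_cast hP
  refine ⟨c ^ d / (4 * C * 4 ^ d * P ^ (2 * N)), by positivity, 16 / δ, by positivity, fun x0 R hR0 hRD f U z hf hU hUB hfr hE => ?_⟩
  obtain ⟨S, hSz, hS, hSv, hS1, hS2⟩ := good_vals hR hf hc hM (Nat.le_ceil _) hR0 x0 z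
  set t : ℕ → ℝ := fun k => R * (1/2)^k with ht
  have ht0 : ∀ k, 0 < t k := fun k => by simp only [ht]; positivity
  have htR : ∀ k, t k ≤ R := fun k => mul_le_of_le_one_right hR0.le (pow_le_one₀ (by norm_num) (by norm_num))
  set G : Set Y := {x | x ∈ closedBall x0 R ∧ f x ∈ S ∧ ∀ k, ball (f x) (δ * t k) ⊆ f '' closedBall x (t k)} with hG
  have hGc : IsClosed G := by
    have : G = closedBall x0 R ∩ (f ⁻¹' S ∩ ⋂ k, {x | ball (f x) (δ * t k) ⊆ f '' closedBall x (t k)}) := by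
      ext x; simp [hG]
    rw [this]
    exact isClosed_closedBall.inter ((hS.isClosed.preimage hf.continuous).inter (isClosed_iInter fun k => surj_closed hf.continuous _ _))
  have hSG : S ⊆ f '' G := fun v hv => by
    have hvz := hSz hv
    rw [mem_ball'] at hvz
    obtain ⟨x, hx, hxv, hk⟩ := nested (z := v) hR hf hU (O := ball x0 (2 * R)) hR0 hδ0 (by nlinarith)
      (fun x hx => ball_subset_ball' (by have := hUB hx; rw [mem_ball] at this; nlinarith))
      (fun x hx => by have := hfr x hx; nlinarith [dist_triangle (f x) v z, dist_comm v z])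
      (Ess.move hU hf.continuous hfr (by linarith [mul_pos hc hR0]) hE) (by linarith) (M := M) (fun k => hS1 v hv _ (by have := ht0 k; positivity) (by
        have := htR k; have := ht0 k; simp only [ht] at this ⊢; nlinarith))
    refine ⟨x, ⟨closure_minimal (hUB.trans ball_subset_closedBall) isClosed_closedBall hx, hxv ▸ hv, fun k => ?_⟩, hxv⟩
    rw [hxv]; exact hk k
  have hGv : (c * R) ^ d / 4 ≤ C * 4 ^ d * ν.real G :=
    (ENNReal.ofReal_le_ofReal_iff (by positivity)).1 ((hSv.trans (measure_mono hSG)).trans (image_bound hR hf hGc))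
  set Bad : ℕ → Set Y := fun k => {x | x ∈ G ∧ ∃ y ∈ G, t k ≤ dist x y ∧ dist x y ≤ 2 * t k ∧ dist (f x) (f y) ≤ δ / 8 * t k} with hBad
  choose Q hQo hQc hQ using fun k => hcol (t k) (ht0 k) ((htR k).trans hRD)
  obtain ⟨χ, hχ⟩ := sel_lem (ν := ν) hGc.measurableSet (fun k => (bad_closed hf.continuous hGc (t k) (δ / 8)).measurableSet) (m := 2 * N) hP
    (fun k i => (hQo k i).measurableSet) hQc (fun x hx s hs => bad_count (T := closedBall x0 (3/2 * R)) hR0 hδ0 (fun y hy => hy.2.2)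
      (fun y hy => closedBall_subset_closedBall' (by have := hy.1; rw [mem_closedBall] at this; linarith)) (hS2 _ hx.2.1) s fun k hk => (hs k hk).2)
  set A := {x | x ∈ G ∧ ∀ k, x ∈ Bad k → x ∈ Q k (χ k)} with hA
  have hAlow : ∀ x ∈ A, ∀ y ∈ A, dist x y ≤ 16 / δ * dist (f x) (f y) := by
    intro x hx y hy
    rcases eq_or_ne x y with rfl | hne
    · simp
    have h0 := dist_pos.2 hne
    have hd : dist x y ≤ 2 * R := by
      have h1 := hx.1.1; have h2 := hy.1.1
      rw [mem_closedBall] at h1 h2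
      linarith [dist_triangle_right x y x0]
    obtain ⟨k, hk1, hk2⟩ := exists_nat_pow_near_of_lt_one (x := dist x y / (2 * R)) (y := (1/2:ℝ)) (by positivity) ((div_le_one (by positivity)).2 hd) (by norm_num) (by norm_num)
    rw [lt_div_iff₀ (by positivity)] at hk1
    rw [div_le_iff₀ (by positivity)] at hk2
    have e1 : t k ≤ dist x y := by simp only [ht]; rw [pow_succ] at hk1; linarith
    have e2 : dist x y ≤ 2 * t k := by simp only [ht]; linarith
    by_contra! hlt
    have e3 : dist (f x) (f y) ≤ δ / 8 * t k := by
      rw [div_mul_eq_mul_div, div_lt_iff₀ hδ0] at hlt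
      nlinarith
    have b1 := hx.2 k ⟨hx.1, y, hy.1, e1, e2, e3⟩
    have b2 := hy.2 k ⟨hy.1, x, hx.1, by rwa [dist_comm], by rwa [dist_comm], by rwa [dist_comm]⟩
    rcases hQ k _ x b1 y b2 with h | h <;> linarith
  refine ⟨closure A, closure_minimal (fun x hx => hx.1.1) isClosed_closedBall, isClosed_closure, ?_, ?_⟩
  · have h1 : ν.real G ≤ P ^ (2 * N) * ν.real (closure A) := by
      have := hχ.trans (mul_le_mul_right (measure_mono (subset_closure (s := A))) _)
      have h2 := ENNReal.toReal_mono (by finiteness) this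
      simpa [measureReal_def] using h2
    rw [div_mul_eq_mul_div, div_le_iff₀ (by positivity), ← mul_pow]
    have : C * 4 ^ d * ν.real G ≤ C * 4 ^ d * (P ^ (2 * N) * ν.real (closure A)) := by gcongr
    linarith
  · have hcl : IsClosed {p : Y × Y | dist p.1 p.2 ≤ 16 / δ * dist (f p.1) (f p.2)} := by
      have := hf.continuous
      exact isClosed_le (by fun_prop) (by fun_prop)
    intro x hx y hy
    have : closure (A ×ˢ A) ⊆ {p : Y × Y | dist p.1 p.2 ≤ 16 / δ * dist (f p.1) (f p.2)} := closure_minimal (fun p hp => hAlow _ hp.1 _ hp.2) hcl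
    rw [closure_prod_eq] at this
    exact this (show (x, y) ∈ _ from ⟨hx, hy⟩)

theorem BP [LocallyConnectedSpace Y] (hR : AReg ν d C D) {Λ c R0 : ℝ} (hΛ : 0 < Λ) (hc : 0 < c) (hR0 : 0 < R0)
    (hess : ∀ x0 : Y, ∀ R, 0 < R → R ≤ R0 → ∃ (f : Y → XX d) (U : Set Y) (z : XX d), (∀ x y, dist (f x) (f y) ≤ Λ / R * dist x y) ∧ IsOpen U ∧ U ⊆ ball x0 R ∧
      (∀ x ∈ frontier U, c ≤ dist (f x) z) ∧ Ess f U z) : ∃ θ > 0, ∃ k0 ≥ 1, ∃ R1 > 0, ∀ x0 : Y, ∀ R, 0 < R → R ≤ R1 →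
    ∃ A ⊆ closedBall x0 R, IsClosed A ∧ θ * R ^ d ≤ ν.real A ∧ ∃ f : Y → XX d, ∀ x ∈ A, ∀ y ∈ A, dist x y ≤ k0 * dist (f x) (f y) ∧ dist (f x) (f y) ≤ dist x y := by
  obtain ⟨θ, hθ, k0, hk0, h⟩ := BP0 hR (c := c / Λ) (by positivity)
  refine ⟨θ, hθ, max k0 1, le_max_right _ _, min R0 D, lt_min hR0 hR.Dpos, fun x0 R hRp hRle => ?_⟩
  obtain ⟨f, U, z, hf, hU, hUB, hfr, hE⟩ := hess x0 R hRp (hRle.trans (min_le_left _ _))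
  have ha : 0 < R / Λ := by positivity
  have hds : ∀ u v : XX d, dist ((R / Λ) • u) ((R / Λ) • v) = R / Λ * dist u v := fun u v => by
    rw [dist_smul₀, Real.norm_of_nonneg ha.le]
  have hlip : LipschitzWith 1 (fun x => (R / Λ) • f x) := LipschitzWith.of_dist_le_mul fun x y => by
    rw [hds]
    calc _ ≤ R / Λ * (Λ / R * dist x y) := by gcongr; exact hf x y
      _ = _ := by field_simp; simp
  obtain ⟨A, hA, hAc, hAv, hAd⟩ := h x0 R hRp (hRle.trans (min_le_right _ _)) (fun x => (R / Λ) • f x) U ((R / Λ) • z) hlip hU hUB (fun x hx => by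
    rw [hds, div_mul_eq_mul_div, div_mul_eq_mul_div, mul_comm]; gcongr; exact hfr x hx) (fun g hg hgf => by
      obtain ⟨x, hx, hxz⟩ := hE (fun x => (R / Λ)⁻¹ • g x) (by fun_prop) (fun x hx => by rw [hgf x hx, inv_smul_smul₀ ha.ne'])
      exact ⟨x, hx, by rw [← hxz, smul_inv_smul₀ ha.ne']⟩)
  refine ⟨A, hA, hAc, hAv, _, fun x hx y hy => ⟨(hAd x hx y hy).trans (mul_le_mul_of_nonneg_right (le_max_left _ _) dist_nonneg), by simpa using hlip.dist_le_mul x y⟩⟩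
end
end

section
open MeasureTheory Metric Set Filter Topology
set_option linter.unusedSectionVars false

def BL {Y X : Type*} [PseudoMetricSpace Y] [PseudoMetricSpace X] (f : Y → X) (A : Set Y) (k : ℝ) : Prop :=
  ∀ x ∈ A, ∀ y ∈ A, dist x y ≤ k * dist (f x) (f y) ∧ dist (f x) (f y) ≤ k * dist x y

theorem BL.contOn {Y X : Type*} [PseudoMetricSpace Y] [PseudoMetricSpace X] {f : Y → X} {A : Set Y} {k : ℝ} (h : BL f A k) : ContinuousOn f A :=
  (LipschitzOnWith.of_dist_le_mul (K := k.toNNReal) fun x hx y hy => ((h x hx y hy).2).trans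
    (mul_le_mul_of_nonneg_right (Real.le_coe_toNNReal k) dist_nonneg)).continuousOn

theorem glue {Y X : Type*} [PseudoMetricSpace Y] [PseudoMetricSpace X] {f : Y → X} {A : Set Y} {k N ε ρ ρ' : ℝ} (hBL : BL f A k) {α α' y y' : Y} {v v' : X}
    (hα : α ∈ A) (hα' : α' ∈ A) (hk : 1 ≤ k) (hN : 0 ≤ N) (hε : 0 < ε)
    (h1 : dist y α ≤ N * ρ) (h1' : dist y' α' ≤ N * ρ') (h2 : dist v (f α) ≤ ε * ρ) (h2' : dist v' (f α') ≤ ε * ρ')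
    (h3 : 5 * ε * (ρ + ρ') ≤ dist (f α) (f α')) (h4 : (ρ + ρ') / 4 ≤ dist y y') :
    dist y y' ≤ 2 * (k + N / (5 * ε)) * dist v v' ∧ dist v v' ≤ 2 * k * (1 + 4 * N) * dist y y' := by
  obtain ⟨ha, hb⟩ := hBL α hα α' hα'
  set E := dist (f α) (f α')
  have e1 : N * (ρ + ρ') ≤ N / (5 * ε) * E := by
    rw [div_mul_eq_mul_div, le_div_iff₀ (by positivity)]; nlinarith
  have e2 : dist y y' ≤ (k + N / (5 * ε)) * E := by
    have := dist_triangle4 y α α' y'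
    rw [dist_comm α' y'] at this; linarith
  have e3 : E ≤ 2 * dist v v' := by
    have : E ≤ _ := dist_triangle4 (f α) v v' (f α')
    rw [dist_comm (f α) v] at this; linarith [dist_nonneg (x := v) (y := v')]
  have e4 : dist v v' ≤ 2 * E := by
    have : dist v v' ≤ _ + E + _ := dist_triangle4 v (f α) (f α') v'
    rw [dist_comm (f α') v'] at this
    have : 0 ≤ E := dist_nonneg
    linarith
  have e5 : dist α α' ≤ (1 + 4 * N) * dist y y' := by
    have := dist_triangle4 α y y' α'
    rw [dist_comm α y] at this; nlinarith
  constructor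
  · calc _ ≤ _ := e2
      _ ≤ (k + N / (5 * ε)) * (2 * dist v v') := by gcongr
      _ = _ := by ring
  · calc _ ≤ _ := e4
      _ ≤ 2 * (k * ((1 + 4 * N) * dist y y')) := by
        have := mul_le_mul_of_nonneg_left e5 (by linarith : (0:ℝ) ≤ k); linarith
      _ = _ := by ring

theorem dj_dist {X : Type*} [PseudoMetricSpace X] {a b : X} {r s : ℝ} (hr : 0 < r) (hs : 0 < s) (h : Disjoint (ball a r) (ball b s)) : (r + s) / 2 ≤ dist a b := by
  have h1 : r ≤ dist a b := by
    by_contra! hlt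
    exact disjoint_left.1 h (mem_ball'.2 hlt) (mem_ball_self hs)
  have h2 : s ≤ dist a b := by
    by_contra! hlt
    exact disjoint_left.1 h (mem_ball_self hr) hlt
  linarith

/-- gluing pieces onto `A`. -/
theorem glue_all {Y : Type*} [MetricSpace Y] {d : ℕ} {f : Y → XX d} {A : Set Y} {k k0 N ε : ℝ} (hBL : BL f A k) (hA : IsClosed A) (hk : 1 ≤ k) (hk0 : 1 ≤ k0)
    (hN : 0 ≤ N) (hε : 0 < ε) (hε1 : ε ≤ 1) (u : Finset Y) (a : Y → Y) (ρ : Y → ℝ) (P : Y → Set Y) (h : Y → Y → XX d) (haA : ∀ b ∈ u, a b ∈ A) (hρ : ∀ b ∈ u, 0 < ρ b)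
    (hda : ∀ b ∈ u, dist b (a b) ≤ N * ρ b) (hfar : ∀ b ∈ u, ∀ y ∈ A, ρ b ≤ dist b y) (hPc : ∀ b ∈ u, IsClosed (P b)) (hPn : ∀ b ∈ u, (P b).Nonempty)
    (hPb : ∀ b ∈ u, P b ⊆ closedBall b (ρ b / 4))
    (hPh : ∀ b ∈ u, ∀ x ∈ P b, ∀ y ∈ P b, dist x y ≤ k0 * dist (h b x) (h b y) ∧ dist (h b x) (h b y) ≤ dist x y)
    (hd1 : ∀ b ∈ u, ∀ c ∈ u, b ≠ c → Disjoint (ball b (ρ b)) (ball c (ρ c)))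
    (hd2 : ∀ b ∈ u, ∀ c ∈ u, b ≠ c → Disjoint (ball (f (a b)) (10 * ε * ρ b)) (ball (f (a c)) (10 * ε * ρ c))) :
    ∃ F : Y → XX d, IsClosed ((A ∩ ⋂ b ∈ u, {y | 5 * ε * ρ b ≤ dist (f y) (f (a b))}) ∪ ⋃ b ∈ u, P b) ∧
      BL F ((A ∩ ⋂ b ∈ u, {y | 5 * ε * ρ b ≤ dist (f y) (f (a b))}) ∪ ⋃ b ∈ u, P b) (k + k0 / ε + 2 * (k + (N + 1) / (5 * ε)) + 2 * k * (1 + 4 * (N + 1))) := by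
  classical
  choose! p hp using hPn
  have hPuniq : ∀ b ∈ u, ∀ c ∈ u, ∀ y ∈ P b, y ∈ P c → b = c := fun b hb c hc y hyb hyc => by
    by_contra hne
    have h1 := hPb b hb hyb
    have h2 := hPb c hc hyc
    rw [mem_closedBall] at h1 h2
    exact disjoint_left.1 (hd1 b hb c hc hne) (mem_ball.2 (by linarith [hρ b hb])) (mem_ball.2 (by linarith [hρ c hc]))
  have hPA : ∀ b ∈ u, ∀ y ∈ P b, y ∉ A := fun b hb y hy hyA => by
    have h1 := hPb b hb hy
    rw [mem_closedBall'] at h1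
    linarith [hfar b hb y hyA, hρ b hb]
  let F : Y → XX d := fun y => if hy : ∃ b ∈ u, y ∈ P b then f (a hy.choose) + ε • (h hy.choose y - h hy.choose (p hy.choose)) else f y
  have hF1 : ∀ b ∈ u, ∀ y ∈ P b, F y = f (a b) + ε • (h b y - h b (p b)) := fun b hb y hy => by
    have hex : ∃ b ∈ u, y ∈ P b := ⟨b, hb, hy⟩
    have : hex.choose = b := hPuniq _ hex.choose_spec.1 b hb y hex.choose_spec.2 hy
    simp only [F, dif_pos hex]
    rw [this]
  have hF2 : ∀ y ∈ A, F y = f y := fun y hy => dif_neg fun ⟨b, hb, hyb⟩ => hPA b hb y hyb hy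
  have hF3 : ∀ b ∈ u, ∀ y ∈ P b, dist (F y) (f (a b)) ≤ ε * ρ b := fun b hb y hy => by
    rw [hF1 b hb y hy, dist_eq_norm, add_sub_cancel_left, norm_smul, Real.norm_of_nonneg hε.le, ← dist_eq_norm]
    have h1 := hPb b hb hy
    have h2 := hPb b hb (hp b hb)
    rw [mem_closedBall] at h1 h2
    gcongr
    linarith [(hPh b hb y hy _ (hp b hb)).2, dist_triangle_right y (p b) b, hρ b hb]
  have hdP : ∀ b ∈ u, ∀ y ∈ P b, dist y (a b) ≤ (N + 1) * ρ b := fun b hb y hy => by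
    have h1 := hPb b hb hy
    rw [mem_closedBall] at h1
    linarith [dist_triangle y b (a b), hda b hb, hρ b hb]
  set k' := k + k0 / ε + 2 * (k + (N + 1) / (5 * ε)) + 2 * k * (1 + 4 * (N + 1)) with hk'
  have q1 : 0 ≤ k0 / ε := by positivity
  have q2 : 0 ≤ 2 * (k + (N + 1) / (5 * ε)) := by positivity
  have q3 : 0 ≤ 2 * k * (1 + 4 * (N + 1)) := by positivity
  have up : ∀ {s e1 e2 : ℝ}, s ≤ k' → 0 ≤ e2 → e1 ≤ s * e2 → e1 ≤ k' * e2 := fun h1 h2 h3 => h3.trans (mul_le_mul_of_nonneg_right h1 h2)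
  let Pr : Y → Y → Prop := fun x y => dist x y ≤ k' * dist (F x) (F y) ∧ dist (F x) (F y) ≤ k' * dist x y
  have hsymm : ∀ x y, Pr x y → Pr y x := fun x y h => by simpa only [Pr, dist_comm x y, dist_comm (F x) (F y)] using h
  have c1 : ∀ x ∈ A, ∀ y ∈ A, Pr x y := fun x hx y hy => by
    simp only [Pr]
    rw [hF2 x hx, hF2 y hy]
    obtain ⟨h1, h2⟩ := hBL x hx y hy
    exact ⟨up (by linarith) dist_nonneg h1, up (by linarith) dist_nonneg h2⟩
  have c2 : ∀ b ∈ u, ∀ x ∈ P b, ∀ y ∈ P b, Pr x y := fun b hb x hx y hy => by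
    have he : dist (F x) (F y) = ε * dist (h b x) (h b y) := by
      rw [hF1 b hb x hx, hF1 b hb y hy, dist_add_left, dist_smul₀, Real.norm_of_nonneg hε.le, dist_sub_right]
    obtain ⟨h1, h2⟩ := hPh b hb x hx y hy
    constructor
    · refine up (s := k0 / ε) (by linarith) dist_nonneg ?_
      rw [he]
      calc _ ≤ _ := h1
        _ = _ := by field_simp
    · refine up (s := 1) (by linarith) dist_nonneg ?_
      rw [he]
      exact mul_le_mul hε1 h2 dist_nonneg zero_le_one
  have c3 : ∀ b ∈ u, ∀ c ∈ u, b ≠ c → ∀ x ∈ P b, ∀ y ∈ P c, Pr x y := fun b hb c hc hne x hx y hy => by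
    have p1 := hρ b hb
    have p2 := hρ c hc
    have h1 := dj_dist p1 p2 (hd1 b hb c hc hne)
    have h2 := dj_dist (by positivity) (by positivity) (hd2 b hb c hc hne)
    have h3 := hPb b hb hx
    have h4 := hPb c hc hy
    rw [mem_closedBall] at h3 h4
    obtain ⟨e1, e2⟩ := glue hBL (haA b hb) (haA c hc) hk (by linarith : 0 ≤ N + 1) hε (hdP b hb x hx) (hdP c hc y hy) (hF3 b hb x hx) (hF3 c hc y hy)
      (by linarith) (by linarith [dist_triangle4 b x y c, dist_comm b x])
    exact ⟨up (by linarith) dist_nonneg e1, up (by linarith) dist_nonneg e2⟩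
  have c4 : ∀ b ∈ u, ∀ x ∈ P b, ∀ y ∈ A, 5 * ε * ρ b ≤ dist (f y) (f (a b)) → Pr x y := fun b hb x hx y hy hyb => by
    have p1 := hρ b hb
    have h3 := hPb b hb hx
    rw [mem_closedBall] at h3
    obtain ⟨e1, e2⟩ := glue (α' := y) (y' := y) (v' := F y) (ρ' := 0) hBL (haA b hb) hy hk (by linarith : 0 ≤ N + 1) hε (hdP b hb x hx) (by simp) (hF3 b hb x hx) (by rw [hF2 y hy]; simp)
      (by rw [dist_comm]; linarith) (by linarith [dist_triangle b x y, dist_comm b x, hfar b hb y hy])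
    exact ⟨up (by linarith) dist_nonneg e1, up (by linarith) dist_nonneg e2⟩
  refine ⟨F, ?_, ?_⟩
  · refine IsClosed.union ?_ (u.finite_toSet.isClosed_biUnion hPc)
    have : A ∩ ⋂ b ∈ u, {y | 5 * ε * ρ b ≤ dist (f y) (f (a b))} = A ∩ f ⁻¹' (⋂ b ∈ u, {w | 5 * ε * ρ b ≤ dist w (f (a b))}) := by
      ext y; simp
    rw [this]
    exact hBL.contOn.preimage_isClosed_of_isClosed hA (isClosed_biInter fun b _ => isClosed_le continuous_const (by fun_prop))
  · have dec : ∀ x ∈ (A ∩ ⋂ b ∈ u, {y | 5 * ε * ρ b ≤ dist (f y) (f (a b))}) ∪ ⋃ b ∈ u, P b,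
        (x ∈ A ∧ ∀ b ∈ u, 5 * ε * ρ b ≤ dist (f x) (f (a b))) ∨ ∃ b ∈ u, x ∈ P b := fun x hx => by simpa using hx
    intro x hx y hy
    rcases dec x hx with ⟨h1, h2⟩ | ⟨b, hb, h1⟩ <;> rcases dec y hy with ⟨h3, h4⟩ | ⟨c, hc, h3⟩
    · exact c1 x h1 y h3
    · exact hsymm _ _ (c4 c hc y h3 x h1 (h2 c hc))
    · exact c4 b hb x h1 y h3 (h4 b hb)
    · by_cases hbc : b = c
      · subst hbc; exact c2 b hb x h1 y h3
      · exact c3 b hb c hc hbc x h1 y h3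
end

section
open MeasureTheory Metric Set Filter Topology
set_option linter.unusedSectionVars false

section
variable {Y : Type*} [MetricSpace Y] [CompactSpace Y] [MeasurableSpace Y] [BorelSpace Y] {ν : Measure Y} [IsFiniteMeasure ν] {d : ℕ} {C D θ k0 R1 : ℝ}

theorem up_step (hd : 1 ≤ d) (hR : AReg ν d C D) (hθ : 0 < θ) (hk0 : 1 ≤ k0) (hR1 : 0 < R1) (hBP : ∀ x0 : Y, ∀ R, 0 < R → R ≤ R1 →
    ∃ A ⊆ closedBall x0 R, IsClosed A ∧ θ * R ^ d ≤ ν.real A ∧ ∃ f : Y → XX d, ∀ x ∈ A, ∀ y ∈ A, dist x y ≤ k0 * dist (f x) (f y) ∧ dist (f x) (f y) ≤ dist x y)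
    {σ B : ℝ} (hσ : 0 < σ) (hB : 0 < B) : ∃ γ > 0, ∀ k ≥ 1, ∃ k' ≥ 1, ∀ (x : Y) (r : ℝ), 0 < r → r ≤ B → ∀ (A : Set Y) (f : Y → XX d), IsClosed A → BL f A k →
      (A ∩ ball x r).Nonempty → σ * r ^ d ≤ ν.real (ball x (r / 2) \ A) →
      ∃ (A' : Set Y) (f' : Y → XX d), IsClosed A' ∧ BL f' A' k' ∧ ν.real (ball x r \ A') ≤ ν.real (ball x r \ A) - γ * r ^ d := by
  classical
  have hC := hR.Cpos
  set κ := min 1 (R1 / B) with hκ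
  have hκ0 : 0 < κ := by positivity
  have hκ1 : κ ≤ 1 := min_le_left _ _
  set N := 150 / κ with hN
  have hN0 : 0 < N := by positivity
  refine ⟨θ / (2 * 4 ^ d) * (σ / 2 / (C * (3 * N + 3) ^ d)), by positivity, fun k hk => ?_⟩
  set ε := min (1 / (30 * k)) (θ / (10 * C * k * 4 ^ d)) with hε
  have hk' : 0 < k := by linarith
  have hε0 : 0 < ε := by positivity
  have hε1 : ε * (30 * k) ≤ 1 := by rw [← le_div_iff₀ (by positivity)]; exact min_le_left _ _
  have hε2 : ε * (10 * C * k * 4 ^ d) ≤ θ := by rw [← le_div_iff₀ (by positivity)]; exact min_le_right _ _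
  have hε3 : ε ≤ 1 := by nlinarith
  refine ⟨k + k0 / ε + 2 * (k + (N + 1) / (5 * ε)) + 2 * k * (1 + 4 * (N + 1)), ?_, fun x r hr hrB A f hA hBL hAne hσA => ?_⟩
  · have : 0 ≤ k0 / ε + 2 * (k + (N + 1) / (5 * ε)) + 2 * k * (1 + 4 * (N + 1)) := by positivity
    show 1 ≤ _
    linarith
  have hWo : IsOpen (ball x (r / 2) \ A) := isOpen_ball.sdiff hA
  obtain ⟨K, hKW, hK, hKv⟩ := hWo.exists_lt_isCompact (μ := ν) (r := ENNReal.ofReal (σ / 2 * r ^ d)) (by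
    rw [← ofReal_measureReal]
    refine (ENNReal.ofReal_lt_ofReal_iff (lt_of_lt_of_le (by positivity) hσA)).2 (lt_of_lt_of_le ?_ hσA)
    have : 0 < σ * r ^ d := by positivity
    linarith)
  rw [← ofReal_measureReal, ENNReal.ofReal_lt_ofReal_iff_of_nonneg (by positivity)] at hKv
  obtain ⟨a0, ha0, ha0x⟩ := hAne
  choose a haA had using fun y => hA.exists_infDist_eq_dist ⟨a0, ha0⟩ y
  set ρ : Y → ℝ := fun y => min (infDist y A) (κ * r) / 100 with hρ
  have hρ0 : ∀ y ∈ K, 0 < ρ y := fun y hy => by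
    have := (hA.notMem_iff_infDist_pos ⟨a0, ha0⟩).1 (hKW hy).2
    positivity
  have hρ1 : ∀ y, ρ y ≤ infDist y A / 100 := fun y => by simp only [hρ]; gcongr; exact min_le_left _ _
  have hρ2 : ∀ y, ρ y ≤ κ * r / 100 := fun y => by simp only [hρ]; gcongr; exact min_le_right _ _
  have hρ3 : ∀ y ∈ K, dist y (a y) ≤ N * ρ y := fun y hy => by
    rw [← had, hN, div_mul_eq_mul_div, le_div_iff₀ hκ0]
    simp only [hρ]
    rcases le_total (infDist y A) (κ * r) with h | h
    · rw [min_eq_left h]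
      nlinarith [infDist_nonneg (x := y) (s := A)]
    · rw [min_eq_right h]
      have h1 := infDist_le_dist_of_mem (x := y) ha0
      have h2 := (hKW hy).1
      rw [mem_ball] at h2 ha0x
      nlinarith [dist_triangle_right y a0 x]
  obtain ⟨t, htK, htc⟩ := hK.elim_nhds_subcover (fun y => ball y (ρ y)) (fun y hy => ball_mem_nhds _ (hρ0 y hy))
  obtain ⟨u, hut, hud, huc⟩ := Vitali.exists_disjoint_subfamily_covering_enlargement
    (fun y => (Sum.inl '' ball y (ρ y) ∪ Sum.inr '' ball (f (a y)) (10 * ε * ρ y) : Set (Y ⊕ XX d))) ↑t ρ 2 one_lt_two (fun y hy => (hρ0 y (htK y hy)).le)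
    (κ * r / 100) (fun y _ => hρ2 y) (fun y hy => ⟨Sum.inl y, Or.inl ⟨y, mem_ball_self (hρ0 y (htK y hy)), rfl⟩⟩)
  lift u to Finset Y using t.finite_toSet.subset hut
  have huK : ∀ b ∈ u, b ∈ K := fun b hb => htK b (hut hb)
  have hcov : K ⊆ ⋃ b ∈ u, ball b ((3 * N + 3) * ρ b) := fun y hy => by
    obtain ⟨q, hq, hyq⟩ := mem_iUnion₂.1 (htc hy)
    obtain ⟨b, hb, hqb, hle⟩ := huc q hq
    have pq := hρ0 q (htK q hq)
    have pb := hρ0 b (huK b hb)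
    refine mem_iUnion₂.2 ⟨b, hb, mem_ball.2 ?_⟩
    rw [mem_ball] at hyq
    have key : dist q b ≤ (3 * N + 1) * ρ b ∨ dist q b ≤ 3 * ρ b := by
      obtain ⟨w, hw1, hw2⟩ := hqb
      rcases hw1 with ⟨w1, h1, rfl⟩ | ⟨w1, h1, rfl⟩
      · rcases hw2 with ⟨w2, h2, he⟩ | ⟨w2, h2, he⟩
        · cases he
          rw [mem_ball] at h1 h2
          right; linarith [dist_triangle_left q b w1]
        · cases he
      · rcases hw2 with ⟨w2, h2, he⟩ | ⟨w2, h2, he⟩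
        · cases he
        · cases he
          rw [mem_ball] at h1 h2
          left
          have h3 : dist (f (a q)) (f (a b)) ≤ 10 * ε * (3 * ρ b) := by nlinarith [dist_triangle_left (f (a q)) (f (a b)) w1]
          have h4 := (hBL _ (haA q) _ (haA b)).1
          have h5 : dist (a q) (a b) ≤ ρ b := by
            calc _ ≤ _ := h4
              _ ≤ k * (10 * ε * (3 * ρ b)) := by gcongr
              _ = ε * (30 * k) * ρ b := by ring
              _ ≤ 1 * ρ b := by gcongr
              _ = _ := one_mul _
          have h6 := hρ3 q (htK q hq)
          have h7 := hρ3 b (huK b hb)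
          have h8 : N * ρ q ≤ N * (2 * ρ b) := by gcongr
          rw [dist_comm] at h7
          linarith [dist_triangle4 q (a q) (a b) b]
    have hNp : 1 * ρ b ≤ N * ρ b := by gcongr; rw [hN, le_div_iff₀ hκ0]; linarith
    rcases key with h | h <;> nlinarith [dist_triangle y q b]
  have hsum : σ / 2 * r ^ d ≤ C * (3 * N + 3) ^ d * ∑ b ∈ u, ρ b ^ d := by
    calc _ ≤ _ := hKv.le
      _ ≤ ν.real (⋃ b ∈ u, ball b ((3 * N + 3) * ρ b)) := measureReal_mono hcov (measure_ne_top _ _)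
      _ ≤ ∑ b ∈ u, ν.real (ball b ((3 * N + 3) * ρ b)) := measureReal_biUnion_finset_le _ _
      _ ≤ ∑ b ∈ u, C * (3 * N + 3) ^ d * ρ b ^ d := Finset.sum_le_sum fun b hb => by
        rw [mul_assoc, ← mul_pow]
        exact hR.upper _ _ (by have := hρ0 b (huK b hb); positivity)
      _ = _ := by rw [Finset.mul_sum]
  have hbp : ∀ b ∈ u, ∃ P ⊆ closedBall b (ρ b / 4), IsClosed P ∧ θ * (ρ b / 4) ^ d ≤ ν.real P ∧ ∃ f : Y → XX d, ∀ x ∈ P, ∀ y ∈ P,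
      dist x y ≤ k0 * dist (f x) (f y) ∧ dist (f x) (f y) ≤ dist x y := fun b hb => hBP b _ (by have := hρ0 b (huK b hb); positivity) (by
    have h1 : κ * r ≤ R1 / B * B := mul_le_mul (min_le_right _ _) hrB hr.le (by positivity)
    rw [div_mul_cancel₀ _ hB.ne'] at h1
    linarith [hρ2 b])
  have hYne : Nonempty Y := ⟨x⟩
  choose! P hPb hPc hPv h hh using hbp
  have hd1 : ∀ b ∈ u, ∀ c ∈ u, b ≠ c → Disjoint (ball b (ρ b)) (ball c (ρ c)) := fun b hb c hc hne => by
    refine disjoint_left.2 fun w h1 h2 => ?_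
    exact disjoint_left.1 (hud hb hc hne) (Or.inl ⟨w, h1, rfl⟩) (Or.inl ⟨w, h2, rfl⟩)
  have hd2 : ∀ b ∈ u, ∀ c ∈ u, b ≠ c → Disjoint (ball (f (a b)) (10 * ε * ρ b)) (ball (f (a c)) (10 * ε * ρ c)) := fun b hb c hc hne => by
    refine disjoint_left.2 fun w h1 h2 => ?_
    exact disjoint_left.1 (hud hb hc hne) (Or.inr ⟨w, h1, rfl⟩) (Or.inr ⟨w, h2, rfl⟩)
  have hfar : ∀ b ∈ u, ∀ y ∈ A, ρ b ≤ dist b y := fun b hb y hy => by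
    linarith [infDist_le_dist_of_mem (x := b) hy, hρ1 b, infDist_nonneg (x := b) (s := A)]
  obtain ⟨F, hFc, hFB⟩ := glue_all hBL hA hk hk0 hN0.le hε0 hε3 u a ρ P h (fun b _ => haA b) (fun b hb => hρ0 b (huK b hb)) (fun b hb => hρ3 b (huK b hb)) hfar hPc
    (fun b hb => by
      rw [nonempty_iff_ne_empty]
      intro he
      have h1 := hPv b hb
      have h2 := hρ0 b (huK b hb)
      rw [he, measureReal_empty] at h1
      have : 0 < θ * (ρ b / 4) ^ d := by positivity
      linarith) hPb hh hd1 hd2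
  refine ⟨_, F, hFc, hFB, ?_⟩
  have m1 : ν.real (⋃ b ∈ u, P b) = ∑ b ∈ u, ν.real (P b) := measureReal_biUnion_finset (fun b hb c hc hne =>
    (hd1 b hb c hc hne).mono ((hPb b hb).trans (closedBall_subset_ball (by linarith [hρ0 b (huK b hb)])))
      ((hPb c hc).trans (closedBall_subset_ball (by linarith [hρ0 c (huK c hc)])))) (fun b hb => (hPc b hb).measurableSet)
  have m2 : (⋃ b ∈ u, P b) ⊆ ball x r \ A := iUnion₂_subset fun b hb y hy => by
    have h1 := hPb b hb hy
    rw [mem_closedBall] at h1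
    have h2 := (hKW (huK b hb)).1
    rw [mem_ball] at h2
    have h3 := hρ0 b (huK b hb)
    refine ⟨mem_ball.2 ?_, fun hyA => ?_⟩
    · nlinarith [dist_triangle y b x, hρ2 b]
    · have := hfar b hb y hyA
      rw [dist_comm] at this
      linarith
  have m3 : ν.real ((ball x r \ A) \ ⋃ b ∈ u, P b) = ν.real (ball x r \ A) - ∑ b ∈ u, ν.real (P b) := by
    rw [measureReal_sdiff m2 (MeasurableSet.biUnion u.countable_toSet fun b hb => (hPc b hb).measurableSet), m1]
  have m4 : ∀ b ∈ u, ν.real (A ∩ {y | dist (f y) (f (a b)) < 5 * ε * ρ b}) ≤ θ / (2 * 4 ^ d) * ρ b ^ d := fun b hb => by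
    have p := hρ0 b (huK b hb)
    calc _ ≤ ν.real (ball (a b) (5 * k * ε * ρ b)) := measureReal_mono fun y hy => mem_ball.2 (by
          have h1 := (hBL y hy.1 _ (haA b)).1
          have h2 : k * dist (f y) (f (a b)) < k * (5 * ε * ρ b) := mul_lt_mul_of_pos_left hy.2 hk'
          linarith)
      _ ≤ C * (5 * k * ε * ρ b) ^ d := hR.upper _ _ (by positivity)
      _ = C * (5 * k * ε) ^ d * ρ b ^ d := by rw [mul_pow (5 * k * ε)]; ring
      _ ≤ C * (5 * k * ε) * ρ b ^ d := by
        gcongr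
        exact pow_le_of_le_one (by positivity) (by linarith) (by omega)
      _ ≤ _ := by
        gcongr
        rw [le_div_iff₀ (by positivity)]; linarith
  have m5 : ball x r \ ((A ∩ ⋂ b ∈ u, {y | 5 * ε * ρ b ≤ dist (f y) (f (a b))}) ∪ ⋃ b ∈ u, P b) ⊆
      ((ball x r \ A) \ ⋃ b ∈ u, P b) ∪ ⋃ b ∈ u, (A ∩ {y | dist (f y) (f (a b)) < 5 * ε * ρ b}) := fun y hy => by
    have h2 : y ∉ ⋃ b ∈ u, P b := fun h => hy.2 (Or.inr h)
    by_cases hyA : y ∈ A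
    · right
      by_contra hcon
      refine hy.2 (Or.inl ⟨hyA, mem_iInter₂.2 fun b hb => ?_⟩)
      by_contra hlt
      exact hcon (mem_iUnion₂.2 ⟨b, hb, hyA, show dist (f y) (f (a b)) < 5 * ε * ρ b from not_le.1 hlt⟩)
    · exact Or.inl ⟨⟨hy.1, hyA⟩, h2⟩
  have m6 : ∑ b ∈ u, θ / (2 * 4 ^ d) * ρ b ^ d + ∑ b ∈ u, θ / (2 * 4 ^ d) * ρ b ^ d ≤ ∑ b ∈ u, ν.real (P b) := by
    rw [← Finset.sum_add_distrib]
    refine Finset.sum_le_sum fun b hb => le_trans (le_of_eq ?_) (hPv b hb)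
    rw [div_pow (ρ b) 4]; generalize (4:ℝ) ^ d = q; ring
  have m7 : θ / (2 * 4 ^ d) * (σ / 2 / (C * (3 * N + 3) ^ d)) * r ^ d ≤ ∑ b ∈ u, θ / (2 * 4 ^ d) * ρ b ^ d := by
    rw [← Finset.mul_sum, mul_assoc]
    gcongr
    rw [div_mul_eq_mul_div, div_le_iff₀ (by positivity)]
    linarith
  have m8 := (measureReal_mono (μ := ν) m5 (measure_ne_top _ _)).trans (measureReal_union_le _ _)
  have m9 := (measureReal_biUnion_finset_le (μ := ν) u (fun b => A ∩ {y | dist (f y) (f (a b)) < 5 * ε * ρ b})).trans (Finset.sum_le_sum m4)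
  linarith

theorem upgrade (hd : 1 ≤ d) (hR : AReg ν d C D) (hθ : 0 < θ) (hk0 : 1 ≤ k0) (hR1 : 0 < R1) (hBP : ∀ x0 : Y, ∀ R, 0 < R → R ≤ R1 →
    ∃ A ⊆ closedBall x0 R, IsClosed A ∧ θ * R ^ d ≤ ν.real A ∧ ∃ f : Y → XX d, ∀ x ∈ A, ∀ y ∈ A, dist x y ≤ k0 * dist (f x) (f y) ∧ dist (f x) (f y) ≤ dist x y)
    {σ B : ℝ} (hσ : 0 < σ) (hB : 0 < B) : ∃ k ≥ 1, ∀ (x : Y) (r : ℝ), 0 < r → r ≤ B → ∃ (A : Set Y) (f : Y → XX d), IsClosed A ∧ BL f A k ∧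
      ν.real (ball x (r / 2) \ A) ≤ σ * r ^ d := by
  obtain ⟨γ, hγ, hst⟩ := up_step hd hR hθ hk0 hR1 hBP hσ hB
  have claim : ∀ n : ℕ, ∃ k ≥ 1, ∀ (x : Y) (r : ℝ), 0 < r → r ≤ B → ∃ (A : Set Y) (f : Y → XX d), IsClosed A ∧ BL f A k ∧
      (ν.real (ball x (r / 2) \ A) ≤ σ * r ^ d ∨ ν.real (ball x r \ A) ≤ (C - n * γ) * r ^ d) := by
    intro n
    induction n with
    | zero =>
      refine ⟨1, le_rfl, fun x r hr _ => ⟨{x}, fun _ => 0, isClosed_singleton, ?_, Or.inr ?_⟩⟩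
      · rintro _ rfl _ rfl; simp
      · simp only [Nat.cast_zero, zero_mul, sub_zero]
        exact (measureReal_mono sdiff_subset).trans (hR.upper x r hr)
    | succ n ih =>
      obtain ⟨k, hk, h⟩ := ih
      obtain ⟨k', hk', hs⟩ := hst k hk
      refine ⟨max k k', hk.trans (le_max_left _ _), fun x r hr hrB => ?_⟩
      have mono : ∀ {A : Set Y} {f : Y → XX d} {s}, s ≤ max k k' → BL f A s → BL f A (max k k') := fun hs h x hx y hy =>
        ⟨(h x hx y hy).1.trans (by gcongr), (h x hx y hy).2.trans (by gcongr)⟩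
      have red : ∃ (A : Set Y) (f : Y → XX d), IsClosed A ∧ BL f A k ∧ (A ∩ ball x r).Nonempty ∧
          (ν.real (ball x (r / 2) \ A) ≤ σ * r ^ d ∨ ν.real (ball x r \ A) ≤ (C - n * γ) * r ^ d) := by
        obtain ⟨A, f, hA, hBL, hor⟩ := h x r hr hrB
        by_cases hne : (A ∩ ball x r).Nonempty
        · exact ⟨A, f, hA, hBL, hne, hor⟩
        · have h1 : ball x r \ A = ball x r := by
            ext y; exact ⟨fun h => h.1, fun h => ⟨h, fun hy => hne ⟨y, hy, h⟩⟩⟩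
          have h2 : ball x (r / 2) \ A = ball x (r / 2) := by
            ext y; exact ⟨fun h => h.1, fun h => ⟨h, fun hy => hne ⟨y, hy, ball_subset_ball (by linarith) h⟩⟩⟩
          rw [h1, h2] at hor
          refine ⟨{x}, fun _ => 0, isClosed_singleton, ?_, ⟨x, rfl, mem_ball_self hr⟩, hor.imp (measureReal_mono sdiff_subset).trans (measureReal_mono sdiff_subset).trans⟩
          rintro _ rfl _ rfl; simp
      obtain ⟨A, f, hA, hBL, hne, hor⟩ := red
      rcases le_or_gt (ν.real (ball x (r / 2) \ A)) (σ * r ^ d) with h1 | h1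
      · exact ⟨A, f, hA, mono (le_max_left _ _) hBL, Or.inl h1⟩
      · obtain ⟨A', f', hA', hBL', hv⟩ := hs x r hr hrB A f hA hBL hne h1.le
        refine ⟨A', f', hA', mono (le_max_right _ _) hBL', Or.inr ?_⟩
        have := hor.resolve_left (not_le.2 h1)
        push_cast
        linarith
  obtain ⟨n, hn⟩ := exists_nat_gt (C / γ)
  rw [div_lt_iff₀ hγ] at hn
  obtain ⟨k, hk, h⟩ := claim n
  refine ⟨k, hk, fun x r hr hrB => ?_⟩
  obtain ⟨A, f, hA, hBL, hor⟩ := h x r hr hrB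
  refine ⟨A, f, hA, hBL, hor.elim id fun h => ?_⟩
  have h1 : (C - n * γ) * r ^ d < 0 := mul_neg_of_neg_of_pos (by linarith) (by positivity)
  linarith [measureReal_nonneg (μ := ν) (s := ball x r \ A)]
end
end

section
open MeasureTheory Metric Set Filter Topology
set_option linter.unusedSectionVars false

theorem mainY {Y : Type*} [MetricSpace Y] [CompactSpace Y] [MeasurableSpace Y] [BorelSpace Y] {ν : Measure Y} [IsFiniteMeasure ν] {d : ℕ} {C D : ℝ}
    (hd : 1 ≤ d) (hR : AReg ν d C D) {L r0 : ℝ} (hL : 1 ≤ L) (hr0 : 0 < r0) (hY : LLC Y L r0) (hch : ∀ x : Y, ∃ e : OpenPartialHomeomorph Y (XX d), x ∈ e.source) :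
    ∃ k ≥ 1, ∀ (x : Y) (r : ℝ), 0 < r → r ≤ D → ∃ (A : Set Y) (f : Y → XX d), IsClosed A ∧ A ⊆ closedBall x r ∧ BL f A k ∧ 9 / 10 * ν.real (closedBall x r) ≤ ν.real A := by
  have hC := hR.Cpos
  have hD := hR.Dpos
  have := loc_conn hch
  obtain ⟨Λ, hΛ, c, hc, R0, hR0, hess⟩ := C_ess hd hR hL hr0 hY hch (fun f ⟨K, hf⟩ => ff_ae hR hf)
  obtain ⟨θ, hθ, k0, hk0, R1, hR1, hbp⟩ := BP hR hΛ hc hR0 hess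
  obtain ⟨k, hk, h⟩ := upgrade hd hR hθ hk0 hR1 hbp (σ := C⁻¹ / (10 * 4 ^ d)) (B := 4 * D) (by positivity) (by positivity)
  refine ⟨k, hk, fun x r hr hrD => ?_⟩
  obtain ⟨A, f, hA, hBL, hv⟩ := h x (4 * r) (by linarith) (by linarith)
  refine ⟨A ∩ closedBall x r, f, hA.inter isClosed_closedBall, inter_subset_right, fun y hy z hz => hBL y hy.1 z hz.1, ?_⟩
  have h1 : ν.real (closedBall x r) ≤ ν.real (A ∩ closedBall x r) + ν.real (ball x (4 * r / 2) \ A) := by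
    refine (measureReal_mono (fun y hy => ?_) (measure_ne_top _ _)).trans (measureReal_union_le _ _)
    by_cases hyA : y ∈ A
    · exact Or.inl ⟨hyA, hy⟩
    · exact Or.inr ⟨closedBall_subset_ball (by linarith) hy, hyA⟩
  have h2 : C⁻¹ / (10 * 4 ^ d) * (4 * r) ^ d = C⁻¹ * r ^ d / 10 := by
    rw [mul_pow]; field_simp
  have h3 := (hR.lower x r hr hrD).trans (measureReal_mono ball_subset_closedBall (measure_ne_top _ _))
  rw [h2] at hv
  linarith

theorem mk_chart {X : Type*} [TopologicalSpace X] {d : ℕ} (x : X) {V : Set X} (hV : IsOpen V) (hx : x ∈ V) {W : Set (EuclideanSpace ℝ (Fin d))} (hW : IsOpen W)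
    (h : V ≃ₜ W) : ∃ e : OpenPartialHomeomorph X (XX d), x ∈ e.source := by
  have : Nonempty V := ⟨⟨x, hx⟩⟩
  have h1 : IsOpenEmbedding ((↑) : V → X) := hV.isOpenEmbedding_subtypeVal
  have h2 : IsOpenEmbedding (fun v : V => EuclideanSpace.equiv (Fin d) ℝ (h v : EuclideanSpace ℝ (Fin d))) :=
    ((EuclideanSpace.equiv (Fin d) ℝ).toHomeomorph.isOpenEmbedding.comp hW.isOpenEmbedding_subtypeVal).comp h.isOpenEmbedding
  refine ⟨(h1.toOpenPartialHomeomorph).symm.trans (h2.toOpenPartialHomeomorph), ?_⟩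
  simp [OpenPartialHomeomorph.trans_source, hx]

theorem mk_llc {X : Type*} [MetricSpace X] {E : Set X} {L r0 : ℝ}
    (h : ∀ x ∈ E, ∀ r : ℝ, 0 < r → r ≤ r0 → ∀ (hsub : E ∩ ball x r ⊆ E ∩ ball x (L * r)), ∃ c : ↥(E ∩ ball x (L * r)),
          ContinuousMap.Homotopic (⟨Set.inclusion hsub, continuous_inclusion hsub⟩ : C(↥(E ∩ ball x r), ↥(E ∩ ball x (L * r)))) (ContinuousMap.const _ c))
    (hL : 1 ≤ L) : LLC E L r0 := by
  classical
  intro x r hr hr0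
  have hsub : E ∩ ball (x : X) r ⊆ E ∩ ball (x : X) (L * r) := inter_subset_inter_right _ (ball_subset_ball (by nlinarith))
  obtain ⟨c, ⟨F⟩⟩ := h x x.2 r hr hr0 hsub
  let H : ℝ → E → E := fun t y => if h : t ∈ Icc (0:ℝ) 1 ∧ y ∈ ball x r then ⟨(F (⟨t, h.1⟩, ⟨y, y.2, h.2⟩) : X), (F (⟨t, h.1⟩, ⟨y, y.2, h.2⟩)).2.1⟩ else y
  have hH : ∀ t (ht : t ∈ Icc (0:ℝ) 1) (y : E) (hy : y ∈ ball x r), H t y = ⟨(F (⟨t, ht⟩, ⟨y, y.2, hy⟩) : X), (F (⟨t, ht⟩, ⟨y, y.2, hy⟩)).2.1⟩ := fun t ht y hy => dif_pos ⟨ht, hy⟩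
  refine ⟨H, ⟨c, c.2.1⟩, ?_, fun y hy => ⟨?_, ?_⟩, fun t ht y hy => ?_⟩
  · rw [continuousOn_iff_continuous_domRestrict]
    have he : (Icc (0:ℝ) 1 ×ˢ ball x r).domRestrict (fun p => H p.1 p.2) = fun p => (⟨(F (⟨p.1.1, p.2.1⟩, ⟨p.1.2, p.1.2.2, p.2.2⟩) : X), (F (⟨p.1.1, p.2.1⟩, ⟨p.1.2, p.1.2.2, p.2.2⟩)).2.1⟩ : E) := by
      funext p; exact hH _ p.2.1 _ p.2.2
    rw [he]
    refine Continuous.subtype_mk (continuous_subtype_val.comp (F.continuous.comp (Continuous.prodMk ?_ ?_))) _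
    · exact Continuous.subtype_mk (by fun_prop) _
    · exact Continuous.subtype_mk (by fun_prop) _
  · rw [hH 0 (by simp) y hy]
    have hq := congrArg Subtype.val (F.apply_zero ⟨y, y.2, hy⟩)
    exact Subtype.ext hq
  · rw [hH 1 (by simp) y hy]
    have hq := congrArg Subtype.val (F.apply_one ⟨y, y.2, hy⟩)
    exact Subtype.ext hq
  · rw [hH t ht y hy]
    exact (F (⟨t, ht⟩, ⟨y, y.2, hy⟩)).2.2
end

open MeasureTheory Metric

/-- Ahlfors-regular sets in `ℝⁿ` which are `d`-dimensional topological manifolds and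
locally linearly contractible are uniformly rectifiable. -/
theorem stmt_0 (n d : ℕ) (hd1 : 1 ≤ d) (hdn : d < n)
    (E : Set (EuclideanSpace ℝ (Fin n))) (hEclosed : IsClosed E)
    (μ : Measure (EuclideanSpace ℝ (Fin n))) (hμsupp : μ Eᶜ = 0)
    (C : ℝ) (hC : 0 < C)
    (hreg : ∀ x ∈ E, ∀ r : ℝ, 0 < r → r ≤ diam E →
      ENNReal.ofReal (C⁻¹ * r ^ d) ≤ μ (ball x r) ∧
      μ (ball x r) ≤ ENNReal.ofReal (C * r ^ d))
    (hman : ∀ x : E, ∃ V : Set E, IsOpen V ∧ x ∈ V ∧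
      ∃ W : Set (EuclideanSpace ℝ (Fin d)), IsOpen W ∧ Nonempty (↥V ≃ₜ ↥W))
    (L₁ : ℝ) (hL₁ : 1 ≤ L₁)
    (hllc : ∀ x ∈ E, ∀ r : ℝ, 0 < r → r ≤ L₁⁻¹ * diam E →
      ∀ (hsub : E ∩ ball x r ⊆ E ∩ ball x (L₁ * r)),
        ∃ c : ↥(E ∩ ball x (L₁ * r)),
          ContinuousMap.Homotopic
            (⟨Set.inclusion hsub, continuous_inclusion hsub⟩ :
              C(↥(E ∩ ball x r), ↥(E ∩ ball x (L₁ * r))))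
            (ContinuousMap.const _ c)) :
    ∃ k : ℝ, 1 ≤ k ∧ ∀ x ∈ E, ∀ r : ℝ, 0 < r → r ≤ diam E →
      ∃ A : Set (EuclideanSpace ℝ (Fin n)), IsClosed A ∧
        A ⊆ E ∩ closedBall x r ∧
        (9 / 10 : ENNReal) * μ (E ∩ closedBall x r) ≤ μ A ∧
        ∃ f : ↥A → EuclideanSpace ℝ (Fin d),
          ∀ y z : ↥A,
            k⁻¹ * dist (y : EuclideanSpace ℝ (Fin n)) (z : EuclideanSpace ℝ (Fin n)) ≤
                dist (f y) (f z) ∧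
            dist (f y) (f z) ≤
              k * dist (y : EuclideanSpace ℝ (Fin n)) (z : EuclideanSpace ℝ (Fin n)) := by
  classical
  rcases le_or_gt (diam E) 0 with hdiam | hdiam
  · exact ⟨1, le_rfl, fun x _ r hr hr' => absurd (hr.trans_le (hr'.trans hdiam)) (lt_irrefl _)⟩
  have hbd : Bornology.IsBounded E := by
    by_contra hb
    rw [diam_eq_zero_of_unbounded hb] at hdiam
    exact lt_irrefl _ hdiam
  have hEc : IsCompact E := isCompact_of_isClosed_isBounded hEclosed hbd
  have : CompactSpace E := isCompact_iff_compactSpace.mp hEc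
  have hEm : MeasurableSet E := hEclosed.measurableSet
  have hemb : MeasurableEmbedding (Subtype.val : E → EuclideanSpace ℝ (Fin n)) := MeasurableEmbedding.subtype_coe hEm
  set D := diam E with hD
  have hμE : ∀ S : Set (EuclideanSpace ℝ (Fin n)), μ (E ∩ S) = μ S := fun S => by
    refine le_antisymm (measure_mono Set.inter_subset_right) ?_
    calc μ S ≤ μ ((E ∩ S) ∪ Eᶜ) := measure_mono (fun y hy => by
            by_cases h : y ∈ E
            · exact Or.inl ⟨h, hy⟩
            · exact Or.inr h)
      _ ≤ μ (E ∩ S) + μ Eᶜ := measure_union_le _ _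
      _ = μ (E ∩ S) := by rw [hμsupp, add_zero]
  let ν : Measure E := μ.comap Subtype.val
  have hν : ∀ S : Set E, ν S = μ (Subtype.val '' S) := fun S => hemb.comap_apply μ S
  have hνb : ∀ (x : E) r, ν (ball x r) = μ (ball (x : EuclideanSpace ℝ (Fin n)) r) := fun x r => by
    rw [hν, ← hμE (ball _ _)]; refine congrArg μ (Set.ext fun y => ⟨?_, fun h => ⟨⟨y, h.1⟩, h.2, rfl⟩⟩)
    rintro ⟨a, ha, rfl⟩
    exact ⟨a.2, ha⟩
  have hνc : ∀ (x : E) r, ν (closedBall x r) = μ (E ∩ closedBall (x : EuclideanSpace ℝ (Fin n)) r) := fun x r => by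
    rw [hν]; refine congrArg μ (Set.ext fun y => ⟨?_, fun h => ⟨⟨y, h.1⟩, h.2, rfl⟩⟩)
    rintro ⟨a, ha, rfl⟩
    exact ⟨a.2, ha⟩
  have hfin : IsFiniteMeasure ν := by
    refine ⟨?_⟩
    obtain ⟨t, -, ht⟩ := (isCompact_univ (X := E)).elim_nhds_subcover (fun x => ball x D) (fun x _ => ball_mem_nhds x hdiam)
    refine (measure_mono ht).trans_lt ((measure_biUnion_finset_le _ _).trans_lt ?_)
    refine ENNReal.sum_lt_top.2 (fun x _ => ?_)
    rw [hνb]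
    exact (hreg x x.2 D hdiam le_rfl).2.trans_lt ENNReal.ofReal_lt_top
  have hR : AReg ν d (max C (ν.real Set.univ / D ^ d)) D := by
    refine ⟨lt_max_of_lt_left hC, hdiam, fun x r hr hrD => ?_, fun x r hr => ?_⟩
    · have h1 := (hreg x x.2 r hr hrD).1
      rw [← hνb, ← ofReal_measureReal, ENNReal.ofReal_le_ofReal_iff measureReal_nonneg] at h1
      refine le_trans ?_ h1
      gcongr
      exact le_max_left _ _
    · rcases le_or_gt r D with hrD | hrD
      · have h1 := (hreg x x.2 r hr hrD).2
        rw [← hνb, ← ofReal_measureReal, ENNReal.ofReal_le_ofReal_iff (by positivity)] at h1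
        refine h1.trans ?_
        gcongr
        exact le_max_left _ _
      · have h1 : ν.real (ball x r) ≤ ν.real Set.univ := measureReal_mono (Set.subset_univ _) (measure_ne_top _ _)
        have h2 : ν.real Set.univ = ν.real Set.univ / D ^ d * D ^ d := by
          field_simp
        calc _ ≤ _ := h1
          _ = _ := h2
          _ ≤ max C (ν.real Set.univ / D ^ d) * r ^ d := by
            gcongr
            exact le_max_right _ _
  have hL0 : 0 < L₁ := by linarith
  obtain ⟨k, hk, hmain⟩ := mainY hd1 hR hL₁ (r0 := L₁⁻¹ * D) (by positivity) (mk_llc hllc hL₁) (fun x => by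
    obtain ⟨V, hV, hx, W, hW, ⟨h⟩⟩ := hman x
    exact mk_chart x hV hx hW h)
  let e := EuclideanSpace.equiv (Fin d) ℝ
  obtain ⟨K1, hK1⟩ : ∃ K1, LipschitzWith K1 e.symm := ⟨_, e.symm.lipschitz⟩
  obtain ⟨K2, hK2⟩ : ∃ K2, LipschitzWith K2 e := ⟨_, e.lipschitz⟩
  set M := max 1 (max (k * K1) (k * K2)) with hM
  have hM1 : 1 ≤ M := le_max_left _ _
  have hMa : k * K1 ≤ M := (le_max_left _ _).trans (le_max_right _ _)
  have hMb : k * K2 ≤ M := (le_max_right _ _).trans (le_max_right _ _)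
  refine ⟨M, hM1, fun x hx r hr hrD => ?_⟩
  obtain ⟨A, f, hA, hAs, hf, hv⟩ := hmain ⟨x, hx⟩ r hr hrD
  refine ⟨Subtype.val '' A, (hA.isCompact.image continuous_subtype_val).isClosed, ?_, ?_, ?_⟩
  · rintro _ ⟨a, ha, rfl⟩
    exact ⟨a.2, hAs ha⟩
  · rw [← hν, ← hνc ⟨x, hx⟩ r, ← ofReal_measureReal (μ := ν) (s := A), ← ofReal_measureReal (μ := ν) (s := closedBall _ _)]
    have h9 : (9 / 10 : ENNReal) = ENNReal.ofReal (9 / 10) := by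
      rw [ENNReal.ofReal_div_of_pos (by norm_num)]; simp
    rw [h9, ← ENNReal.ofReal_mul (by norm_num)]
    exact ENNReal.ofReal_le_ofReal hv
  · have hmem : ∀ y : ↥(Subtype.val '' A), ∃ a : E, a ∈ A ∧ (a : EuclideanSpace ℝ (Fin n)) = y := fun y => y.2
    choose g hg hg' using hmem
    refine ⟨fun y => e.symm (f (g y)), fun y z => ?_⟩
    obtain ⟨h1, h2⟩ := hf _ (hg y) _ (hg z)
    have h3 : dist (g y) (g z) = dist (y : EuclideanSpace ℝ (Fin n)) z := by
      rw [Subtype.dist_eq, hg', hg']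
    rw [h3] at h1 h2
    have h4 := hK1.dist_le_mul (f (g y)) (f (g z))
    have h5 := hK2.dist_le_mul (e.symm (f (g y))) (e.symm (f (g z)))
    rw [e.apply_symm_apply, e.apply_symm_apply] at h5
    have hk0 : 0 ≤ k := by linarith
    constructor
    · rw [inv_mul_le_iff₀ (by linarith)]
      calc _ ≤ _ := h1
        _ ≤ k * (K2 * dist (e.symm (f (g y))) (e.symm (f (g z)))) := by gcongr
        _ = (k * K2) * dist (e.symm (f (g y))) (e.symm (f (g z))) := by ring
        _ ≤ _ := by gcongr
    · calc _ ≤ _ := h4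
        _ ≤ K1 * (k * dist (y : EuclideanSpace ℝ (Fin n)) z) := by gcongr
        _ = (k * K1) * dist (y : EuclideanSpace ℝ (Fin n)) z := by ring
        _ ≤ _ := by gcongr
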